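/- arXiv:0809.1960 — 2 statements merged into one kernel-verified Lean document; each statement's English description precedes it below -/
import Mathlib

section
/- Every cube tiling of ℝ⁴ contains a column; that is, if T ⊆ ℝ⁴ determines a cube tiling of ℝ⁴, then there exist s ∈ ℝ⁴ and a standard basis vector eᵢ of ℝ⁴ such that s + k·eᵢ ∈ T for every k ∈ ℤ. -/
/-- The half-open unit cube `[0,1)ⁿ` translated by `t`. -/
def Cube {n : ℕ} (t : Fin n → ℝ) : Set (Fin n → ℝ) :=
  {x | ∀ j, t j ≤ x j ∧ x j < t j + 1}

/-- `T` determines a cube tiling of `ℝⁿ`: the cubes `[0,1)ⁿ + t`, `t ∈ T`,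
are pairwise disjoint and their union is all of `ℝⁿ`. -/
def IsCubeTiling {n : ℕ} (T : Set (Fin n → ℝ)) : Prop :=
  (∀ s ∈ T, ∀ t ∈ T, s ≠ t → Disjoint (Cube s) (Cube t)) ∧
  (⋃ t ∈ T, Cube t) = Set.univ

/-- `T ⊆ ℝ` determines a tiling of `ℝ` by unit intervals `[0,1) + t`. -/
def IsCubeTiling1 (T : Set ℝ) : Prop :=
  (∀ s ∈ T, ∀ t ∈ T, s ≠ t → Disjoint (Set.Ico s (s + 1)) (Set.Ico t (t + 1))) ∧
  (⋃ t ∈ T, Set.Ico t (t + 1)) = Set.univ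

/-- The tiling determined by `T` contains a column: there are `s ∈ ℝⁿ` and a
standard basis vector `eᵢ` such that `s + k·eᵢ ∈ T` for every `k ∈ ℤ`. -/
def ContainsColumn {n : ℕ} (T : Set (Fin n → ℝ)) : Prop :=
  ∃ s : Fin n → ℝ, ∃ i : Fin n, ∀ k : ℤ, (s + (k : ℝ) • (Pi.single i 1 : Fin n → ℝ)) ∈ T

/-- A natural code of `ℝⁿ`: each `ε j : ℝ → ℕ⁺` restricts to a bijection from
every coset `x + ℤ` onto the positive integers. -/
def IsNaturalCode {n : ℕ} (ε : Fin n → ℝ → ℕ+) : Prop :=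
  ∀ j : Fin n, ∀ x : ℝ, Set.BijOn (ε j) {y : ℝ | ∃ m : ℤ, y = x + m} Set.univ

theorem caseA {α β : Type*} (f0 f1 f2 f3 : α → α → α → β)
    (K01 : ∀ x x' y y' z w : α, f0 y z w = f0 y' z w ∨ f1 x z w = f1 x' z w)
    (K02 : ∀ x x' y z z' w : α, f0 y z w = f0 y z' w ∨ f2 x y w = f2 x' y w)
    (K03 : ∀ x x' y z w w' : α, f0 y z w = f0 y z w' ∨ f3 x y z = f3 x' y z)
    (K12 : ∀ x y y' z z' w : α, f1 x z w = f1 x z' w ∨ f2 x y w = f2 x y' w)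
    (K13 : ∀ x y y' z w w' : α, f1 x z w = f1 x z w' ∨ f3 x y z = f3 x y' z)
    (K23 : ∀ x y z z' w w' : α, f2 x y w = f2 x y w' ∨ f3 x y z = f3 x y z')
    (K012 : ∀ x x' y y' z z' w : α, f0 y z w = f0 y' z' w ∨ f1 x z w = f1 x' z' w ∨ f2 x y w = f2 x' y' w)
    (K013 : ∀ x x' y y' z w w' : α, f0 y z w = f0 y' z w' ∨ f1 x z w = f1 x' z w' ∨ f3 x y z = f3 x' y' z)
    (K023 : ∀ x x' y z z' w w' : α, f0 y z w = f0 y z' w' ∨ f2 x y w = f2 x' y w' ∨ f3 x y z = f3 x' y z')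
    (K123 : ∀ x y y' z z' w w' : α, f1 x z w = f1 x z' w' ∨ f2 x y w = f2 x y' w' ∨ f3 x y z = f3 x y' z')
    (K0123 : ∀ x x' y y' z z' w w' : α, f0 y z w = f0 y' z' w' ∨ f1 x z w = f1 x' z' w' ∨ f2 x y w = f2 x' y' w' ∨ f3 x y z = f3 x' y' z')
    (x0 x1 y0 y1 y2 z0 z1 z2 w0 w1 w2 : α)
    (hw0 : f1 x0 z0 w0 ≠ f1 x1 z0 w0)
    (hw1 : f2 x0 y0 w0 ≠ f2 x0 y1 w0)
    (hw2 : f3 x0 y0 z0 ≠ f3 x0 y0 z1)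
    (hw3 : f0 y0 z0 w0 ≠ f0 y0 z0 w1)
    (hw4 : f0 y0 z0 w0 ≠ f0 y2 z0 w0 ∨ f2 x1 y0 w0 ≠ f2 x1 y2 w0 ∨ f3 x1 y0 z0 ≠ f3 x1 y2 z0)
    (hw5 : f0 y0 z1 w0 ≠ f0 y0 z1 w2 ∨ f1 x0 z1 w0 ≠ f1 x0 z1 w2 ∨ f2 x0 y0 w0 ≠ f2 x0 y0 w2)
    (hw6 : f0 y1 z0 w0 ≠ f0 y1 z2 w0 ∨ f1 x0 z0 w0 ≠ f1 x0 z2 w0 ∨ f3 x0 y1 z0 ≠ f3 x0 y1 z2) : False := by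
  have h0 := K123 x0 y0 y1 z0 z1 w1 w0
  have h1 := K123 x0 y0 y1 z0 z2 w1 w0
  have h2 := K12 x0 y0 y1 z0 z2 w0
  have h3 := K23 x1 y2 z0 z1 w0 w2
  have h4 := K0123 x0 x1 y0 y1 z1 z0 w2 w0
  have h5 := K123 x1 y0 y2 z0 z1 w0 w2
  have h6 := K12 x1 y0 y2 z0 z2 w0
  have h7 := K12 x1 y0 y2 z0 z1 w0
  have h8 := K13 x0 y0 y1 z1 w0 w2
  have h9 := K013 x1 x0 y0 y1 z1 w2 w0
  have h10 := K03 x0 x1 y0 z0 w0 w1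
  have h11 := K23 x0 y0 z0 z1 w0 w2
  have h12 := K23 x0 y0 z0 z1 w0 w1
  have h13 := K13 x0 y0 y1 z0 w0 w1
  have h14 := K23 x0 y1 z0 z2 w0 w2
  have h15 := K012 x0 x1 y0 y1 z0 z2 w0
  have h16 := K01 x0 x1 y1 y2 z0 w0
  have h17 := K02 x0 x1 y1 z0 z2 w0
  have h18 := K023 x0 x1 y0 z0 z1 w1 w0
  have h19 := K123 x0 y0 y1 z1 z2 w2 w0
  have h20 := K012 x1 x0 y0 y1 z0 z2 w0
  have h21 := K12 x0 y0 y1 z0 z1 w0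
  have h22 := K01 x0 x1 y0 y2 z0 w0
  have h23 := K012 x0 x1 y0 y1 z1 z0 w0
  have h24 := K01 x0 x1 y0 y2 z1 w0
  have h25 := K013 x0 x1 y0 y2 z0 w1 w0
  have h26 := K013 x0 x1 y0 y2 z1 w2 w0
  have h27 := K123 x0 y1 y0 z0 z1 w0 w2
  have h28 := K01 x0 x1 y0 y1 z1 w2
  have h29 := K02 x0 x1 y1 z0 z1 w0
  have h30 := K023 x1 x0 y1 z0 z1 w0 w2
  have h31 := K013 x0 x1 y0 y1 z0 w1 w0
  have h32 := K03 x0 x1 y0 z1 w0 w2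
  have h33 := K01 x0 x1 y0 y1 z1 w0
  clear K01 K02 K03 K12 K13 K23 K012 K013 K023 K123 K0123
  grind

theorem caseB {α β : Type*} (f0 f1 f2 f3 : α → α → α → β)
    (K01 : ∀ x x' y y' z w : α, f0 y z w = f0 y' z w ∨ f1 x z w = f1 x' z w)
    (K02 : ∀ x x' y z z' w : α, f0 y z w = f0 y z' w ∨ f2 x y w = f2 x' y w)
    (K03 : ∀ x x' y z w w' : α, f0 y z w = f0 y z w' ∨ f3 x y z = f3 x' y z)
    (K12 : ∀ x y y' z z' w : α, f1 x z w = f1 x z' w ∨ f2 x y w = f2 x y' w)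
    (K13 : ∀ x y y' z w w' : α, f1 x z w = f1 x z w' ∨ f3 x y z = f3 x y' z)
    (K23 : ∀ x y z z' w w' : α, f2 x y w = f2 x y w' ∨ f3 x y z = f3 x y z')
    (K012 : ∀ x x' y y' z z' w : α, f0 y z w = f0 y' z' w ∨ f1 x z w = f1 x' z' w ∨ f2 x y w = f2 x' y' w)
    (K013 : ∀ x x' y y' z w w' : α, f0 y z w = f0 y' z w' ∨ f1 x z w = f1 x' z w' ∨ f3 x y z = f3 x' y' z)
    (K023 : ∀ x x' y z z' w w' : α, f0 y z w = f0 y z' w' ∨ f2 x y w = f2 x' y w' ∨ f3 x y z = f3 x' y z')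
    (K123 : ∀ x y y' z z' w w' : α, f1 x z w = f1 x z' w' ∨ f2 x y w = f2 x y' w' ∨ f3 x y z = f3 x y' z')
    (K0123 : ∀ x x' y y' z z' w w' : α, f0 y z w = f0 y' z' w' ∨ f1 x z w = f1 x' z' w' ∨ f2 x y w = f2 x' y' w' ∨ f3 x y z = f3 x' y' z')
    (x0 x1 x2 y0 y1 y2 z0 z1 z2 w0 w1 : α)
    (hw0 : f1 x0 z0 w0 ≠ f1 x1 z0 w0)
    (hw1 : f2 x0 y0 w0 ≠ f2 x0 y1 w0)
    (hw2 : f0 y0 z0 w0 ≠ f0 y0 z1 w0)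
    (hw3 : f0 y0 z0 w0 ≠ f0 y0 z0 w1)
    (hw4 : f0 y0 z0 w0 ≠ f0 y2 z0 w0 ∨ f2 x1 y0 w0 ≠ f2 x1 y2 w0 ∨ f3 x1 y0 z0 ≠ f3 x1 y2 z0)
    (hw5 : f1 x0 z0 w1 ≠ f1 x2 z0 w1 ∨ f2 x0 y0 w1 ≠ f2 x2 y0 w1 ∨ f3 x0 y0 z0 ≠ f3 x2 y0 z0)
    (hw6 : f0 y1 z0 w0 ≠ f0 y1 z2 w0 ∨ f1 x0 z0 w0 ≠ f1 x0 z2 w0 ∨ f3 x0 y1 z0 ≠ f3 x0 y1 z2) : False := by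
  have h0 := K12 x0 y0 y1 z1 z2 w0
  have h1 := K0123 x2 x0 y0 y1 z0 z2 w1 w0
  have h2 := K012 x1 x0 y0 y1 z0 z2 w0
  have h3 := K013 x1 x0 y0 y1 z0 w1 w0
  have h4 := K013 x0 x1 y0 y2 z0 w1 w0
  have h5 := K123 x0 y0 y1 z0 z2 w1 w0
  have h6 := K13 x1 y0 y2 z0 w0 w1
  have h7 := K013 x2 x1 y0 y2 z0 w1 w0
  have h8 := K12 x0 y0 y1 z0 z2 w0
  have h9 := K012 x0 x1 y0 y2 z1 z0 w0
  have h10 := K03 x0 x1 y0 z0 w0 w1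
  have h11 := K03 x0 x2 y0 z0 w0 w1
  have h12 := K01 x0 x1 y0 y2 z0 w0
  have h13 := K01 x0 x1 y0 y1 z0 w0
  have h14 := K12 x0 y0 y1 z0 z1 w0
  have h15 := K02 x0 x1 y0 z0 z1 w0
  have h16 := K03 x1 x2 y0 z0 w0 w1
  clear K01 K02 K03 K12 K13 K23 K012 K013 K023 K123 K0123
  grind

/-- The point of `ℤ⁴` with prescribed coordinates `x, y, z, w` at the (distinct) indices
`a, b, c` and the remaining index. -/
def pt (a b c : Fin 4) (x y z w : ℤ) : Fin 4 → ℤ :=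
  fun i => if i = a then x else if i = b then y else if i = c then z else w

/-- Up to relabelling, a map of a 4-element set without fixed points and 2-cycles is a
4-cycle or a 3-cycle with a tail. -/
theorem graph_shape : ∀ j0 j1 j2 j3 : Fin 4,
    (∀ i : Fin 4, ![j0, j1, j2, j3] i ≠ i ∧ ![j0, j1, j2, j3] (![j0, j1, j2, j3] i) ≠ i) →
    ∃ a b c d : Fin 4, (a ≠ b ∧ a ≠ c ∧ a ≠ d ∧ b ≠ c ∧ b ≠ d ∧ c ≠ d) ∧
      ![j0, j1, j2, j3] a = b ∧ ![j0, j1, j2, j3] b = c ∧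
      ((![j0, j1, j2, j3] c = d ∧ ![j0, j1, j2, j3] d = a) ∨
       (![j0, j1, j2, j3] c = a ∧ ![j0, j1, j2, j3] d = a)) := by
  decide +kernel

theorem graph_shape' (g : Fin 4 → Fin 4) (hg : ∀ i, g i ≠ i ∧ g (g i) ≠ i) :
    ∃ a b c d : Fin 4, (a ≠ b ∧ a ≠ c ∧ a ≠ d ∧ b ≠ c ∧ b ≠ d ∧ c ≠ d) ∧
      g a = b ∧ g b = c ∧ ((g c = d ∧ g d = a) ∨ (g c = a ∧ g d = a)) := by
  have h : ![g 0, g 1, g 2, g 3] = g := by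
    funext i; fin_cases i <;> rfl
  have := graph_shape (g 0) (g 1) (g 2) (g 3)
  rw [h] at this
  exact this hg

theorem cover4 : ∀ a b c d : Fin 4, (a ≠ b ∧ a ≠ c ∧ a ≠ d ∧ b ≠ c ∧ b ≠ d ∧ c ≠ d) →
    ∀ i, i = a ∨ i = b ∨ i = c ∨ i = d := by
  decide +kernel

/-- Combinatorial core: a Keller function on `ℤ⁴` is constant on some line. -/
theorem comb_core (F : Fin 4 → (Fin 4 → ℤ) → ℝ)
    (hK : ∀ z z' : Fin 4 → ℤ, z ≠ z' → ∃ i, z i ≠ z' i ∧ F i z = F i z') :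
    ∃ (i : Fin 4) (p : Fin 4 → ℤ), ∀ (k : ℤ) (j : Fin 4), F j (Function.update p i k) = F j p := by
  by_contra hcon
  push Not at hcon
  choose k g hg using fun i => hcon i 0
  -- the function with index `i` does not depend on coordinate `i`
  have hself : ∀ (i : Fin 4) (p : Fin 4 → ℤ) (m : ℤ), F i (Function.update p i m) = F i p := by
    intro i p m
    by_cases h : Function.update p i m = p
    · rw [h]
    · obtain ⟨l, hl, hl'⟩ := hK _ _ h
      by_cases hli : l = i
      · subst hli; exact hl'
      · simp [Function.update_of_ne hli] at hl
  have hg2 : ∀ i, g i ≠ i ∧ g (g i) ≠ i := by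
    intro i
    have h1 : g i ≠ i := fun h => hg i (by rw [h]; exact hself i 0 _)
    refine ⟨h1, fun h2 => ?_⟩
    by_cases hne : Function.update (0 : Fin 4 → ℤ) i (k i) = Function.update (0 : Fin 4 → ℤ) (g i) (k (g i))
    · apply hg i
      rw [hne]
      exact hself (g i) 0 _
    · obtain ⟨l, hl, hl'⟩ := hK _ _ hne
      by_cases hli : l = i
      · subst hli
        rw [hself] at hl'
        apply hg (g l)
        rw [h2, ← hl']
      · by_cases hlg : l = g i
        · rw [hlg, hself] at hl'
          exact hg i hl'
        · simp [Function.update_of_ne hli, Function.update_of_ne hlg] at hl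
  obtain ⟨a, b, c, d, hd, hab, hbc, hcase⟩ := graph_shape' g hg2
  have hcov := cover4 a b c d hd
  obtain ⟨nab, nac, nad, nbc, nbd, ncd⟩ := hd
  have ea : ∀ x y z w, pt a b c x y z w a = x := by intros; simp [pt]
  have eb : ∀ x y z w, pt a b c x y z w b = y := by intros; simp [pt, nab.symm]
  have ec : ∀ x y z w, pt a b c x y z w c = z := by intros; simp [pt, nac.symm, nbc.symm]
  have ed : ∀ x y z w, pt a b c x y z w d = w := by
    intros; simp [pt, nad.symm, nbd.symm, ncd.symm]
  have ext4 : ∀ p q : Fin 4 → ℤ, p a = q a → p b = q b → p c = q c → p d = q d → p = q := by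
    intro p q h1 h2 h3 h4
    funext i
    rcases hcov i with h | h | h | h <;> rw [h] <;> assumption
  have e0 : pt a b c 0 0 0 0 = 0 := by funext i; simp [pt]
  have ua : ∀ x y z w m, Function.update (pt a b c x y z w) a m = pt a b c m y z w := by
    intro x y z w m
    apply ext4 <;> simp [ea, eb, ec, ed, Function.update_of_ne, nab.symm, nac.symm, nad.symm]
  have ub : ∀ x y z w m, Function.update (pt a b c x y z w) b m = pt a b c x m z w := by
    intro x y z w m
    apply ext4 <;> simp [ea, eb, ec, ed, Function.update_of_ne, nab, nbc.symm, nbd.symm]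
  have uc : ∀ x y z w m, Function.update (pt a b c x y z w) c m = pt a b c x y m w := by
    intro x y z w m
    apply ext4 <;> simp [ea, eb, ec, ed, Function.update_of_ne, nac, nbc, ncd.symm]
  have ud : ∀ x y z w m, Function.update (pt a b c x y z w) d m = pt a b c x y z m := by
    intro x y z w m
    apply ext4 <;> simp [ea, eb, ec, ed, Function.update_of_ne, nad, nbd, ncd]
  have fa : ∀ x y z w, F a (pt a b c x y z w) = F a (pt a b c 0 y z w) := by
    intro x y z w; rw [← ua 0 y z w x, hself]
  have fb : ∀ x y z w, F b (pt a b c x y z w) = F b (pt a b c x 0 z w) := by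
    intro x y z w; rw [← ub x 0 z w y, hself]
  have fc : ∀ x y z w, F c (pt a b c x y z w) = F c (pt a b c x y 0 w) := by
    intro x y z w; rw [← uc x y 0 w z, hself]
  have fd : ∀ x y z w, F d (pt a b c x y z w) = F d (pt a b c x y z 0) := by
    intro x y z w; rw [← ud x y z 0 w, hself]
  obtain ⟨f0, hf0⟩ : ∃ f0 : ℤ → ℤ → ℤ → ℝ, ∀ x y z w, F a (pt a b c x y z w) = f0 y z w :=
    ⟨_, fa⟩
  obtain ⟨f1, hf1⟩ : ∃ f1 : ℤ → ℤ → ℤ → ℝ, ∀ x y z w, F b (pt a b c x y z w) = f1 x z w :=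
    ⟨_, fb⟩
  obtain ⟨f2, hf2⟩ : ∃ f2 : ℤ → ℤ → ℤ → ℝ, ∀ x y z w, F c (pt a b c x y z w) = f2 x y w :=
    ⟨_, fc⟩
  obtain ⟨f3, hf3⟩ : ∃ f3 : ℤ → ℤ → ℤ → ℝ, ∀ x y z w, F d (pt a b c x y z w) = f3 x y z :=
    ⟨_, fd⟩
  have K : ∀ x y z w x' y' z' w', (x = x' ∧ y = y' ∧ z = z' ∧ w = w') ∨
      (x ≠ x' ∧ f0 y z w = f0 y' z' w') ∨ (y ≠ y' ∧ f1 x z w = f1 x' z' w') ∨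
      (z ≠ z' ∧ f2 x y w = f2 x' y' w') ∨ (w ≠ w' ∧ f3 x y z = f3 x' y' z') := by
    intro x y z w x' y' z' w'
    by_cases h : pt a b c x y z w = pt a b c x' y' z' w'
    · left
      refine ⟨?_, ?_, ?_, ?_⟩
      · simpa [ea] using congrFun h a
      · simpa [eb] using congrFun h b
      · simpa [ec] using congrFun h c
      · simpa [ed] using congrFun h d
    · right
      obtain ⟨i, hi, hi'⟩ := hK _ _ h
      rcases hcov i with h | h | h | h <;> subst h
      · simp only [ea, hf0] at hi hi'; tauto
      · simp only [eb, hf1] at hi hi'; tauto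
      · simp only [ec, hf2] at hi hi'; tauto
      · simp only [ed, hf3] at hi hi'; tauto
  -- witnesses for lines
  have La : ∀ y z w, ∃ m, f1 0 z w ≠ f1 m z w ∨ f2 0 y w ≠ f2 m y w ∨ f3 0 y z ≠ f3 m y z := by
    intro y z w
    obtain ⟨m, j, hj⟩ := hcon a (pt a b c 0 y z w)
    rw [ua] at hj
    refine ⟨m, ?_⟩
    rcases hcov j with h | h | h | h <;> rw [h] at hj <;> simp only [hf0, hf1, hf2, hf3] at hj <;>
      first | exact absurd rfl hj | (have := hj.symm; tauto)
  have Lb : ∀ x z w, ∃ m, f0 0 z w ≠ f0 m z w ∨ f2 x 0 w ≠ f2 x m w ∨ f3 x 0 z ≠ f3 x m z := by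
    intro x z w
    obtain ⟨m, j, hj⟩ := hcon b (pt a b c x 0 z w)
    rw [ub] at hj
    refine ⟨m, ?_⟩
    rcases hcov j with h | h | h | h <;> rw [h] at hj <;> simp only [hf0, hf1, hf2, hf3] at hj <;>
      first | exact absurd rfl hj | (have := hj.symm; tauto)
  have Lc : ∀ x y w, ∃ m, f0 y 0 w ≠ f0 y m w ∨ f1 x 0 w ≠ f1 x m w ∨ f3 x y 0 ≠ f3 x y m := by
    intro x y w
    obtain ⟨m, j, hj⟩ := hcon c (pt a b c x y 0 w)
    rw [uc] at hj
    refine ⟨m, ?_⟩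
    rcases hcov j with h | h | h | h <;> rw [h] at hj <;> simp only [hf0, hf1, hf2, hf3] at hj <;>
      first | exact absurd rfl hj | (have := hj.symm; tauto)
  have Ld : ∀ x y z, ∃ m, f0 y z 0 ≠ f0 y z m ∨ f1 x z 0 ≠ f1 x z m ∨ f2 x y 0 ≠ f2 x y m := by
    intro x y z
    obtain ⟨m, j, hj⟩ := hcon d (pt a b c x y z 0)
    rw [ud] at hj
    refine ⟨m, ?_⟩
    rcases hcov j with h | h | h | h <;> rw [h] at hj <;> simp only [hf0, hf1, hf2, hf3] at hj <;>
      first | exact absurd rfl hj | (have := hj.symm; tauto)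
  have ga := hg a
  have gb := hg b
  have gc := hg c
  have gd := hg d
  rw [← e0, ua, hab, hf1, hf1] at ga
  rw [← e0, ub, hbc, hf2, hf2] at gb
  rw [← e0, uc] at gc
  rw [← e0, ud] at gd
  obtain ⟨y2, hy2⟩ := Lb (k a) 0 0
  obtain ⟨z2, hz2⟩ := Lc 0 (k b) 0
  rcases hcase with ⟨h1, h2⟩ | ⟨h1, h2⟩
  · rw [h1, hf3, hf3] at gc
    rw [h2, hf0, hf0] at gd
    obtain ⟨w2, hw2⟩ := Ld 0 0 (k c)
    refine caseA f0 f1 f2 f3 ?_ ?_ ?_ ?_ ?_ ?_ ?_ ?_ ?_ ?_ ?_ 0 (k a) 0 (k b) y2 0 (k c) z2 0 (k d) w2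
      ga.symm gb.symm gc.symm gd.symm hy2 hw2 hz2
    · intro x x' y y' z w; have := K x y z w x' y' z w; grind
    · intro x x' y z z' w; have := K x y z w x' y z' w; grind
    · intro x x' y z w w'; have := K x y z w x' y z w'; grind
    · intro x y y' z z' w; have := K x y z w x y' z' w; grind
    · intro x y y' z w w'; have := K x y z w x y' z w'; grind
    · intro x y z z' w w'; have := K x y z w x y z' w'; grind
    · intro x x' y y' z z' w; have := K x y z w x' y' z' w; grind
    · intro x x' y y' z w w'; have := K x y z w x' y' z w'; grind
    · intro x x' y z z' w w'; have := K x y z w x' y z' w'; grind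
    · intro x y y' z z' w w'; have := K x y z w x y' z' w'; grind
    · intro x x' y y' z z' w w'; have := K x y z w x' y' z' w'; grind
  · rw [h1, hf0, hf0] at gc
    rw [h2, hf0, hf0] at gd
    obtain ⟨x2, hx2⟩ := La 0 0 (k d)
    refine caseB f0 f1 f2 f3 ?_ ?_ ?_ ?_ ?_ ?_ ?_ ?_ ?_ ?_ ?_ 0 (k a) x2 0 (k b) y2 0 (k c) z2 0 (k d)
      ga.symm gb.symm gc.symm gd.symm hy2 hx2 hz2
    · intro x x' y y' z w; have := K x y z w x' y' z w; grind
    · intro x x' y z z' w; have := K x y z w x' y z' w; grind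
    · intro x x' y z w w'; have := K x y z w x' y z w'; grind
    · intro x y y' z z' w; have := K x y z w x y' z' w; grind
    · intro x y y' z w w'; have := K x y z w x y' z w'; grind
    · intro x y z z' w w'; have := K x y z w x y z' w'; grind
    · intro x x' y y' z z' w; have := K x y z w x' y' z' w; grind
    · intro x x' y y' z w w'; have := K x y z w x' y' z w'; grind
    · intro x x' y z z' w w'; have := K x y z w x' y z' w'; grind
    · intro x y y' z z' w w'; have := K x y z w x y' z' w'; grind
    · intro x x' y y' z z' w w'; have := K x y z w x' y' z' w'; grind

/-- An indexed cube tiling. -/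
def FamTiling {n : ℕ} {ι : Type*} (τ : ι → Fin n → ℝ) : Prop :=
  (∀ x : Fin n → ℝ, ∃ u, x ∈ Cube (τ u)) ∧
  (∀ u v (x : Fin n → ℝ), x ∈ Cube (τ u) → x ∈ Cube (τ v) → u = v)

/-- Membership in a cube for a point whose `i`-th coordinate was changed. -/
theorem mem_update {n : ℕ} (t x : Fin n → ℝ) (i : Fin n) (r : ℝ) :
    Function.update x i r ∈ Cube t ↔
      (t i ≤ r ∧ r < t i + 1) ∧ ∀ j, j ≠ i → t j ≤ x j ∧ x j < t j + 1 := by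
  constructor
  · intro h
    refine ⟨by simpa using h i, fun j hj => ?_⟩
    have := h j
    rwa [Function.update_of_ne hj] at this
  · rintro ⟨h1, h2⟩ j
    by_cases hj : j = i
    · subst hj; simpa using h1
    · rw [Function.update_of_ne hj]; exact h2 j hj

/-- Cubes of a tiling meeting a line parallel to `eᵢ` follow each other at unit distance. -/
theorem line_succ {n : ℕ} {ι : Type*} {τ : ι → Fin n → ℝ} (h : FamTiling τ) (i : Fin n)
    (x : Fin n → ℝ) (u : ι) (hu : ∀ j, j ≠ i → τ u j ≤ x j ∧ x j < τ u j + 1) (m : ℕ) :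
    ∃ v, (∀ j, j ≠ i → τ v j ≤ x j ∧ x j < τ v j + 1) ∧ τ v i = τ u i + m := by
  induction m with
  | zero => exact ⟨u, hu, by simp⟩
  | succ m ih =>
    obtain ⟨v, hv, hvi⟩ := ih
    obtain ⟨w, hw⟩ := h.1 (Function.update x i (τ v i + 1))
    rw [mem_update] at hw
    obtain ⟨⟨hw1, hw2⟩, hw3⟩ := hw
    refine ⟨w, hw3, ?_⟩
    rcases hw1.lt_or_eq with hlt | heq
    · exfalso
      have : v = w := h.2 v w (Function.update x i (τ w i))
        ((mem_update _ _ _ _).2 ⟨⟨by linarith, hlt⟩, hv⟩)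
        ((mem_update _ _ _ _).2 ⟨⟨le_rfl, by linarith⟩, hw3⟩)
      subst this
      linarith
    · rw [heq, hvi]; push_cast; ring

theorem line_congr_aux {n : ℕ} {ι : Type*} {τ : ι → Fin n → ℝ} (h : FamTiling τ) (i : Fin n)
    (x : Fin n → ℝ) (u v : ι) (hu : ∀ j, j ≠ i → τ u j ≤ x j ∧ x j < τ u j + 1)
    (hv : ∀ j, j ≠ i → τ v j ≤ x j ∧ x j < τ v j + 1) (huv : τ u i ≤ τ v i) :
    ∃ m : ℤ, τ v i - τ u i = m := by
  obtain ⟨w, hw, hwi⟩ := line_succ h i x u hu ⌊τ v i - τ u i⌋₊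
  have h1 := Nat.floor_le (sub_nonneg.2 huv)
  have h2 := Nat.lt_floor_add_one (τ v i - τ u i)
  have : v = w := h.2 v w (Function.update x i (τ v i))
    ((mem_update _ _ _ _).2 ⟨⟨le_rfl, by linarith⟩, hv⟩)
    ((mem_update _ _ _ _).2 ⟨⟨by linarith, by linarith⟩, hw⟩)
  subst this
  exact ⟨(⌊τ v i - τ u i⌋₊ : ℤ), by push_cast; linarith⟩

theorem line_congr {n : ℕ} {ι : Type*} {τ : ι → Fin n → ℝ} (h : FamTiling τ) (i : Fin n)
    (x : Fin n → ℝ) (u v : ι) (hu : ∀ j, j ≠ i → τ u j ≤ x j ∧ x j < τ u j + 1)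
    (hv : ∀ j, j ≠ i → τ v j ≤ x j ∧ x j < τ v j + 1) :
    ∃ m : ℤ, τ v i - τ u i = m := by
  rcases le_total (τ u i) (τ v i) with huv | huv
  · exact line_congr_aux h i x u v hu hv huv
  · obtain ⟨m, hm⟩ := line_congr_aux h i x v u hv hu huv
    exact ⟨-m, by push_cast; linarith⟩

open Classical in
/-- Shift by `δ` along `eᵢ` all cubes whose `i`-th coordinate is congruent to `c` mod 1. -/
noncomputable def shiftFam {n : ℕ} {ι : Type*} (τ : ι → Fin n → ℝ) (i : Fin n) (c δ : ℝ) :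
    ι → Fin n → ℝ :=
  fun u => if ∃ m : ℤ, τ u i - c = m then Function.update (τ u) i (τ u i + δ) else τ u

theorem shift_tiling {n : ℕ} {ι : Type*} {τ : ι → Fin n → ℝ} (h : FamTiling τ) (i : Fin n)
    (c δ : ℝ) : FamTiling (shiftFam τ i c δ) := by
  have hin : ∀ u (x : Fin n → ℝ), (∃ m : ℤ, τ u i - c = m) →
      (x ∈ Cube (shiftFam τ i c δ u) ↔ Function.update x i (x i - δ) ∈ Cube (τ u)) := by
    intro u x hu
    rw [mem_update, shiftFam, if_pos hu]
    constructor
    · intro hx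
      refine ⟨?_, fun j hj => ?_⟩
      · have := hx i
        rw [Function.update_self] at this
        constructor <;> linarith [this.1, this.2]
      · have := hx j
        rwa [Function.update_of_ne hj] at this
    · rintro ⟨h1, h2⟩ j
      by_cases hj : j = i
      · subst hj
        rw [Function.update_self]
        constructor <;> linarith [h1.1, h1.2]
      · rw [Function.update_of_ne hj]; exact h2 j hj
  have hout : ∀ u, (¬ ∃ m : ℤ, τ u i - c = m) → shiftFam τ i c δ u = τ u := by
    intro u hu
    rw [shiftFam, if_neg hu]
  have hcl : ∀ u v (x : Fin n → ℝ), (∀ j, j ≠ i → τ u j ≤ x j ∧ x j < τ u j + 1) →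
      (∀ j, j ≠ i → τ v j ≤ x j ∧ x j < τ v j + 1) → (∃ m : ℤ, τ u i - c = m) →
      (∃ m : ℤ, τ v i - c = m) := by
    rintro u v x hu hv ⟨m, hm⟩
    obtain ⟨m', hm'⟩ := line_congr h i x u v hu hv
    exact ⟨m + m', by push_cast; linarith⟩
  constructor
  · intro x
    obtain ⟨u, hu⟩ := h.1 x
    by_cases hc : ∃ m : ℤ, τ u i - c = m
    · obtain ⟨v, hv⟩ := h.1 (Function.update x i (x i - δ))
      have hv' := (mem_update _ _ _ _).1 hv
      exact ⟨v, (hin v x (hcl u v x (fun j _ => hu j) hv'.2 hc)).2 hv⟩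
    · exact ⟨u, by rw [hout u hc]; exact hu⟩
  · intro u v x hu hv
    have key : ∀ u, x ∈ Cube (shiftFam τ i c δ u) → ∀ j, j ≠ i → τ u j ≤ x j ∧ x j < τ u j + 1 := by
      intro u hu
      by_cases hc : ∃ m : ℤ, τ u i - c = m
      · exact ((mem_update _ _ _ _).1 ((hin u x hc).1 hu)).2
      · rw [hout u hc] at hu
        exact fun j _ => hu j
    by_cases hc : ∃ m : ℤ, τ u i - c = m
    · have hc' := hcl u v x (key u hu) (key v hv) hc
      exact h.2 u v _ ((hin u x hc).1 hu) ((hin v x hc').1 hv)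
    · have hc' : ¬ ∃ m : ℤ, τ v i - c = m := fun hc' =>
        hc (hcl v u x (key v hv) (key u hu) hc')
      rw [hout u hc] at hu
      rw [hout v hc'] at hv
      exact h.2 u v x hu hv

/-- The theorem of Keller on cube tilings. -/
theorem keller {n : ℕ} {ι : Type*} (N : ℕ) : ∀ (τ : ι → Fin n → ℝ), FamTiling τ → ∀ u v : ι,
    u ≠ v → (Finset.univ.filter fun j => τ u j ≠ τ v j).card = N →
    ∃ i, ∃ m : ℤ, m ≠ 0 ∧ τ u i - τ v i = m := by
  induction N using Nat.strong_induction_on with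
  | _ N ih =>
    intro τ h u v huv hcard
    by_contra hcon
    push Not at hcon
    by_cases hex : ∃ i, τ u i ≠ τ v i
    · obtain ⟨i, hi⟩ := hex
      have hui : ¬ ∃ m : ℤ, τ u i - τ v i = m := by
        rintro ⟨m, hm⟩
        refine hcon i m ?_ hm
        rintro rfl
        apply hi
        simpa [sub_eq_zero] using hm
      have hu' : shiftFam τ i (τ v i) (τ u i - τ v i) u = τ u := by
        rw [shiftFam, if_neg hui]
      have hv' : shiftFam τ i (τ v i) (τ u i - τ v i) v = Function.update (τ v) i (τ u i) := by
        rw [shiftFam, if_pos ⟨0, by simp⟩]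
        congr 1
        ring
      have hlt : (Finset.univ.filter fun j => shiftFam τ i (τ v i) (τ u i - τ v i) u j ≠
          shiftFam τ i (τ v i) (τ u i - τ v i) v j).card < N := by
        rw [← hcard]
        apply Finset.card_lt_card
        rw [Finset.ssubset_iff_of_subset]
        · refine ⟨i, by simpa using hi, ?_⟩
          simp [hu', hv']
        · intro j
          simp only [Finset.mem_filter, Finset.mem_univ, true_and, hu', hv']
          intro hj
          by_cases hji : j = i
          · subst hji; exact hi
          · rwa [Function.update_of_ne hji] at hj
      obtain ⟨l, m, hm, hl⟩ := ih _ hlt _ (shift_tiling h i (τ v i) (τ u i - τ v i)) u v huv rfl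
      rw [hu', hv'] at hl
      by_cases hli : l = i
      · subst hli
        rw [Function.update_self, sub_self] at hl
        exact hm (by exact_mod_cast hl.symm)
      · rw [Function.update_of_ne hli] at hl
        exact hcon l m hm hl
    · push Not at hex
      apply huv
      have hmem : ∀ t : Fin n → ℝ, t ∈ Cube t := fun t j => ⟨le_rfl, by linarith⟩
      refine h.2 u v (τ u) (hmem _) ?_
      rw [funext hex]
      exact hmem _

/-- Every cube tiling of ℝ^4 contains a column. -/
theorem cube_tiling_dim4_contains_column (T : Set (Fin 4 → ℝ)) (hT : IsCubeTiling T) :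
    ∃ s : Fin 4 → ℝ, ∃ i : Fin 4, ∀ k : ℤ, (s + (k : ℝ) • (Pi.single i 1 : Fin 4 → ℝ)) ∈ T := by
  have hfam : FamTiling (fun t : T => (t : Fin 4 → ℝ)) := by
    constructor
    · intro x
      have hx : x ∈ ⋃ t ∈ T, Cube t := by rw [hT.2]; trivial
      simp only [Set.mem_iUnion] at hx
      obtain ⟨t, ht, hxt⟩ := hx
      exact ⟨⟨t, ht⟩, hxt⟩
    · intro u v x hu hv
      by_contra hne
      exact Set.disjoint_left.1 (hT.1 u u.2 v v.2 (fun h => hne (Subtype.ext h))) hu hv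
  choose t ht using fun z : Fin 4 → ℤ => hfam.1 (fun j => (z j : ℝ))
  have hK : ∀ z z' : Fin 4 → ℤ, z ≠ z' → ∃ i, z i ≠ z' i ∧
      (z i : ℝ) - (t z : Fin 4 → ℝ) i = (z' i : ℝ) - (t z' : Fin 4 → ℝ) i := by
    intro z z' hz
    have hne : t z ≠ t z' := by
      intro h
      apply hz
      funext j
      have h1 := ht z j
      have h2 := ht z' j
      rw [← h] at h2
      have h3 : (z j : ℝ) < (z' j : ℝ) + 1 := by linarith [h1.2, h2.1]
      have h4 : (z' j : ℝ) < (z j : ℝ) + 1 := by linarith [h1.1, h2.2]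
      have h5 : z j < z' j + 1 := by exact_mod_cast h3
      have h6 : z' j < z j + 1 := by exact_mod_cast h4
      omega
    obtain ⟨i, m, hm, hi⟩ := keller _ _ hfam (t z) (t z') hne rfl
    have h1 := ht z i
    have h2 := ht z' i
    simp only at h1 h2 hi
    have h3 : (z i : ℝ) < z' i + m + 1 := by linarith [h1.2, h2.1]
    have h4 : (z' i : ℝ) + m < z i + 1 := by linarith [h1.1, h2.2]
    have h5 : z i < z' i + m + 1 := by exact_mod_cast h3
    have h6 : z' i + m < z i + 1 := by exact_mod_cast h4
    have h7 : z i = z' i + m := by omega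
    refine ⟨i, by omega, ?_⟩
    have h8 : (z i : ℝ) = z' i + m := by exact_mod_cast h7
    linarith
  obtain ⟨i, p, hp⟩ := comb_core (fun i z => (z i : ℝ) - (t z : Fin 4 → ℝ) i) hK
  refine ⟨(t (Function.update p i 0) : Fin 4 → ℝ), i, fun k => ?_⟩
  have : (t (Function.update p i 0) : Fin 4 → ℝ) + (k : ℝ) • (Pi.single i 1 : Fin 4 → ℝ) =
      (t (Function.update p i k) : Fin 4 → ℝ) := by
    funext j
    have h1 := hp 0 j
    have h2 := hp k j
    by_cases hj : j = i
    · subst hj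
      simp at h1 h2 ⊢
      linarith
    · simp [Function.update_of_ne hj, hj] at h1 h2 ⊢
      linarith
  rw [this]
  exact (t _).2
end

section
/- Every cube tiling of ℝ⁵ contains a column; that is, if T ⊆ ℝ⁵ determines a cube tiling of ℝ⁵, then there exist s ∈ ℝ⁵ and a standard basis vector eᵢ of ℝ⁵ such that s + k·eᵢ ∈ T for every k ∈ ℤ. -/
namespace CubeCol

/-- Every coset of `ℤ` meets `A` in exactly one point. -/
def IsSel (A : Set ℝ) : Prop := ∀ x : ℝ, ∃! m : ℤ, x + m ∈ A

theorem isSel_Ioc (x : ℝ) : IsSel (Set.Ioc (x - 1) x) := by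
  intro y
  refine ⟨⌊x - y⌋, ⟨?_, ?_⟩, ?_⟩
  · have := Int.lt_floor_add_one (x - y); linarith
  · have := Int.floor_le (x - y); linarith
  · rintro m ⟨h1, h2⟩
    symm
    rw [Int.floor_eq_iff]
    constructor <;> linarith

theorem exists_sel (s t : ℝ) (h : ∀ m : ℤ, s - t = m → m = 0) :
    ∃ A, IsSel A ∧ s ∈ A ∧ t ∈ A := by
  refine ⟨{y | (y ∈ Set.Ioc (s - 1) s ∧ ∀ m : ℤ, y - t ≠ m) ∨ y = t}, ?_, ?_, ?_⟩
  · intro x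
    by_cases hx : ∃ m : ℤ, x - t = m
    · obtain ⟨m, hm⟩ := hx
      refine ⟨-m, Or.inr ?_, ?_⟩
      · push_cast; linarith
      · rintro k (⟨_, hk⟩ | hk)
        · exact absurd (by push_cast; linarith) (hk (m + k))
        · have : (k : ℝ) = ((-m : ℤ) : ℝ) := by push_cast; linarith
          exact_mod_cast this
    · push Not at hx
      obtain ⟨m, hm, hu⟩ := isSel_Ioc s x
      refine ⟨m, Or.inl ⟨hm, fun k hk => hx (k - m) (by push_cast; linarith)⟩, ?_⟩
      rintro k (⟨hk, _⟩ | hk)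
      · exact hu k hk
      · exact absurd (by push_cast; linarith) (hx (-k))
  · by_cases hst : s = t
    · exact Or.inr hst
    · refine Or.inl ⟨⟨by linarith, le_refl _⟩, fun m hm => hst ?_⟩
      have := h m hm
      subst this
      push_cast at hm; linarith
  · exact Or.inr rfl

/-- A set of reals with exactly one point in each `(x-1, x]` is a coset of `ℤ`. -/
theorem coset_of_unique (R : Set ℝ) (hR : ∀ x : ℝ, ∃! r, r ∈ R ∧ r ∈ Set.Ioc (x - 1) x) :
    ∃ a, ∀ r, r ∈ R ↔ ∃ m : ℤ, r = a + m := by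
  have up : ∀ a ∈ R, a + 1 ∈ R := by
    intro a ha
    obtain ⟨r, ⟨hr, hr1, hr2⟩, -⟩ := hR (a + 1)
    rcases hr2.lt_or_eq with h | h
    · have := (hR r).unique ⟨hr, by constructor <;> linarith⟩ ⟨ha, by constructor <;> linarith⟩
      linarith
    · exact h ▸ hr
  have dn : ∀ a ∈ R, a - 1 ∈ R := by
    intro a ha
    obtain ⟨r, ⟨hr, hr1, hr2⟩, -⟩ := hR (a - 1)
    have := (hR a).unique ⟨up r hr, by constructor <;> linarith⟩ ⟨ha, by constructor <;> linarith⟩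
    have : r = a - 1 := by linarith
    exact this ▸ hr
  obtain ⟨a, ⟨ha, -⟩, -⟩ := hR 0
  have hall : ∀ m : ℤ, a + m ∈ R := by
    intro m
    induction m using Int.induction_on with
    | zero => simpa using ha
    | succ i ih => have := up _ ih; push_cast at this ⊢; rwa [← add_assoc]
    | pred i ih =>
      have := dn _ ih; push_cast at this ⊢
      rwa [← add_sub_assoc]
  refine ⟨a, fun r => ⟨fun hr => ?_, ?_⟩⟩
  · obtain ⟨m, hm, -⟩ := isSel_Ioc r a
    exact ⟨m, (hR r).unique ⟨hr, by constructor <;> linarith⟩ ⟨hall m, hm⟩⟩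
  · rintro ⟨m, rfl⟩; exact hall m

theorem mem_cube_iff (t x : Fin 5 → ℝ) : x ∈ Cube t ↔ ∀ j, t j ∈ Set.Ioc (x j - 1) (x j) := by
  unfold Cube
  simp only [Set.mem_ofPred_eq, Set.mem_Ioc]
  refine forall_congr' fun j => ⟨fun h => ⟨by linarith [h.2], h.1⟩, fun h => ⟨h.2, by linarith [h.1]⟩⟩

theorem tiling_unique {T : Set (Fin 5 → ℝ)} (hT : IsCubeTiling T) (x : Fin 5 → ℝ) :
    ∃! t, t ∈ T ∧ ∀ j, t j ∈ Set.Ioc (x j - 1) (x j) := by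
  have hx : x ∈ ⋃ t ∈ T, Cube t := by rw [hT.2]; trivial
  simp only [Set.mem_iUnion] at hx
  obtain ⟨t, ht, hxt⟩ := hx
  refine ⟨t, ⟨ht, (mem_cube_iff t x).1 hxt⟩, ?_⟩
  rintro s ⟨hs, hxs⟩
  by_contra hne
  exact Set.disjoint_left.1 (hT.1 s hs t ht hne) ((mem_cube_iff s x).2 hxs) hxt

theorem sel_unique {T : Set (Fin 5 → ℝ)} (hT : IsCubeTiling T) (S : Finset (Fin 5)) :
    ∀ A : Fin 5 → Set ℝ, (∀ j, IsSel (A j)) → (∀ j, j ∉ S → ∃ x, A j = Set.Ioc (x - 1) x) →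
      ∃! t, t ∈ T ∧ ∀ j, t j ∈ A j := by
  induction S using Finset.induction_on with
  | empty =>
    intro A _ h
    choose x hx using fun j => h j (Finset.notMem_empty j)
    have := tiling_unique hT x
    simpa only [hx] using this
  | insert i S hi ih =>
    intro A hA h
    have key : ∀ x : ℝ, ∃! t, t ∈ T ∧ ∀ j, t j ∈ Function.update A i (Set.Ioc (x - 1) x) j := by
      intro x
      apply ih
      · intro j
        by_cases hj : j = i
        · subst hj; simpa using isSel_Ioc x
        · simpa [Function.update_of_ne hj] using hA j
      · intro j hj
        by_cases hji : j = i
        · subst hji; exact ⟨x, by simp⟩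
        · rw [Function.update_of_ne hji]
          exact h j (by simp [hji, hj])
    have split : ∀ (B : Set ℝ) (t : Fin 5 → ℝ), (∀ j, t j ∈ Function.update A i B j) ↔
        (t i ∈ B ∧ ∀ j, j ≠ i → t j ∈ A j) := by
      intro B t
      constructor
      · intro h
        refine ⟨by simpa using h i, fun j hj => ?_⟩
        have := h j
        rwa [Function.update_of_ne hj] at this
      · rintro ⟨h1, h2⟩ j
        by_cases hj : j = i
        · subst hj; simpa using h1
        · rw [Function.update_of_ne hj]; exact h2 j hj
    simp only [split] at key
    obtain ⟨a, ha⟩ := coset_of_unique {r | ∃ t ∈ T, t i = r ∧ ∀ j, j ≠ i → t j ∈ A j} (by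
      intro x
      obtain ⟨t, ⟨ht, h1, h2⟩, hu⟩ := key x
      refine ⟨t i, ⟨⟨t, ht, rfl, h2⟩, h1⟩, ?_⟩
      rintro r ⟨⟨s, hs, rfl, hs2⟩, hr⟩
      rw [hu s ⟨hs, hr, hs2⟩])
    have split' : ∀ t : Fin 5 → ℝ, (∀ j, t j ∈ A j) ↔ (t i ∈ A i ∧ ∀ j, j ≠ i → t j ∈ A j) := by
      intro t
      refine ⟨fun h => ⟨h i, fun j _ => h j⟩, fun h j => ?_⟩
      by_cases hj : j = i
      · subst hj; exact h.1
      · exact h.2 j hj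
    simp only [split']
    obtain ⟨m, hm, hmu⟩ := hA i a
    obtain ⟨t, ht, hti, htj⟩ := (ha (a + m)).2 ⟨m, rfl⟩
    refine ⟨t, ⟨ht, hti ▸ hm, htj⟩, ?_⟩
    rintro s ⟨hs, hsi, hsj⟩
    obtain ⟨k, hk⟩ := (ha (s i)).1 ⟨s, hs, rfl, hsj⟩
    have hkm : k = m := hmu k (by show a + (k : ℝ) ∈ A i; rw [← hk]; exact hsi)
    have hst : s i = t i := by rw [hk, hti, hkm]
    exact (key (s i)).unique ⟨hs, by constructor <;> linarith, hsj⟩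
      ⟨ht, by rw [hst]; constructor <;> linarith, htj⟩

/-- Keller theorem: two distinct members of a cube tiling have coordinates differing by
a nonzero integer. -/
theorem keller {T : Set (Fin 5 → ℝ)} (hT : IsCubeTiling T) {s t : Fin 5 → ℝ} (hs : s ∈ T)
    (ht : t ∈ T) (hst : s ≠ t) : ∃ i, ∃ m : ℤ, s i - t i = m ∧ m ≠ 0 := by
  by_contra hcon
  push Not at hcon
  choose A hA hsA htA using fun i => exists_sel (s i) (t i) (hcon i)
  exact hst ((sel_unique hT Finset.univ A hA (fun j hj => absurd (Finset.mem_univ j) hj)).unique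
    ⟨hs, hsA⟩ ⟨ht, htA⟩)

/-- The points of the letter space. -/
abbrev W := Fin 5 → ℤ

/-- A coding of points by classes. -/
abbrev Coding := W → Fin 5 → ℝ

def K (c : Coding) : Prop := ∀ w w', w ≠ w' → ∃ i, w i ≠ w' i ∧ c w i = c w' i

def ColFree (c : Coding) : Prop := ∀ i w, ∃ x, c (Function.update w i x) ≠ c w

theorem reduction (main : ∀ c : Coding, K c → ¬ ColFree c) (T : Set (Fin 5 → ℝ))
    (hT : IsCubeTiling T) :
    ∃ s : Fin 5 → ℝ, ∃ i : Fin 5, ∀ k : ℤ,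
      (s + (k : ℝ) • (Pi.single i 1 : Fin 5 → ℝ)) ∈ T := by
  choose τ hτ hu using fun w : W => tiling_unique hT (fun j => (w j : ℝ))
  have hceil : ∀ w j, ⌈τ w j⌉ = w j := by
    intro w j
    rw [Int.ceil_eq_iff]
    exact (hτ w).2 j
  have hK : K (fun w i => Int.fract (τ w i)) := by
    intro w w' hw
    have hne : τ w ≠ τ w' := by
      intro h
      apply hw
      funext j
      rw [← hceil w j, ← hceil w' j, h]
    obtain ⟨i, m, hm, hm0⟩ := keller hT (hτ w).1 (hτ w').1 hne
    refine ⟨i, fun h => hm0 ?_, ?_⟩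
    · have h1 : τ w i = τ w' i + m := by linarith
      have h2 := hceil w i
      rw [h1, Int.ceil_add_intCast, hceil w' i] at h2
      omega
    · exact Int.fract_eq_fract.2 ⟨m, hm⟩
  have := main _ hK
  unfold ColFree at this
  push Not at this
  obtain ⟨i, w, hw⟩ := this
  refine ⟨τ w, i, fun k => ?_⟩
  have hmem := (hτ (Function.update w i (w i + k))).1
  convert hmem using 1
  funext j
  have hf := congrFun (hw (w i + k)) j
  obtain ⟨m, hm⟩ := Int.fract_eq_fract.1 hf
  have h1 : τ (Function.update w i (w i + k)) j = τ w j + m := by linarith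
  have h2 := hceil (Function.update w i (w i + k)) j
  rw [h1, Int.ceil_add_intCast, hceil w j] at h2
  rw [h1]
  by_cases hj : j = i
  · subst hj
    simp at h2
    simp [h2]
  · rw [Function.update_of_ne hj] at h2
    have : m = 0 := by omega
    simp [this, hj]


/-! ### Combinatorics of column free codings -/

open Function (update)

def Good (c : Coding) : Prop := K c ∧ ColFree c

def Arc (c : Coding) (i j : Fin 5) (w : W) : Prop :=
  ∃ x y, c (update w i x) j ≠ c (update w i y) j

theorem c_indep {c : Coding} (hK : K c) (i : Fin 5) (w : W) (x : ℤ) :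
    c (update w i x) i = c w i := by
  by_cases h : update w i x = w
  · rw [h]
  · obtain ⟨k, hk, hc⟩ := hK _ _ h
    have : k = i := by
      by_contra hki
      exact hk (Function.update_of_ne hki _ _)
    subst this
    exact hc

theorem arc_upd_left {c : Coding} (i j : Fin 5) (w : W) (z : ℤ) :
    Arc c i j (update w i z) ↔ Arc c i j w := by
  unfold Arc
  simp only [Function.update_idem]

theorem not_arc_self {c : Coding} (hK : K c) (i : Fin 5) (w : W) : ¬ Arc c i i w := by
  rintro ⟨x, y, h⟩
  rw [c_indep hK, c_indep hK] at h
  exact h rfl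

theorem arc_upd_right {c : Coding} (hK : K c) (i j : Fin 5) (w : W) (z : ℤ) :
    Arc c i j (update w j z) ↔ Arc c i j w := by
  by_cases hij : i = j
  · subst hij
    exact iff_of_false (not_arc_self hK _ _) (not_arc_self hK _ _)
  · unfold Arc
    simp only [Function.update_comm (Ne.symm hij), c_indep hK]

theorem arc_anti {c : Coding} (hK : K c) {i j : Fin 5} (hij : i ≠ j) (w : W) :
    ¬ (Arc c i j w ∧ Arc c j i w) := by
  rintro ⟨⟨x, y, h⟩, ⟨z, t, h'⟩⟩
  have hxy : x ≠ y := by rintro rfl; exact h rfl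
  have hzt : z ≠ t := by rintro rfl; exact h' rfl
  have hne : update (update w i x) j z ≠ update (update w i y) j t := by
    intro he
    have := congrFun he j
    simp at this
    exact hzt this
  obtain ⟨k, hk, hc⟩ := hK _ _ hne
  by_cases hkj : k = j
  · subst hkj
    rw [c_indep hK, c_indep hK] at hc
    exact h hc
  · by_cases hki : k = i
    · subst hki
      rw [Function.update_comm hij, Function.update_comm hij, c_indep hK, c_indep hK] at hc
      exact h' hc
    · simp [Function.update_of_ne hkj, Function.update_of_ne hki] at hk

theorem arc_of_ne {c : Coding} {i j : Fin 5} {w : W} {x : ℤ}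
    (h : c w j ≠ c (update w i x) j) : Arc c i j w :=
  ⟨w i, x, by rwa [Function.update_eq_self]⟩

theorem arc_out {c : Coding} (hc : Good c) (i : Fin 5) (w : W) : ∃ j, j ≠ i ∧ Arc c i j w := by
  obtain ⟨x, hx⟩ := hc.2 i w
  obtain ⟨j, hj⟩ := Function.ne_iff.1 hx
  refine ⟨j, ?_, arc_of_ne (Ne.symm hj)⟩
  rintro rfl
  exact hj (c_indep hc.1 _ _ _)

/-- Exchange letters `1` and `b` in coordinate `j` among words of class `d` there. -/
noncomputable def flp (c : Coding) (j : Fin 5) (d : ℝ) (b : ℤ) (w : W) : W :=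
  open Classical in if c w j = d then update w j (Equiv.swap 1 b (w j)) else w

noncomputable def mdf (c : Coding) (j : Fin 5) (d : ℝ) (b : ℤ) : Coding :=
  fun w => c (flp c j d b w)

theorem flp_class {c : Coding} (hK : K c) (j : Fin 5) (d : ℝ) (b : ℤ) (w : W) : c (flp c j d b w) j = c w j := by
  unfold flp
  split_ifs
  · exact c_indep hK _ _ _
  · rfl

theorem flp_pos {c : Coding} (j : Fin 5) (d : ℝ) (b : ℤ) {w : W} (h : c w j = d) : flp c j d b w = update w j (Equiv.swap 1 b (w j)) := by
  simp [flp, h]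

theorem flp_neg {c : Coding} (j : Fin 5) (d : ℝ) (b : ℤ) {w : W} (h : c w j ≠ d) : flp c j d b w = w := by
  simp [flp, h]

theorem flp_of_zero {c : Coding} (j : Fin 5) (d : ℝ) (b : ℤ) {w : W} (hb : b ≠ 0) (h : w j = 0) : flp c j d b w = w := by
  unfold flp
  split_ifs
  · rw [h, Equiv.swap_apply_of_ne_of_ne (by norm_num) hb.symm, ← h, Function.update_eq_self]
  · rfl

theorem flp_other {c : Coding} (j : Fin 5) (d : ℝ) (b : ℤ) (w : W) {i : Fin 5} (h : i ≠ j) : flp c j d b w i = w i := by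
  unfold flp
  split_ifs
  · exact Function.update_of_ne h _ _
  · rfl

theorem flp_flp {c : Coding} (hK : K c) (j : Fin 5) (d : ℝ) (b : ℤ) (w : W) : flp c j d b (flp c j d b w) = w := by
  by_cases h : c w j = d
  · have h' : c (flp c j d b w) j = d := by rw [flp_class hK, h]
    rw [flp_pos j d b h', flp_pos j d b h]
    simp
  · rw [flp_neg j d b (w := flp c j d b w) (by rw [flp_class hK]; exact h), flp_neg j d b h]

theorem mdf_K {c : Coding} (hK : K c) (j : Fin 5) (d : ℝ) (b : ℤ) : K (mdf c j d b) := by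
  intro w w' hw
  have hne : flp c j d b w ≠ flp c j d b w' := by
    intro h
    apply hw
    rw [← flp_flp hK j d b w, h, flp_flp hK]
  obtain ⟨i, hi, hc⟩ := hK _ _ hne
  refine ⟨i, ?_, hc⟩
  by_cases hij : i = j
  · subst hij
    rw [flp_class hK, flp_class hK] at hc
    intro hww
    apply hi
    by_cases h : c w i = d
    · rw [flp_pos i d b h, flp_pos i d b (hc ▸ h), hww]; simp
    · rw [flp_neg i d b h, flp_neg i d b (hc ▸ h), hww]
  · rwa [flp_other j d b w hij, flp_other j d b w' hij] at hi

theorem mdf_ColFree {c : Coding} (hK : K c) (j : Fin 5) (d : ℝ) (b : ℤ) (hF : ColFree c) : ColFree (mdf c j d b) := by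
  intro i w
  by_contra hcon
  push Not at hcon
  have hcl : ∀ x, c (update w i x) j = c w j := by
    intro x
    have := congrFun (hcon x) j
    unfold mdf at this
    rwa [flp_class hK, flp_class hK] at this
  have key : ∀ x, ∃ y, update (flp c j d b w) i x = flp c j d b (update w i y) := by
    intro x
    by_cases h : c w j = d
    · by_cases hij : i = j
      · subst hij
        refine ⟨Equiv.swap 1 b x, ?_⟩
        rw [flp_pos i d b h, flp_pos i d b (by rw [hcl, h])]
        simp
      · refine ⟨x, ?_⟩
        rw [flp_pos j d b h, flp_pos j d b (by rw [hcl, h])]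
        rw [Function.update_comm hij, Function.update_of_ne (Ne.symm hij)]
    · exact ⟨x, by rw [flp_neg j d b h, flp_neg j d b (by rw [hcl]; exact h)]⟩
  obtain ⟨x, hx⟩ := hF i (flp c j d b w)
  obtain ⟨y, hy⟩ := key x
  rw [hy] at hx
  exact hx (hcon y)

theorem mdf_good {c : Coding} (hc : Good c) (j : Fin 5) (d : ℝ) (b : ℤ) : Good (mdf c j d b) :=
  ⟨mdf_K hc.1 j d b, mdf_ColFree hc.1 j d b hc.2⟩

/-- Arcs at the origin are not changed by a modification. -/
theorem mdf_arc {c : Coding} (hc : Good c) (j : Fin 5) (d : ℝ) (b : ℤ) (hb : b ≠ 0) (i k : Fin 5) :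
    Arc (mdf c j d b) i k 0 ↔ Arc c i k 0 := by
  by_cases hij : i = j
  · subst hij
    by_cases h : c 0 i = d
    · have key : ∀ x, mdf c i d b (update 0 i x) = c (update 0 i (Equiv.swap 1 b x)) := by
        intro x
        unfold mdf
        rw [flp_pos i d b (by rw [c_indep hc.1, h])]
        simp
      unfold Arc
      simp only [key]
      constructor
      · rintro ⟨x, y, hxy⟩; exact ⟨_, _, hxy⟩
      · rintro ⟨x, y, hxy⟩
        exact ⟨Equiv.swap 1 b x, Equiv.swap 1 b y, by simpa using hxy⟩
    · have key : ∀ x, mdf c i d b (update 0 i x) = c (update 0 i x) := by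
        intro x
        unfold mdf
        rw [flp_neg i d b (by rw [c_indep hc.1]; exact h)]
      unfold Arc
      simp only [key]
  · have key : ∀ x, mdf c j d b (update 0 i x) = c (update 0 i x) := by
      intro x
      unfold mdf
      rw [flp_of_zero j d b hb (by rw [Function.update_of_ne (Ne.symm hij)]; rfl)]
    unfold Arc
    simp only [key]

/-- Box points. -/
def pt (u : ℕ) : W := fun i => bif u.testBit i then 1 else 0

theorem pt_zero : pt 0 = 0 := by
  funext i; simp [pt]

/-- Clear a bit. -/
def clr (i u : ℕ) : ℕ := bif u.testBit i then u - 2 ^ i else u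

theorem clr_lt (i u : ℕ) (h : u.testBit i = true) : clr i u < u := by
  have := Nat.ge_two_pow_of_testBit h
  have : 0 < 2 ^ i := by positivity
  simp only [clr, h, cond_true]
  omega

theorem clr_lt32 (i u : ℕ) (h : u < 32) : clr i u < 32 := by
  refine lt_of_le_of_lt ?_ h
  unfold clr
  cases u.testBit i <;> simp

theorem pt_clr_aux : ∀ (i : Fin 5) (u : Fin 32) (k : Fin 5),
    (clr i u).testBit k = bif decide (k = i) then false else (u : ℕ).testBit k := by
  decide

theorem pt_clr (i : Fin 5) (u : ℕ) (hu : u < 32) : pt (clr i u) = update (pt u) i 0 := by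
  funext k
  have := pt_clr_aux i ⟨u, hu⟩ k
  simp only at this
  by_cases h : k = i
  · subst h
    simp [pt, this]
  · simp [pt, this, h]

theorem clr_bit (i : Fin 5) (u : ℕ) (hu : u < 32) : (clr i u).testBit i = false := by
  have := pt_clr_aux i ⟨u, hu⟩ i
  simpa using this

theorem pt_of_bit {u : ℕ} {i : Fin 5} (h : u.testBit i = false) : pt u i = 0 := by simp [pt, h]

def LineOK (want : Fin 5 → Option (Fin 5)) (c : Coding) (j : Fin 5) (p : ℕ) : Prop :=
  ((∃ q < p, q.testBit j = false ∧ c (pt q) j = c (pt p) j) ∨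
    c (pt p) ≠ c (update (pt p) j 1)) ∧
  (p = 0 → ∀ k, want j = some k → Arc c j k 0 → c 0 k ≠ c (update 0 j 1) k)

theorem choice (want : Fin 5 → Option (Fin 5)) {c₀ : Coding} (h₀ : Good c₀) (t : ℕ) (ht : t ≤ 160) :
    ∃ c, Good c ∧ (∀ i k, Arc c i k 0 ↔ Arc c₀ i k 0) ∧
      ∀ (q : ℕ) (i : Fin 5), 5 * q + i < t → q.testBit i = false → LineOK want c i q := by
  induction t with
  | zero => exact ⟨c₀, h₀, fun _ _ => Iff.rfl, fun q i h => absurd h (by omega)⟩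
  | succ t ih =>
    obtain ⟨c, hc, harc, hl⟩ := ih (by omega)
    obtain ⟨p, j, htpj⟩ : ∃ (p : ℕ) (j : Fin 5), t = 5 * p + j :=
      ⟨t / 5, ⟨t % 5, by omega⟩, by simp only; omega⟩
    have hp32 : p < 32 := by omega
    have huniq : ∀ (q : ℕ) (i : Fin 5), 5 * q + (i : ℕ) < t + 1 →
        5 * q + (i : ℕ) < t ∨ (q = p ∧ i = j) := by
      intro q i h
      have := i.2
      have := j.2
      rcases Nat.lt_or_ge (5 * q + (i : ℕ)) t with h' | h'
      · exact Or.inl h'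
      · refine Or.inr ⟨by omega, Fin.ext (by omega)⟩
    by_cases hbit : p.testBit j = true
    · refine ⟨c, hc, harc, fun q i h hb => ?_⟩
      rcases huniq q i h with h | ⟨rfl, rfl⟩
      · exact hl q i h hb
      · rw [hbit] at hb; cases hb
    have hbit : p.testBit j = false := by simpa using hbit
    by_cases hseen : ∃ q < p, q.testBit j = false ∧ c (pt q) j = c (pt p) j
    · refine ⟨c, hc, harc, fun q i h hb => ?_⟩
      rcases huniq q i h with h | ⟨rfl, rfl⟩
      · exact hl q i h hb
      · refine ⟨Or.inl hseen, ?_⟩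
        rintro rfl
        obtain ⟨q, hq, -⟩ := hseen
        omega
    push Not at hseen
    have hb : ∃ b, c (update (pt p) j b) ≠ c (pt p) ∧
        (p = 0 → ∀ k, want j = some k → Arc c j k 0 → c 0 k ≠ c (update 0 j b) k) := by
      by_cases hw : p = 0 ∧ ∃ k, want j = some k ∧ Arc c j k 0
      · obtain ⟨rfl, k, hk, x, y, hxy⟩ := hw
        have : ∃ b, c 0 k ≠ c (update 0 j b) k := by
          by_contra hcon
          push Not at hcon
          exact hxy ((hcon x).symm.trans (hcon y))
        obtain ⟨b, hb⟩ := this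
        refine ⟨b, ?_, ?_⟩
        · intro h
          rw [pt_zero] at h
          exact hb (congrFun h k).symm
        · intro _ k' hk'
          rw [hk] at hk'
          cases hk'
          exact fun _ => hb
      · obtain ⟨b, hb⟩ := hc.2 j (pt p)
        exact ⟨b, hb, fun hp k hk ha => absurd ⟨hp, k, hk, ha⟩ hw⟩
    obtain ⟨b, hb1, hb2⟩ := hb
    have hpj : pt p j = 0 := pt_of_bit hbit
    have hb0 : b ≠ 0 := by
      rintro rfl
      apply hb1
      rw [← hpj, Function.update_eq_self]
    set d := c (pt p) j with hd
    -- words of an earlier point with letter `1` in coordinate `j` have another class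
    have hold : ∀ q, q ≤ p → q.testBit j = true → c (pt q) j ≠ d := by
      intro q hq hqj
      have h1 := hseen (clr j q) (lt_of_lt_of_le (clr_lt _ _ hqj) hq) (clr_bit j q (by omega))
      rwa [pt_clr j q (by omega), c_indep hc.1] at h1
    have hfix : ∀ q, q ≤ p → flp c j d b (pt q) = pt q := by
      intro q hq
      by_cases hqj : q.testBit j = true
      · exact flp_neg j d b (hold q hq hqj)
      · exact flp_of_zero j d b hb0 (pt_of_bit (by simpa using hqj))
    have hfix' : ∀ q, q ≤ p → mdf c j d b (pt q) = c (pt q) := by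
      intro q hq
      unfold mdf
      rw [hfix q hq]
    have hnew : mdf c j d b (update (pt p) j 1) = c (update (pt p) j b) := by
      unfold mdf
      rw [flp_pos j d b (by rw [c_indep hc.1])]
      simp
    refine ⟨mdf c j d b, mdf_good hc j d b, fun i k => (mdf_arc hc j d b hb0 i k).trans (harc i k),
      fun q i h hbq => ?_⟩
    have hqp : q ≤ p := by have := j.2; omega
    rcases huniq q i h with h | ⟨rfl, rfl⟩
    · have hlt : i = j → q < p := by
        rintro rfl
        omega
      obtain ⟨h1, h2⟩ := hl q i h hbq
      refine ⟨?_, ?_⟩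
      · rcases h1 with ⟨q', hq', hb', he⟩ | hne
        · left
          exact ⟨q', hq', hb', by rw [hfix' q' (by omega), hfix' q hqp, he]⟩
        · right
          rw [hfix' q hqp]
          by_cases hcl : c (update (pt q) i 1) j = d
          · by_cases hij : i = j
            · subst hij
              rw [c_indep hc.1] at hcl
              exact absurd hcl (hseen q (hlt rfl) hbq)
            · by_cases hqj : q.testBit j = true
              · intro he
                have := congrFun he j
                unfold mdf at this
                rw [flp_class hc.1, hcl] at this
                exact hold q hqp hqj this
              · unfold mdf
                rw [flp_of_zero j d b hb0
                  (by rw [Function.update_of_ne (Ne.symm hij)]; exact pt_of_bit (by simpa using hqj))]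
                exact hne
          · unfold mdf
            rw [flp_neg j d b hcl]
            exact hne
      · rintro rfl k hk ha
        have h3 := h2 rfl k hk ((mdf_arc hc j d b hb0 i k).1 ha)
        have h4 : mdf c j d b 0 = c 0 := by
          have := hfix' 0 (by omega)
          rwa [pt_zero] at this
        have h5 : mdf c j d b (update 0 i 1) = c (update 0 i 1) := by
          unfold mdf
          by_cases hij : i = j
          · subst hij
            rw [flp_neg i d b]
            rw [c_indep hc.1, ← pt_zero]
            exact hseen 0 (hlt rfl) (by simp)
          · rw [flp_of_zero j d b hb0]
            rw [Function.update_of_ne (Ne.symm hij)]; rfl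
        rw [h4, h5]
        exact h3
    · refine ⟨Or.inr ?_, ?_⟩
      · rw [hfix' q le_rfl, hnew]
        exact hb1.symm
      · rintro rfl k hk ha
        have h4 : mdf c i d b 0 = c 0 := by
          have := hfix' 0 le_rfl
          rwa [pt_zero] at this
        rw [pt_zero] at hnew
        rw [h4, hnew]
        exact hb2 rfl k hk ((mdf_arc hc i d b hb0 i k).1 ha)

/-- Pulling back a coding along a permutation of the coordinates and a change of origin. -/
def pull (c : Coding) (π : Equiv.Perm (Fin 5)) (w : W) : Coding :=
  fun v i => c (fun k => Equiv.swap 0 (w k) (v (π.symm k))) (π i)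

def gmap (π : Equiv.Perm (Fin 5)) (w : W) (v : W) : W :=
  fun k => Equiv.swap 0 (w k) (v (π.symm k))

theorem gmap_update (π : Equiv.Perm (Fin 5)) (w v : W) (i : Fin 5) (x : ℤ) :
    gmap π w (update v i x) = update (gmap π w v) (π i) (Equiv.swap 0 (w (π i)) x) := by
  funext k
  by_cases h : k = π i
  · subst h
    simp [gmap]
  · have h' : π.symm k ≠ i := by
      rintro rfl
      simp at h
    simp [gmap, h, h']

theorem gmap_zero (π : Equiv.Perm (Fin 5)) (w : W) : gmap π w 0 = w := by
  funext k
  simp [gmap]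

theorem pull_good {c : Coding} (hc : Good c) (π : Equiv.Perm (Fin 5)) (w : W) :
    Good (pull c π w) := by
  constructor
  · intro v v' hv
    have hne : gmap π w v ≠ gmap π w v' := by
      intro h
      apply hv
      funext i
      have := congrFun h (π i)
      simpa [gmap] using this
    obtain ⟨i, hi, hci⟩ := hc.1 _ _ hne
    refine ⟨π.symm i, ?_, ?_⟩
    · intro h
      apply hi
      simp [gmap, h]
    · change c (gmap π w v) (π (π.symm i)) = c (gmap π w v') (π (π.symm i))
      rw [Equiv.apply_symm_apply]
      exact hci
  · intro i v
    obtain ⟨x, hx⟩ := hc.2 (π i) (gmap π w v)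
    refine ⟨Equiv.swap 0 (w (π i)) x, fun h => hx ?_⟩
    funext k
    have := congrFun h (π.symm k)
    change c (gmap π w (update v i _)) (π (π.symm k)) = c (gmap π w v) (π (π.symm k)) at this
    rw [gmap_update] at this
    simpa using this

theorem pull_arc {c : Coding} (π : Equiv.Perm (Fin 5)) (w : W) (i j : Fin 5) :
    Arc (pull c π w) i j 0 ↔ Arc c (π i) (π j) w := by
  have key : ∀ x, pull c π w (update 0 i x) j = c (update w (π i) (Equiv.swap 0 (w (π i)) x)) (π j) := by
    intro x
    change c (gmap π w (update 0 i x)) (π j) = _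
    rw [gmap_update, gmap_zero]
  unfold Arc
  simp only [key]
  constructor
  · rintro ⟨x, y, h⟩; exact ⟨_, _, h⟩
  · rintro ⟨x, y, h⟩
    exact ⟨Equiv.swap 0 (w (π i)) x, Equiv.swap 0 (w (π i)) y, by simpa using h⟩

/-! ### A small checker for propositional certificates -/

def bitN (N l : ℕ) : Bool := Nat.ble 1 (Nat.land 1 (Nat.shiftRight N l))

def clf (i u : ℕ) : ℕ := Nat.land u (Nat.xor 31 (Nat.shiftLeft 1 i))

/-- Code of the variable: the classes of box points `u` and `v` in coordinate `i` agree. -/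
def mkE (i u v : ℕ) : ℕ :=
  bif Nat.ble (clf i u) (clf i v) then
    Nat.add (Nat.mul i 1024) (Nat.add (Nat.mul (clf i u) 32) (clf i v))
  else Nat.add (Nat.mul i 1024) (Nat.add (Nat.mul (clf i v) 32) (clf i u))

/-- Code of the variable: there is an arc from `i` to `j` at `u`. -/
def mkA (i j u : ℕ) : ℕ :=
  Nat.add 5120 (Nat.add (Nat.mul i 160) (Nat.add (Nat.mul j 32) (clf i (clf j u))))

def lp (v : ℕ) : ℕ := Nat.mul 2 v
def ln (v : ℕ) : ℕ := Nat.add (Nat.mul 2 v) 1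
def lneg (l : ℕ) : ℕ := Nat.sub (Nat.add l 1) (Nat.mul 2 (Nat.mod l 2))

/-- Field of a hint. -/
def fld (h s m : ℕ) : ℕ := Nat.mod (Nat.shiftRight h s) m

def triv : List ℕ := [lp (mkE 0 0 0)]

def clT (i u v x : ℕ) : List ℕ := [ln (mkE i u v), ln (mkE i v x), lp (mkE i u x)]

def clKgo (u v : ℕ) : ℕ → List ℕ
  | 0 => []
  | i + 1 => bif Bool.xor (bitN u i) (bitN v i) then lp (mkE i u v) :: clKgo u v i else clKgo u v i

def clK (u v : ℕ) : List ℕ := bif Nat.beq u v then triv else clKgo u v 5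

def clAnti (i j u : ℕ) : List ℕ :=
  bif Nat.beq i j then triv else [ln (mkA i j u), ln (mkA j i u)]

def clAE (i j u : ℕ) : List ℕ := [lp (mkE j u (Nat.xor u (Nat.shiftLeft 1 i))), lp (mkA i j u)]

def clOutgo (i u : ℕ) : ℕ → List ℕ
  | 0 => []
  | k + 1 => bif Nat.beq i k then clOutgo i u k else lp (mkA i k u) :: clOutgo i u k

def clFgo2 (j p : ℕ) : ℕ → List ℕ
  | 0 => []
  | i + 1 => bif Nat.beq i j then clFgo2 j p i
      else ln (mkE i p (Nat.xor p (Nat.shiftLeft 1 j))) :: clFgo2 j p i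

def clFgo (j p : ℕ) : ℕ → List ℕ
  | 0 => clFgo2 j p 5
  | q + 1 => bif bitN q j then clFgo j p q else lp (mkE j p q) :: clFgo j p q

def clF (j p : ℕ) : List ℕ := bif bitN p j then triv else clFgo j p p

def dig (π i : ℕ) : ℕ := Nat.mod (fld π (Nat.mul 3 i) 8) 5

def permOK (π : ℕ) : Bool :=
  Nat.beq (Nat.lor (Nat.shiftLeft 1 (dig π 0)) (Nat.lor (Nat.shiftLeft 1 (dig π 1))
    (Nat.lor (Nat.shiftLeft 1 (dig π 2)) (Nat.lor (Nat.shiftLeft 1 (dig π 3))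
    (Nat.shiftLeft 1 (dig π 4)))))) 31

def arcL (π u a : ℕ) : ℕ := mkA (dig π (fld a 3 5)) (dig π (Nat.mod (Nat.mod a 8) 5)) u

def mapNeg (π u : ℕ) : List ℕ → List ℕ
  | [] => []
  | a :: l => lp (arcL π u a) :: mapNeg π u l

def mapPos (π u : ℕ) (neg : List ℕ) : List ℕ → List ℕ
  | [] => mapNeg π u neg
  | a :: l => ln (arcL π u a) :: mapPos π u neg l

def nthP : List (List ℕ × List ℕ) → ℕ → Option (List ℕ × List ℕ)
  | [], _ => none
  | p :: l, k => bif Nat.beq k 0 then some p else nthP l (Nat.sub k 1)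

def clP (known : List (List ℕ × List ℕ)) (k π u : ℕ) : List ℕ :=
  bif permOK π then
    match nthP known k with
    | none => triv
    | some p => mapPos π u p.2 p.1
  else triv

def nthL : List (List ℕ) → ℕ → List ℕ
  | [], _ => triv
  | p :: l, k => bif Nat.beq k 0 then p else nthL l (Nat.sub k 1)

def clU (want j : ℕ) : List ℕ :=
  bif Nat.beq (fld want (Nat.mul 3 j) 8) 0 then triv
  else [ln (mkA j (Nat.mod (Nat.sub (fld want (Nat.mul 3 j) 8) 1) 5) 0),
    ln (mkE (Nat.mod (Nat.sub (fld want (Nat.mul 3 j) 8) 1) 5) 0 (Nat.shiftLeft 1 j))]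

def hI (h : ℕ) : ℕ := Nat.mod (fld h 4 8) 5
def hJ (h : ℕ) : ℕ := Nat.mod (fld h 7 8) 5
def hU (h : ℕ) : ℕ := fld h 10 32
def hV (h : ℕ) : ℕ := fld h 15 32
def hX (h : ℕ) : ℕ := fld h 20 32

/-- The clause described by a hint. -/
def clauseOf (want : ℕ) (known : List (List ℕ × List ℕ)) (learned : List (List ℕ)) (h : ℕ) :
    List ℕ :=
  bif Nat.beq (Nat.mod h 16) 0 then clT (hI h) (hU h) (hV h) (hX h)
  else bif Nat.beq (Nat.mod h 16) 1 then clK (hU h) (hV h)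
  else bif Nat.beq (Nat.mod h 16) 2 then clAnti (hI h) (hJ h) (hU h)
  else bif Nat.beq (Nat.mod h 16) 3 then clAE (hI h) (hJ h) (hU h)
  else bif Nat.beq (Nat.mod h 16) 4 then clOutgo (hI h) (hU h) 5
  else bif Nat.beq (Nat.mod h 16) 5 then clF (hI h) (hU h)
  else bif Nat.beq (Nat.mod h 16) 6 then clP known (fld h 4 64) (Nat.shiftRight h 15) (hU h)
  else bif Nat.beq (Nat.mod h 16) 7 then nthL learned (Nat.shiftRight h 4)
  else bif Nat.beq (Nat.mod h 16) 8 then clU want (hI h)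
  else triv

/-- Result: `0` if all literals are false, `l + 2` if only `l` is not false, otherwise `1`. -/
def scan (N : ℕ) : ℕ → List ℕ → ℕ
  | acc, [] => acc
  | acc, l :: ls => bif bitN N l then scan N acc ls
      else bif Nat.beq acc 0 then scan N (Nat.add l 2) ls else 1

def setF (N l : ℕ) : ℕ := Nat.lor N (Nat.shiftLeft 1 l)

def propa (cl : ℕ → List ℕ) : ℕ → List ℕ → Option ℕ
  | N, [] => some N
  | N, h :: hs =>
    (fun r => bif Nat.beq r 0 then none
      else bif Nat.beq r 1 then propa cl N hs
      else propa cl (setF N (lneg (Nat.sub r 2))) hs) (scan N 0 (cl h))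

def addAll : ℕ → List ℕ → ℕ
  | N, [] => N
  | N, l :: ls => addAll (setF N l) ls

def unpack (s : ℕ) : ℕ → ℕ → List ℕ
  | 0, _ => []
  | f + 1, n => bif Nat.beq n 0 then []
      else Nat.mod n (Nat.pow 2 s) :: unpack s f (Nat.shiftRight n s)

def steps (want : ℕ) (known : List (List ℕ × List ℕ)) :
    ℕ → List (List ℕ) → List (ℕ × ℕ) → Bool
  | _, _, [] => false
  | root, learned, (a, b) :: rest =>
    bif Nat.beq a 0 then
      match propa (clauseOf want known learned) root (unpack 32 3000 b) with
      | none => true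
      | some r => steps want known r learned rest
    else
      match propa (clauseOf want known learned) (addAll root (unpack 14 100 a))
        (unpack 32 3000 b) with
      | none => steps want known root (unpack 14 100 a :: learned) rest
      | some _ => false

def rootN (pos neg : List ℕ) : ℕ := addAll 0 (mapPos 18056 0 neg pos)

def checkCert (want : ℕ) (known : List (List ℕ × List ℕ)) (pos neg : List ℕ)
    (cert : List (ℕ × ℕ)) : Bool :=
  steps want known (rootN pos neg) [] cert

/-! ### Soundness -/

def fi (n : ℕ) : Fin 5 := ⟨n % 5, Nat.mod_lt _ (by decide)⟩

theorem fi_val (i : Fin 5) : fi i = i := by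
  apply Fin.ext
  exact Nat.mod_eq_of_lt i.2

theorem fi_coe {i : ℕ} (h : i < 5) : ((fi i : Fin 5) : ℕ) = i := Nat.mod_eq_of_lt h

def semVar (c : Coding) (v : ℕ) : Prop :=
  if v < 5120 then c (pt (v / 32 % 32)) (fi (v / 1024)) = c (pt (v % 32)) (fi (v / 1024))
  else Arc c (fi ((v - 5120) / 160)) (fi ((v - 5120) / 32)) (pt ((v - 5120) % 32))

def semLit (c : Coding) (l : ℕ) : Prop := if l % 2 = 1 then ¬ semVar c (l / 2) else semVar c (l / 2)

theorem sem_lp (c : Coding) (v : ℕ) : semLit c (lp v) ↔ semVar c v := by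
  have h1 : lp v % 2 = 0 := by change 2 * v % 2 = 0; omega
  have h2 : lp v / 2 = v := by change 2 * v / 2 = v; omega
  simp [semLit, h1, h2]

theorem sem_ln (c : Coding) (v : ℕ) : semLit c (ln v) ↔ ¬ semVar c v := by
  have h1 : ln v % 2 = 1 := by change (2 * v + 1) % 2 = 1; omega
  have h2 : ln v / 2 = v := by change (2 * v + 1) / 2 = v; omega
  simp [semLit, h1, h2]

theorem sem_lneg (c : Coding) (l : ℕ) : semLit c (lneg l) ↔ ¬ semLit c l := by
  have h2 : lneg l / 2 = l / 2 := by
    change (l + 1 - 2 * (l % 2)) / 2 = l / 2; omega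
  have h1 : lneg l % 2 = 1 - l % 2 := by
    change (l + 1 - 2 * (l % 2)) % 2 = _; omega
  unfold semLit
  rw [h1, h2]
  rcases Nat.mod_two_eq_zero_or_one l with h | h <;> simp [h]

theorem bitN_eq (N l : ℕ) : bitN N l = N.testBit l := by
  unfold bitN Nat.testBit
  have e : Nat.land 1 (Nat.shiftRight N l) = 1 &&& N >>> l := rfl
  rw [e]
  rcases Nat.eq_zero_or_pos (1 &&& N >>> l) with h | h
  · rw [h]; rfl
  · have h1 : Nat.ble 1 (1 &&& N >>> l) = true := by rw [Nat.ble_eq]; exact h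
    have h2 : (1 &&& N >>> l) ≠ 0 := by omega
    rw [h1]
    exact (bne_iff_ne.2 h2).symm

theorem setF_bit {N m l : ℕ} (h : bitN (setF N m) l = true) : bitN N l = true ∨ l = m := by
  rw [bitN_eq] at *
  have e : setF N m = N ||| 1 <<< m := rfl
  rw [e, Nat.testBit_or, Bool.or_eq_true] at h
  rcases h with h | h
  · exact Or.inl h
  · right
    rw [Nat.one_shiftLeft, Nat.testBit_two_pow] at h
    exact (by simpa using h : m = l).symm

theorem clf_eq {i u : ℕ} (hi : i < 5) (hu : u < 32) : clf i u = clr i u := by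
  have : ∀ (i : Fin 5) (u : Fin 32), clf i u = clr i u := by decide
  exact this ⟨i, hi⟩ ⟨u, hu⟩

theorem clf_lt {i u : ℕ} (hi : i < 5) (hu : u < 32) : clf i u < 32 := by
  rw [clf_eq hi hu]; exact clr_lt32 _ _ hu

theorem pt_clf {i u : ℕ} (hi : i < 5) (hu : u < 32) : pt (clf i u) = update (pt u) (fi i) 0 := by
  rw [clf_eq hi hu, ← pt_clr (fi i) u hu, fi_coe hi]

theorem pt_xor {i u : ℕ} (hi : i < 5) (hu : u < 32) :
    ∃ x, pt (Nat.xor u (Nat.shiftLeft 1 i)) = update (pt u) (fi i) x := by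
  have : ∀ (i : Fin 5) (u : Fin 32) (k : Fin 5), k ≠ i →
    (Nat.xor u (Nat.shiftLeft 1 i)).testBit k = (u : ℕ).testBit k := by decide
  refine ⟨pt (Nat.xor u (Nat.shiftLeft 1 i)) (fi i), ?_⟩
  funext k
  by_cases hk : k = fi i
  · subst hk; simp
  · rw [Function.update_of_ne hk]
    have h := this ⟨i, hi⟩ ⟨u, hu⟩ k (by
      intro h; apply hk; rw [h]; apply Fin.ext; exact (fi_coe hi).symm)
    simp only at h
    simp only [pt, h]

theorem xor_lt {i u : ℕ} (hi : i < 5) (hu : u < 32) : Nat.xor u (Nat.shiftLeft 1 i) < 32 := by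
  have : ∀ (i : Fin 5) (u : Fin 32), Nat.xor u (Nat.shiftLeft 1 i) < 32 := by decide
  exact this ⟨i, hi⟩ ⟨u, hu⟩

theorem pt_xor_one {i u : ℕ} (hi : i < 5) (hu : u < 32) (hb : bitN u i = false) :
    pt (Nat.xor u (Nat.shiftLeft 1 i)) = update (pt u) (fi i) 1 := by
  have : ∀ (i : Fin 5) (u : Fin 32), bitN u i = false → 
    (Nat.xor u (Nat.shiftLeft 1 i)).testBit i = true := by decide
  obtain ⟨x, hx⟩ := pt_xor hi hu
  have h := this ⟨i, hi⟩ ⟨u, hu⟩ hb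
  have hx1 : x = 1 := by
    have h1 := congrFun hx (fi i)
    rw [Function.update_self] at h1
    rw [← h1]
    unfold pt
    rw [fi_coe hi]
    simp only at h
    rw [h]
    rfl
  rw [hx, hx1]

theorem sem_mkE {c : Coding} (hc : Good c) {i u v : ℕ} (hi : i < 5) (hu : u < 32) (hv : v < 32) :
    semVar c (mkE i u v) ↔ c (pt u) (fi i) = c (pt v) (fi i) := by
  have hU := clf_lt hi hu
  have hV := clf_lt hi hv
  have key : ∀ a b : ℕ, a < 32 → b < 32 →
      (semVar c (i * 1024 + (a * 32 + b)) ↔ c (pt a) (fi i) = c (pt b) (fi i)) := by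
    intro a b ha hb
    unfold semVar
    rw [if_pos (by omega)]
    have h1 : (i * 1024 + (a * 32 + b)) / 32 % 32 = a := by omega
    have h2 : (i * 1024 + (a * 32 + b)) % 32 = b := by omega
    have h3 : (i * 1024 + (a * 32 + b)) / 1024 = i := by omega
    rw [h1, h2, h3]
  have e1 : c (pt (clf i u)) (fi i) = c (pt u) (fi i) := by
    rw [pt_clf hi hu, c_indep hc.1]
  have e2 : c (pt (clf i v)) (fi i) = c (pt v) (fi i) := by
    rw [pt_clf hi hv, c_indep hc.1]
  unfold mkE
  cases Nat.ble (clf i u) (clf i v)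
  · refine (key _ _ hV hU).trans ?_
    rw [e1, e2]
    exact eq_comm
  · refine (key _ _ hU hV).trans ?_
    rw [e1, e2]

theorem sem_mkA {c : Coding} (hc : Good c) {i j u : ℕ} (hi : i < 5) (hj : j < 5) (hu : u < 32) :
    semVar c (mkA i j u) ↔ Arc c (fi i) (fi j) (pt u) := by
  have h1 := clf_lt hj hu
  have h2 := clf_lt hi h1
  have e : mkA i j u = 5120 + (i * 160 + (j * 32 + clf i (clf j u))) := rfl
  rw [e]
  generalize ha : clf i (clf j u) = a at *
  unfold semVar
  rw [if_neg (by omega)]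
  have h3 : (5120 + (i * 160 + (j * 32 + a)) - 5120) / 160 = i := by omega
  have h4 : fi ((5120 + (i * 160 + (j * 32 + a)) - 5120) / 32) = fi j := by
    apply Fin.ext
    change _ % 5 = _ % 5
    omega
  have h5 : (5120 + (i * 160 + (j * 32 + a)) - 5120) % 32 = a := by omega
  rw [h3, h4, h5, ← ha, pt_clf hi h1, pt_clf hj hu, arc_upd_left, arc_upd_right hc.1]

theorem triv_true {c : Coding} (hc : Good c) : ∃ l ∈ triv, semLit c l := by
  refine ⟨_, List.mem_singleton.2 rfl, ?_⟩
  rw [sem_lp, sem_mkE hc (by norm_num) (by norm_num) (by norm_num)]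

theorem clT_true {c : Coding} (hc : Good c) {i u v x : ℕ} (hi : i < 5) (hu : u < 32) (hv : v < 32) (hx : x < 32) :
    ∃ l ∈ clT i u v x, semLit c l := by
  simp only [clT, List.mem_cons, List.not_mem_nil, or_false, exists_eq_or_imp, exists_eq_left,
    sem_lp, sem_ln, sem_mkE hc hi hu hv, sem_mkE hc hi hv hx, sem_mkE hc hi hu hx]
  by_cases h1 : c (pt u) (fi i) = c (pt v) (fi i)
  · by_cases h2 : c (pt v) (fi i) = c (pt x) (fi i)
    · exact Or.inr (Or.inr (h1.trans h2))
    · exact Or.inr (Or.inl h2)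
  · exact Or.inl h1

theorem clKgo_mem {u v i n : ℕ} (hi : i < n) (h : u.testBit i ≠ v.testBit i) :
    lp (mkE i u v) ∈ clKgo u v n := by
  induction n with
  | zero => omega
  | succ n ih =>
    unfold clKgo
    rcases Nat.lt_succ_iff_lt_or_eq.1 hi with h' | rfl
    · cases Bool.xor (bitN u n) (bitN v n)
      · exact ih h'
      · exact List.mem_cons_of_mem _ (ih h')
    · have : Bool.xor (bitN u i) (bitN v i) = true := by
        rw [bitN_eq, bitN_eq]
        cases h1 : u.testBit i <;> cases h2 : v.testBit i <;> simp_all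
      rw [this]
      exact List.mem_cons_self

theorem clK_true {c : Coding} (hc : Good c) {u v : ℕ} (hu : u < 32) (hv : v < 32) : ∃ l ∈ clK u v, semLit c l := by
  unfold clK
  cases hb : Nat.beq u v
  · have hne : pt u ≠ pt v := by
      intro h
      have h0 : u ≠ v := Nat.ne_of_beq_eq_false hb
      have : ∀ (u v : Fin 32), (∀ i : Fin 5, (u : ℕ).testBit i = (v : ℕ).testBit i) → u = v := by
        decide
      have h1 := this ⟨u, hu⟩ ⟨v, hv⟩ (by
        intro i
        have := congrFun h i
        simp only [pt] at this
        simp only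
        cases h1 : u.testBit i <;> cases h2 : v.testBit i <;> simp_all)
      exact h0 (Fin.ext_iff.1 h1)
    obtain ⟨i, hi, hci⟩ := hc.1 _ _ hne
    refine ⟨lp (mkE i u v), clKgo_mem i.2 ?_, ?_⟩
    · intro h
      apply hi
      simp only [pt, h]
    · rw [sem_lp, sem_mkE hc i.2 hu hv, fi_val]
      exact hci
  · exact triv_true hc

theorem clAnti_true {c : Coding} (hc : Good c) {i j u : ℕ} (hi : i < 5) (hj : j < 5) (hu : u < 32) :
    ∃ l ∈ clAnti i j u, semLit c l := by
  unfold clAnti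
  cases hb : Nat.beq i j
  · have hne : fi i ≠ fi j := by
      intro h
      have h1 := Fin.ext_iff.1 h
      rw [fi_coe hi, fi_coe hj] at h1
      exact Nat.ne_of_beq_eq_false hb h1
    simp only [cond_false, List.mem_cons, List.not_mem_nil, or_false, exists_eq_or_imp,
      exists_eq_left, sem_ln, sem_mkA hc hi hj hu, sem_mkA hc hj hi hu]
    exact not_and_or.1 (arc_anti hc.1 hne _)
  · exact triv_true hc

theorem clAE_true {c : Coding} (hc : Good c) {i j u : ℕ} (hi : i < 5) (hj : j < 5) (hu : u < 32) :
    ∃ l ∈ clAE i j u, semLit c l := by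
  simp only [clAE, List.mem_cons, List.not_mem_nil, or_false, exists_eq_or_imp,
      exists_eq_left, sem_lp, sem_mkA hc hi hj hu, sem_mkE hc hj hu (xor_lt hi hu)]
  obtain ⟨x, hx⟩ := pt_xor hi hu
  rw [hx]
  by_cases h : c (pt u) (fi j) = c (update (pt u) (fi i) x) (fi j)
  · exact Or.inl h
  · exact Or.inr (arc_of_ne h)

theorem clOutgo_mem {i u k n : ℕ} (hk : k < n) (h : i ≠ k) : lp (mkA i k u) ∈ clOutgo i u n := by
  induction n with
  | zero => omega
  | succ n ih =>
    unfold clOutgo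
    rcases Nat.lt_succ_iff_lt_or_eq.1 hk with h' | rfl
    · cases Nat.beq i n
      · exact List.mem_cons_of_mem _ (ih h')
      · exact ih h'
    · have : Nat.beq i k = false := by
        cases hb : Nat.beq i k
        · rfl
        · exact absurd (Nat.eq_of_beq_eq_true hb) h
      rw [this]
      exact List.mem_cons_self

theorem clOut_true {c : Coding} (hc : Good c) {i u : ℕ} (hi : i < 5) (hu : u < 32) : ∃ l ∈ clOutgo i u 5, semLit c l := by
  obtain ⟨j, hj, ha⟩ := arc_out hc (fi i) (pt u)
  refine ⟨lp (mkA i j u), clOutgo_mem j.2 ?_, ?_⟩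
  · intro h
    apply hj
    rw [h, fi_val]
  · rw [sem_lp, sem_mkA hc hi j.2 hu, fi_val]
    exact ha

theorem clFgo2_mem {j p i n : ℕ} (hi : i < n) (h : i ≠ j) :
    ln (mkE i p (Nat.xor p (Nat.shiftLeft 1 j))) ∈ clFgo2 j p n := by
  induction n with
  | zero => omega
  | succ n ih =>
    unfold clFgo2
    rcases Nat.lt_succ_iff_lt_or_eq.1 hi with h' | rfl
    · cases Nat.beq n j
      · exact List.mem_cons_of_mem _ (ih h')
      · exact ih h'
    · have : Nat.beq i j = false := by
        cases hb : Nat.beq i j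
        · rfl
        · exact absurd (Nat.eq_of_beq_eq_true hb) h
      rw [this]
      exact List.mem_cons_self

theorem clFgo_mem2 {j p n : ℕ} {l : ℕ} (h : l ∈ clFgo2 j p 5) : l ∈ clFgo j p n := by
  induction n with
  | zero => exact h
  | succ n ih =>
    unfold clFgo
    cases bitN n j
    · exact List.mem_cons_of_mem _ ih
    · exact ih

theorem clFgo_mem {j p q n : ℕ} (hq : q < n) (h : q.testBit j = false) :
    lp (mkE j p q) ∈ clFgo j p n := by
  induction n with
  | zero => omega
  | succ n ih =>
    unfold clFgo
    rcases Nat.lt_succ_iff_lt_or_eq.1 hq with h' | rfl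
    · cases bitN n j
      · exact List.mem_cons_of_mem _ (ih h')
      · exact ih h'
    · rw [bitN_eq, h]
      exact List.mem_cons_self

def wantF (want : ℕ) (j : Fin 5) : Option (Fin 5) :=
  if fld want (Nat.mul 3 j) 8 = 0 then none else some (fi (fld want (Nat.mul 3 j) 8 - 1))

theorem clF_true {c : Coding} (hc : Good c) {want : ℕ}
    (hl : ∀ (q : ℕ) (i : Fin 5), q < 32 → q.testBit i = false → LineOK (wantF want) c i q)
    {j p : ℕ} (hj : j < 5) (hp : p < 32) : ∃ l ∈ clF j p, semLit c l := by
  unfold clF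
  cases hb : bitN p j
  · have hb' : p.testBit (fi j : Fin 5) = false := by rw [fi_coe hj, ← bitN_eq, hb]
    rcases (hl p (fi j) hp hb').1 with ⟨q, hq, hqb, he⟩ | hne
    · rw [fi_coe hj] at hqb
      refine ⟨_, clFgo_mem hq hqb, ?_⟩
      rw [sem_lp, sem_mkE hc hj hp (by omega)]
      exact he.symm
    · obtain ⟨i, hi⟩ := Function.ne_iff.1 hne
      have hij : i ≠ fi j := by
        rintro rfl
        exact hi (c_indep hc.1 _ _ _).symm
      refine ⟨_, clFgo_mem2 (clFgo2_mem (i := i) i.2 ?_), ?_⟩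
      · intro h
        apply hij
        rw [← h, fi_val]
      · rw [sem_ln, sem_mkE hc i.2 hp (xor_lt hj hp), fi_val, pt_xor_one hj hp hb]
        exact hi
  · exact triv_true hc

theorem clU_true {c : Coding} (hc : Good c) {want : ℕ}
    (hl : ∀ (q : ℕ) (i : Fin 5), q < 32 → q.testBit i = false → LineOK (wantF want) c i q)
    {j : ℕ} (hj : j < 5) : ∃ l ∈ clU want j, semLit c l := by
  unfold clU
  cases hb : Nat.beq (fld want (Nat.mul 3 j) 8) 0
  · have hb' : fld want (Nat.mul 3 j) 8 ≠ 0 := Nat.ne_of_beq_eq_false hb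
    have h := (hl 0 (fi j) (by norm_num) (by simp)).2 rfl (fi (fld want (Nat.mul 3 j) 8 - 1))
      (by unfold wantF; rw [fi_coe hj, if_neg hb'])
    have hk : Nat.mod (Nat.sub (fld want (Nat.mul 3 j) 8) 1) 5 < 5 := Nat.mod_lt _ (by norm_num)
    have e : fi (Nat.mod (Nat.sub (fld want (Nat.mul 3 j) 8) 1) 5) =
        fi (fld want (Nat.mul 3 j) 8 - 1) := by
      apply Fin.ext
      exact Nat.mod_mod _ _
    have hx := pt_xor_one hj (u := 0) (by norm_num) (by rw [bitN_eq]; simp)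
    have e0 : Nat.xor 0 (Nat.shiftLeft 1 j) = Nat.shiftLeft 1 j := Nat.zero_xor _
    have hlt := xor_lt hj (u := 0) (by norm_num)
    rw [e0] at hx hlt
    simp only [cond_false, List.mem_cons, List.not_mem_nil, or_false, exists_eq_or_imp,
      exists_eq_left, sem_ln, sem_mkA hc hj hk (u := 0) (by norm_num),
      sem_mkE hc hk (u := 0) (by norm_num) hlt, e, hx, pt_zero]
    by_cases ha : Arc c (fi j) (fi (fld want (Nat.mul 3 j) 8 - 1)) 0
    · exact Or.inr (h ha)
    · exact Or.inl ha
  · exact triv_true hc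

def aI (a : ℕ) : Fin 5 := fi (fld a 3 5)
def aJ (a : ℕ) : Fin 5 := fi (Nat.mod a 8)

/-- The configuration of arcs (`pos`) and non-arcs (`neg`) never occurs at the origin. -/
def Excl (pos neg : List ℕ) : Prop :=
  ∀ c, Good c → ¬ ((∀ a ∈ pos, Arc c (aI a) (aJ a) 0) ∧ ∀ a ∈ neg, ¬ Arc c (aI a) (aJ a) 0)

theorem dig_lt (π i : ℕ) : dig π i < 5 := Nat.mod_lt _ (by norm_num)

def permF (π : ℕ) (i : Fin 5) : Fin 5 := fi (dig π i)

theorem permF_bij {π : ℕ} (h : permOK π = true) : Function.Bijective (permF π) := by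
  rw [← Finite.surjective_iff_bijective]
  intro k
  have h1 := Nat.eq_of_beq_eq_true h
  have h2 : (31 : ℕ).testBit k = true := by
    revert k; decide
  rw [← h1] at h2
  have key : ∀ i : Fin 5, (Nat.shiftLeft 1 (dig π i)).testBit k = true → permF π i = k := by
    intro i hi
    have e : Nat.shiftLeft 1 (dig π i) = 1 <<< dig π i := rfl
    rw [e, Nat.one_shiftLeft, Nat.testBit_two_pow] at hi
    have : dig π i = k := by simpa using hi
    unfold permF
    rw [this, fi_val]
  have lor_eq : ∀ a b : ℕ, (Nat.lor a b).testBit k = (a.testBit k || b.testBit k) :=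
    fun a b => Nat.testBit_or a b k
  simp only [lor_eq, Bool.or_eq_true] at h2
  rcases h2 with h | h | h | h | h
  · exact ⟨0, key 0 h⟩
  · exact ⟨1, key 1 h⟩
  · exact ⟨2, key 2 h⟩
  · exact ⟨3, key 3 h⟩
  · exact ⟨4, key 4 h⟩

theorem mapNeg_mem {π u : ℕ} {neg : List ℕ} {a : ℕ} (h : a ∈ neg) :
    lp (arcL π u a) ∈ mapNeg π u neg := by
  induction neg with
  | nil => cases h
  | cons b l ih =>
    rcases List.mem_cons.1 h with rfl | h
    · exact List.mem_cons_self
    · exact List.mem_cons_of_mem _ (ih h)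

theorem mapPos_mem1 {π u : ℕ} {pos neg : List ℕ} {a : ℕ} (h : a ∈ pos) :
    ln (arcL π u a) ∈ mapPos π u neg pos := by
  induction pos with
  | nil => cases h
  | cons b l ih =>
    rcases List.mem_cons.1 h with rfl | h
    · exact List.mem_cons_self
    · exact List.mem_cons_of_mem _ (ih h)

theorem mapPos_mem2 {π u : ℕ} {pos neg : List ℕ} {a : ℕ} (h : a ∈ neg) :
    lp (arcL π u a) ∈ mapPos π u neg pos := by
  induction pos with
  | nil => exact mapNeg_mem h
  | cons b l ih => exact List.mem_cons_of_mem _ ih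

theorem mapPos_cases {π u : ℕ} {pos neg : List ℕ} {l : ℕ} (h : l ∈ mapPos π u neg pos) :
    (∃ a ∈ pos, l = ln (arcL π u a)) ∨ ∃ a ∈ neg, l = lp (arcL π u a) := by
  induction pos with
  | nil =>
    right
    change l ∈ mapNeg π u neg at h
    induction neg with
    | nil => cases h
    | cons b t ih =>
      rcases List.mem_cons.1 h with rfl | h
      · exact ⟨b, List.mem_cons_self, rfl⟩
      · obtain ⟨a, ha, e⟩ := ih h
        exact ⟨a, List.mem_cons_of_mem _ ha, e⟩
  | cons b t ih =>
    rcases List.mem_cons.1 h with rfl | h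
    · exact Or.inl ⟨b, List.mem_cons_self, rfl⟩
    · rcases ih h with ⟨a, ha, e⟩ | h
      · exact Or.inl ⟨a, List.mem_cons_of_mem _ ha, e⟩
      · exact Or.inr h

theorem nthP_mem {known : List (List ℕ × List ℕ)} {k : ℕ} {p : List ℕ × List ℕ}
    (h : nthP known k = some p) : p ∈ known := by
  induction known generalizing k with
  | nil => cases h
  | cons q l ih =>
    unfold nthP at h
    cases hb : Nat.beq k 0
    · rw [hb] at h
      exact List.mem_cons_of_mem _ (ih h)
    · rw [hb] at h
      cases h
      exact List.mem_cons_self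

theorem sem_arcL {c : Coding} (hc : Good c) {π u a : ℕ} (hu : u < 32) :
    semVar c (arcL π u a) ↔ Arc c (permF π (aI a)) (permF π (aJ a)) (pt u) := by
  unfold arcL
  rw [sem_mkA hc (dig_lt _ _) (dig_lt _ _) hu]
  have h1 : ((aI a : Fin 5) : ℕ) = fld a 3 5 := fi_coe (Nat.mod_lt _ (by norm_num))
  have h2 : ((aJ a : Fin 5) : ℕ) = Nat.mod (Nat.mod a 8) 5 := rfl
  unfold permF
  rw [h1, h2]

theorem clP_true {c : Coding} (hc : Good c) {known : List (List ℕ × List ℕ)}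
    (hk : ∀ p ∈ known, Excl p.1 p.2) {k π u : ℕ} (hu : u < 32) :
    ∃ l ∈ clP known k π u, semLit c l := by
  unfold clP
  cases hb : permOK π
  · exact triv_true hc
  · cases hp : nthP known k with
    | none => exact triv_true hc
    | some p =>
      have hex := hk p (nthP_mem hp)
      simp only [cond_true]
      by_contra hcon
      push Not at hcon
      set σ : Equiv.Perm (Fin 5) := Equiv.ofBijective _ (permF_bij hb) with hσ
      apply hex (pull c σ (pt u)) (pull_good hc _ _)
      constructor
      · intro a ha
        rw [pull_arc]
        have h := hcon _ (mapPos_mem1 ha)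
        rw [sem_ln, not_not, sem_arcL hc hu] at h
        exact h
      · intro a ha
        rw [pull_arc]
        have h := hcon _ (mapPos_mem2 ha)
        rw [sem_lp, sem_arcL hc hu] at h
        exact h

theorem nthL_true {c : Coding} (hc : Good c) {learned : List (List ℕ)}
    (hl : ∀ C ∈ learned, ∃ l ∈ C, semLit c l) (k : ℕ) : ∃ l ∈ nthL learned k, semLit c l := by
  induction learned generalizing k with
  | nil => exact triv_true hc
  | cons q t ih =>
    unfold nthL
    cases Nat.beq k 0
    · exact ih (fun C hC => hl C (List.mem_cons_of_mem _ hC)) _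
    · exact hl q List.mem_cons_self

theorem clauseOf_true {c : Coding} (hc : Good c) {want : ℕ}
    (hl : ∀ (q : ℕ) (i : Fin 5), q < 32 → q.testBit i = false → LineOK (wantF want) c i q)
    {known : List (List ℕ × List ℕ)} (hk : ∀ p ∈ known, Excl p.1 p.2)
    {learned : List (List ℕ)} (hL : ∀ C ∈ learned, ∃ l ∈ C, semLit c l) (h : ℕ) :
    ∃ l ∈ clauseOf want known learned h, semLit c l := by
  have hi : hI h < 5 := Nat.mod_lt _ (by norm_num)
  have hj : hJ h < 5 := Nat.mod_lt _ (by norm_num)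
  have hu : hU h < 32 := Nat.mod_lt _ (by norm_num)
  have hv : hV h < 32 := Nat.mod_lt _ (by norm_num)
  have hx : hX h < 32 := Nat.mod_lt _ (by norm_num)
  unfold clauseOf
  cases Nat.beq (Nat.mod h 16) 0 with
  | true => exact clT_true hc hi hu hv hx
  | false =>
  cases Nat.beq (Nat.mod h 16) 1 with
  | true => exact clK_true hc hu hv
  | false =>
  cases Nat.beq (Nat.mod h 16) 2 with
  | true => exact clAnti_true hc hi hj hu
  | false =>
  cases Nat.beq (Nat.mod h 16) 3 with
  | true => exact clAE_true hc hi hj hu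
  | false =>
  cases Nat.beq (Nat.mod h 16) 4 with
  | true => exact clOut_true hc hi hu
  | false =>
  cases Nat.beq (Nat.mod h 16) 5 with
  | true => exact clF_true hc hl hi hu
  | false =>
  cases Nat.beq (Nat.mod h 16) 6 with
  | true => exact clP_true hc hk hu
  | false =>
  cases Nat.beq (Nat.mod h 16) 7 with
  | true => exact nthL_true hc hL _
  | false =>
  cases Nat.beq (Nat.mod h 16) 8 with
  | true => exact clU_true hc hl hi
  | false => exact triv_true hc

theorem scan_succ {N a : ℕ} {C : List ℕ} :
    scan N (a + 1) C = 1 ∨ (scan N (a + 1) C = a + 1 ∧ ∀ l ∈ C, bitN N l = true) := by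
  induction C with
  | nil => exact Or.inr ⟨rfl, fun l h => by cases h⟩
  | cons l t ih =>
    unfold scan
    cases hb : bitN N l
    · exact Or.inl rfl
    · rcases ih with h | ⟨h, h'⟩
      · exact Or.inl h
      · refine Or.inr ⟨h, fun m hm => ?_⟩
        rcases List.mem_cons.1 hm with rfl | hm
        · exact hb
        · exact h' m hm

theorem scan_zero {N : ℕ} {C : List ℕ} :
    (scan N 0 C = 0 ∧ ∀ l ∈ C, bitN N l = true) ∨ scan N 0 C = 1 ∨
      ∃ m, scan N 0 C = m + 2 ∧ ∀ l ∈ C, l = m ∨ bitN N l = true := by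
  induction C with
  | nil => exact Or.inl ⟨rfl, fun l h => by cases h⟩
  | cons l t ih =>
    unfold scan
    cases hb : bitN N l
    · change _ ∨ scan N (l + 1 + 1) t = 1 ∨ _
      rcases scan_succ (N := N) (a := l + 1) (C := t) with h | ⟨h, h'⟩
      · exact Or.inr (Or.inl h)
      · refine Or.inr (Or.inr ⟨l, h, fun m hm => ?_⟩)
        rcases List.mem_cons.1 hm with rfl | hm
        · exact Or.inl rfl
        · exact Or.inr (h' m hm)
    · rcases ih with ⟨h, h'⟩ | h | ⟨m, h, h'⟩
      · refine Or.inl ⟨h, fun m hm => ?_⟩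
        rcases List.mem_cons.1 hm with rfl | hm
        · exact hb
        · exact h' m hm
      · exact Or.inr (Or.inl h)
      · refine Or.inr (Or.inr ⟨m, h, fun k hk => ?_⟩)
        rcases List.mem_cons.1 hk with rfl | hk
        · exact Or.inr hb
        · exact h' k hk

theorem propa_sound {c : Coding} {cl : ℕ → List ℕ} (hcl : ∀ h, ∃ l ∈ cl h, semLit c l)
    (hs : List ℕ) : ∀ N, (∀ l, bitN N l = true → ¬ semLit c l) →
      ∃ N', propa cl N hs = some N' ∧ ∀ l, bitN N' l = true → ¬ semLit c l := by
  induction hs with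
  | nil => intro N hN; exact ⟨N, rfl, hN⟩
  | cons h t ih =>
    intro N hN
    obtain ⟨l, hl, hs⟩ := hcl h
    unfold propa
    rcases scan_zero (N := N) (C := cl h) with ⟨_, h'⟩ | h' | ⟨m, h', hm⟩
    · exact absurd hs (hN l (h' l hl))
    · simp only [h']
      exact ih N hN
    · simp only [h']
      have hsm : semLit c m := by
        rcases hm l hl with rfl | hb
        · exact hs
        · exact absurd hs (hN l hb)
      apply ih
      intro k hk
      rcases setF_bit hk with hk | rfl
      · exact hN k hk
      · have e : Nat.sub (m + 2) 2 = m := rfl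
        rw [e, sem_lneg, not_not]
        exact hsm

theorem addAll_sound {c : Coding} (C : List ℕ) : ∀ N, (∀ l, bitN N l = true → ¬ semLit c l) →
    (∀ l ∈ C, ¬ semLit c l) → ∀ l, bitN (addAll N C) l = true → ¬ semLit c l := by
  induction C with
  | nil => intro N hN _; exact hN
  | cons a t ih =>
    intro N hN hC
    apply ih
    · intro l hl
      rcases setF_bit hl with h | rfl
      · exact hN l h
      · exact hC _ List.mem_cons_self
    · exact fun l hl => hC l (List.mem_cons_of_mem _ hl)

theorem steps_sound {c : Coding} (hc : Good c) {want : ℕ}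
    (hl : ∀ (q : ℕ) (i : Fin 5), q < 32 → q.testBit i = false → LineOK (wantF want) c i q)
    {known : List (List ℕ × List ℕ)} (hk : ∀ p ∈ known, Excl p.1 p.2) (cert : List (ℕ × ℕ)) :
    ∀ root learned, (∀ l, bitN root l = true → ¬ semLit c l) →
      (∀ C ∈ learned, ∃ l ∈ C, semLit c l) → steps want known root learned cert = false := by
  induction cert with
  | nil => intros; rfl
  | cons s t ih =>
    obtain ⟨a, b⟩ := s
    intro root learned hr hL
    have hcl := clauseOf_true hc hl hk hL
    unfold steps
    cases Nat.beq a 0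
    · by_cases hC : ∃ l ∈ unpack 14 100 a, semLit c l
      · have := ih root (unpack 14 100 a :: learned) hr (by
          intro C hm
          rcases List.mem_cons.1 hm with rfl | hm
          · exact hC
          · exact hL C hm)
        simp only [cond_false, this]
        split <;> rfl
      · push Not at hC
        obtain ⟨N', h1, -⟩ := propa_sound hcl (unpack 32 3000 b) _
          (addAll_sound (unpack 14 100 a) root hr hC)
        simp only [cond_false, h1]
    · obtain ⟨N', h1, h2⟩ := propa_sound hcl (unpack 32 3000 b) root hr
      simp only [cond_true, h1]
      exact ih N' learned h2 hL

theorem permF_id (i : Fin 5) : permF 18056 i = i := by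
  revert i; decide

theorem check_sound {want : ℕ} {known : List (List ℕ × List ℕ)} {pos neg : List ℕ}
    {cert : List (ℕ × ℕ)} (h : checkCert want known pos neg cert = true)
    (hk : ∀ p ∈ known, Excl p.1 p.2) : Excl pos neg := by
  rintro c₀ h₀ ⟨hpos, hneg⟩
  obtain ⟨c, hc, harc, hl⟩ := choice (wantF want) h₀ 160 le_rfl
  have hlines : ∀ (q : ℕ) (i : Fin 5), q < 32 → q.testBit i = false → LineOK (wantF want) c i q :=
    fun q i hq hb => hl q i (by have := i.2; omega) hb
  have hroot : ∀ l, bitN (rootN pos neg) l = true → ¬ semLit c l := by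
    unfold rootN
    apply addAll_sound
    · intro l hl
      rw [bitN_eq] at hl
      simp at hl
    · intro l hl
      rcases mapPos_cases hl with ⟨a, ha, rfl⟩ | ⟨a, ha, rfl⟩
      · rw [sem_ln, not_not, sem_arcL hc (by norm_num), permF_id, permF_id, pt_zero, harc]
        exact hpos a ha
      · rw [sem_lp, sem_arcL hc (by norm_num), permF_id, permF_id, pt_zero, harc]
        exact hneg a ha
  have := steps_sound hc hlines hk cert (rootN pos neg) [] hroot (fun C hC => by cases hC)
  unfold checkCert at h
  rw [this] at h
  cases h

theorem all_nil : ∀ p ∈ ([] : List (List ℕ × List ℕ)), Excl p.1 p.2 := fun p h => by cases h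

theorem all_cons {pos neg : List ℕ} {known : List (List ℕ × List ℕ)} (h : Excl pos neg)
    (hk : ∀ p ∈ known, Excl p.1 p.2) : ∀ p ∈ ((pos, neg) :: known), Excl p.1 p.2 := by
  intro p hp
  rcases List.mem_cons.1 hp with rfl | hp
  · exact h
  · exact hk p hp

/-- If a single arc is excluded, there is no good coding at all. -/
theorem finish {a : ℕ} (ha : aI a ≠ aJ a) (h : Excl [a] []) : ∀ c : Coding, K c → ¬ ColFree c := by
  intro c hK hF
  obtain ⟨j, hj, harc⟩ := arc_out ⟨hK, hF⟩ (aI a) 0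
  -- a permutation fixing the source and moving the target
  have hc : Good c := ⟨hK, hF⟩
  apply h (pull c (Equiv.swap (aJ a) j) 0) (pull_good hc _ _)
  refine ⟨fun b hb => ?_, fun b hb => by cases hb⟩
  rw [List.mem_singleton.1 hb, pull_arc, Equiv.swap_apply_left,
    Equiv.swap_apply_of_ne_of_ne ha hj.symm]
  exact harc

/-! ### The certificates -/

def kn0 : List (List ℕ × List ℕ) := []
theorem hk0 : ∀ p ∈ kn0, Excl p.1 p.2 := all_nil

def cert0 : List (ℕ × ℕ) := [
  (8200, 2814754062073928),
  (16, 1266641690165256),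
  (6148, 1407379178520632),
  (4100, 844429225099304),
  (2050, 422216760033304),
  (145, 43521329506126753368637495),
  (2129, 155347262968385268820738071),
  (2121, 77976010513048928625098792),
  (6150, 1964522903617944902696999),
  (6278, 58067103717080725670854759),
  (8208, 563),
  (8, 35),
  (137, 41103477866897495019225095),
  (4102, 1888965039892305457184775),
  (4230, 58066808569175546318028967),
  (8194, 515),
  (8327, 698599699303185419230842717951176382349336),
  (164, 2682812666740743),
  (37, 49565958604199899242168327),
  (549, 353006339327472917310078983),
  (293, 350588487688243040485376023),
  (11409109051629705, 106747953239106279626427625807906988390549418744735027812058689129686447508854601605733883028959503336723263173235785917130159947943),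
  (34103300, 121910019530802960779498110849477453379619349982554537742188271406363325709305589330486038372482940528634884238243199639647252062857640180817980067031670057206741467176),
  (8197, 4928317451612352979195831777221268522833625032167982154125958601213571056227256490747138811079313020242338557542936632360998564903760589270971630082352692751791635015099015436959815),
  (2080, 2533279085363207),
  (0, 719423018973456760839)]

theorem ck0 : checkCert 13452 kn0 [34, 3, 25, 17, 8] [28, 16, 4] cert0 = true := by decide +kernel

theorem ex0 : Excl [34, 3, 25, 17, 8] [28, 16, 4] := check_sound ck0 hk0

def kn1 : List (List ℕ × List ℕ) := ([34, 3, 25, 17, 8], [28, 16, 4]) :: kn0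
theorem hk1 : ∀ p ∈ kn1, Excl p.1 p.2 := all_cons ex0 hk0

def cert1 : List (ℕ × ℕ) := [
  (2050, 422216760033304),
  (6146, 1266641690165304),
  (4098, 703691736743976),
  (4193, 310090063026963051255431175),
  (32, 189556674469877613782330359436825583184510999),
  (545, 164413911467589808278208519),
  (289, 87042659012253472377536535),
  (161, 48357032784585270067462183),
  (8202, 3324564450684608882671639),
  (8208, 563),
  (8196, 531),
  (8195, 396140815061632138567049281703),
  (8267, 22366308254491593366568967),
  (8273, 24179696983913537128628247),
  (8261, 20552919525069649604509735),
  (4194, 2959889596940327),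
  (6178, 10427003640920417845117095),
  (2082, 10313666845331546359988375),
  (6242, 328847597844827281735811095),
  (2146, 328847007549015892238008615),
  (0, 1597421289686726634227921570373488667114045727309831)]

theorem ck1 : checkCert 12872 kn1 [8, 24, 34, 16] [28, 12] cert1 = true := by decide +kernel

theorem ex1 : Excl [8, 24, 34, 16] [28, 12] := check_sound ck1 hk1

def kn2 : List (List ℕ × List ℕ) := ([8, 24, 34, 16], [28, 12]) :: kn1
theorem hk2 : ∀ p ∈ kn2, Excl p.1 p.2 := all_cons ex1 hk1

def cert2 : List (ℕ × ℕ) := [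
  (8, 703691736743944),
  (10368, 1112396529672),
  (2050, 422216760033304),
  (10560, 81604378648),
  (137, 41103477866897628163211288),
  (6152, 1688854155231288),
  (11328, 1318554959928),
  (8196, 2533279085363272),
  (11584, 837518622792),
  (2145, 310089767879058005046591560),
  (10817, 530),
  (11265, 402),
  (2064, 768799145991),
  (2593, 314321008247708794841202760),
  (8200, 547),
  (10944, 55466025811044411561819039383396315824279),
  (10689, 1176821039111),
  (4100, 66902575877961721805088497466735030528114871),
  (4241, 155952021026097762760916999),
  (4165, 20552329229259089035395095),
  (2058, 3060111927644664664948743),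
  (2401, 312507619518286851079143496),
  (2122, 492133549633599591622973839294837224508066096373788284196348204219802963990279457434798594761754149127),
  (16, 51),
  (6146, 387),
  (6216, 19419256421275549241966903),
  (2235364921479, 37871165583428788683127),
  (2057, 2931442020830753234994964988247),
  (2121, 77976010513050509173063687),
  (2321, 82207250881701092809244695),
  (2315, 80393862152278668010848295),
  (4102, 1888965039893748566196263),
  (12, 717818152140496005234887),
  (6156, 3777911633040782017953847),
  (268, 1002758899499063),
  (4230, 18335377552176028014098097324949528),
  (4167, 21156792139066403622748231),
  (141, 42312403686512326057394200),
  (6412, 116133321990446158096368135),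
  (6220, 19457035353139468476350551),
  (10690, 5579162517559),
  (10884, 8946416877623),
  (8461, 6017002240910042844434650223129832928439597113802983),
  (10373, 9904194584599),
  (2344, 3113821224828951),
  (8205, 116133617138353124155588647),
  (8333, 117266985094239777422574183),
  (2089, 89460805799387905784807735),
  (2601, 391692260703045062022398519),
  (2153, 387461020334397021006856215),
  (4260, 3105025131806775),
  (11140, 11145440133191),
  (4132, 13298202462505299573997671),
  (4645, 165623427583014796158566407),
  (4197, 30223735786176122433044503),
  (4324, 58369040024079341050659191),
  (11653, 11141145165895),
  (135452747, 84061080444291872085344216154663),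
  (2292358092935, 10554182976326695667384984782685826899592785256944752015056328644174171820873204139028385118000262807699746087870186398064326791724079099193690238948075876235270799193297155173153848900144739194042033010022160778653896660279005097223221855043475175707373468390033370373670393473953019212067718095686289201134621361780924875527),
  (102864967, 1305461381454852583259816528901428119020332103582008906823631747138758610536524692863524877522115779234458272871108061182162794601781101486015851916504347976326081197428408219443369799540846589670064807),
  (137746566, 457180532251979550985105875690407851691634126071880143845935770843318717240526662740720519723358285853996883395674636288327),
  (136424643, 669698975464320323802084526697855983979805006065708426180277376380081722014553113036778965795199538068002929710281618313320214960208520162208502748183941533539902729526872805102709793456905777592796975274915112239554392932230084865650486724569884714319423644077074928066669999314615081214720533170952881450869523161881402461374975574839),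
  (8407, 167427122333110870131057675111257654244660722156214503100477051730616736244157260600589507936684722570925503111637088549099465407892936269942780876694770765392199014141917030551628678730738806908191314019034677740551394668406448213958018195590930397265649459173705929629165345830165585950016254604390777444062378199589839841528414014985184222024137943413500709534258680072600375919373477867717885243830022919334848226423074035227998226960333404107164129874325353726314603193953561742796103015442707941116644485564913248031304301080180744099235969314067258795271679444465983934282195024104626174870250605891971716564039951301797827445764789422715857126597336166659967168905964684103),
  (6374, 3813110620094471),
  (8326, 264353791887666917842858775061995523820323147953221589602874279616096076007968496103817566693118165636893113469214303351009571101426520393970948371279964437622635053402196742539796905018697483637331187454662378783591),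
  (8198, 59238545752741494046851079),
  (8397, 117871448004048466399461383),
  (6279, 11935043417850448445479),
  (8343, 214037719061204890739015735),
  (148, 1556912759898135),
  (10436, 10458245365799),
  (6215, 785979015223),
  (6311, 69551899003419977708470407),
  (21, 44730255325741515687329816),
  (11717, 99941488547196681800511426279430831405665353783),
  (6247, 69533009537488430408138935),
  (180, 16358295943404760952995959),
  (6308, 10733123272743),
  (6183, 367533224072494453253735255),
  (53, 54401661882658480365502488),
  (309, 505330992598915025091953911),
  (6373, 68947436093612594401640663),
  (676, 6989120841391178690592983),
  (37, 204308463514872979065405447),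
  (549, 353006339327475872247578631),
  (293, 350588487688248263165607959),
  (8260, 944491743323255497293863),
  (8330, 14441154865962927881306228610040327),
  (8194, 20552919525074941004218391),
  (8269, 116662522184432462835221175),
  (8202, 97924171980411345624367143),
  (8525, 119080373823661721184633559),
  (8266, 97943061446337532805513287),
  (44, 4381079702562619823518516198244407),
  (6219, 2503965933591),
  (428, 425655225299942631654031383),
  (1197, 361468820064774977935638567),
  (6155, 96733840478817518119552135),
  (6573, 3089869267829636339781478348519038566513630126760862578586473786713253292169557702808175431),
  (10916, 79315161055271),
  (8604, 4248517224693783),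
  (6189, 425656110743654046543905847),
  (6445, 427960625587300893039001607),
  (8221, 124520540011927689909765015),
  (8477, 273218415824533056993099783),
  (8592, 57764381779377653302115906522972215),
  (2360, 18209463604689524437811255),
  (8209, 120893762553087856834773015),
  (8337, 155952611321914782960844807),
  (8401, 156557074231718180538023959),
  (2105, 94296509077846491203110183),
  (6180, 11031466550734260782759975),
  (2594, 49975936491570099197023222826533303),
  (4148, 77884532106185648115314561694826679),
  (6501, 107595283389418664183726119),
  (7341, 436423106324597593545375799),
  (2082, 333663821361543067794933367),
  (3107, 319761174435974626127380552),
  (4213, 35059439064634909714808840),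
  (11108, 80964428496951),
  (10336, 70931384893479),
  (11365, 80960133529623),
  (11297, 114464848857739794489207564299268212870103433239),
  (3120, 71137543323655),
  (2097, 323992414804625828238852168),
  (2609, 469063513158389025784987655),
  (2417, 467250124428959454161012375),
  (8724, 3694363364294679),
  (8532, 64811881015656678618903937286701178591117463),
  (8213, 160788314600366496431472983),
  (8341, 194638237549584428379930631),
  (0, 843915569391140335340222123058660023)]

theorem ck2 : checkCert 9739 kn2 [2, 8, 26, 33, 11] [20, 24, 3] cert2 = true := by decide +kernel

theorem ex2 : Excl [2, 8, 26, 33, 11] [20, 24, 3] := check_sound ck2 hk2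

def kn3 : List (List ℕ × List ℕ) := ([2, 8, 26, 33, 11], [20, 24, 3]) :: kn2
theorem hk3 : ∀ p ∈ kn3, Excl p.1 p.2 := all_cons ex2 hk2

def cert3 : List (ℕ × ℕ) := [
  (6146, 1266641690165304),
  (4, 422216760033288),
  (145, 155951430730287404055265287),
  (2080, 2533279085363224),
  (2145, 29014514818656309610545160),
  (4100, 844429225099304),
  (8194, 2392541597007944),
  (161, 310693935640960007137132631),
  (8198, 2115638631069704830058551),
  (8262, 58048509399054563881779207),
  (11649, 546),
  (4128, 1387274436615),
  (4112, 307),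
  (2064, 179),
  (2129, 24178811540197797206687751),
  (6150, 1964522903618700816941063),
  (6214, 58048214251150277882150919),
  (4167, 355595073441808845658553048149406334844936),
  (2122, 989564759965703),
  (2059, 22365422810775853444628487),
  (2401, 106385767273993676303368199),
  (2385, 101550063995534541129252887),
  (4099, 4826781403319864558664248612779719414182508993428200343986183930485210612229828356604841678483507036871441409187782085178579045886768164107554945583484676033507533229407927411696778840016647303728662588736872212031101304472707329425575),
  (8, 703691736743943),
  (4193, 29014809966562313597091863),
  (4177, 24179106688103796898267175),
  (289, 311902861460574636311838759),
  (273, 157160356549902033229971511),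
  (6154, 3173448723232505357926439),
  (8202, 3324564450684608882671655),
  (6218, 96733840478819373545422871),
  (8266, 96734135626722628752900487),
  (0, 1550653237210469972793251978696069866796439098622167)]

theorem ck3 : checkCert 4778 kn3 [24, 1, 12, 17, 32, 20] [26, 25] cert3 = true := by decide +kernel

theorem ex3 : Excl [24, 1, 12, 17, 32, 20] [26, 25] := check_sound ck3 hk3

def kn4 : List (List ℕ × List ℕ) := ([24, 1, 12, 17, 32, 20], [26, 25]) :: kn3
theorem hk4 : ∀ p ∈ kn4, Excl p.1 p.2 := all_cons ex3 hk3

def cert4 : List (ℕ × ℕ) := [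
  (4, 422216760033288),
  (10304, 562640715784),
  (8200, 2814754062073928),
  (11648, 1387274436680),
  (6146, 1266641690165304),
  (11200, 219043332152),
  (145, 155951430730287404055265367),
  (2056, 844429225099288),
  (10688, 1181116006424),
  (2121, 21760959900968603281784840),
  (6176, 451),
  (2064, 179),
  (2129, 24178811540197792911720456),
  (6150, 1964522903617876183220327),
  (6214, 58048214251149247090000023),
  (8, 35),
  (11072, 142578311742804658206672051454852861001943),
  (273, 157160356549902033229971479),
  (4112, 133804811473553591229693881397249038929101047),
  (4641, 314321303395614253366902791),
  (4241, 43521919801937112074289175),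
  (8194, 515),
  (8196, 531),
  (10753, 2399292933409865831),
  (6148, 1730871820295),
  (10369, 2019020171154292759),
  (6212, 19381477489412660799734103),
  (4098, 1112396529687),
  (4165, 39290679433285909962817543),
  (12, 717818152141595516862471),
  (401, 158369282369516662404677639),
  (140, 116094657614867456717750759),
  (2341638294035, 11979928921280016447306587220979750049505216418546103),
  (135385159, 82793429832848022289226833854472),
  (6153, 2931442020830753235407281848823),
  (6217, 77976600808859149891797479),
  (6433, 87043544455970586689011735),
  (6345, 79185526628473916505457015),
  (6281, 78581063718666670637580503),
  (4114, 452513636818014442852277518065770028920875845901613874726318665508089735810830721494322212580232441393752294012426752989767104482044660099510522765206896700996133814620930759902543298429511),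
  (8216, 7555804819336910505771063),
  (2072, 1435617857537850308821031),
  (4626, 174237024047768956013904247),
  (4243, 44126382711744559805628440),
  (8472, 232190495821358280841625655),
  (2328, 232189610377642467905241143),
  (2137, 26596663179427055556100167),
  (136534157, 709488735049726052462602069739878121210487),
  (281, 111856818722353245103740399785305653436171373276165999772359965655695831),
  (6410, 1847183829630983),
  (25, 232189315229737082393985047),
  (153, 233322683185626896756899847),
  (6155, 80394452448089576472313895),
  (6283, 97923876832500531274449351),
  (4304, 8762080176942231050028707112550439),
  (2074, 33912268085468531488291329237057719),
  (4102, 62864732915773648475783191),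
  (4166, 58047919103246060601999367),
  (8263, 1679332212743),
  (2146, 2678414620229639),
  (8199, 58048509399057037782941719),
  (8327, 59238545752740188376793095),
  (8409, 65283174850812166019219479),
  (2083, 29618977728463628492865591),
  (2595, 333663821361546435049291783),
  (2339, 331245969722317520297263127),
  (2851, 336081673000773769253355559),
  (164, 2682812666740823),
  (10500, 11008001179751),
  (36, 11484813733083424531415175),
  (549, 165622837287204437452914695),
  (805, 242994089742540562900189511),
  (11525, 11003706212407),
  (104452327, 4590576642885970632018197411427919667546590137024711),
  (6375, 73514197951349123116589519951962853761015497597750828978342945795163932222910627879),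
  (8406, 3813110620094471),
  (6183, 367571003004361533584048151),
  (6247, 368118797516375099623604231),
  (6311, 368723260426181108540899351),
  (8215, 64678711941003614481285415),
  (8279, 213376587753602796811715495),
  (8400, 49975936491561539907773983667257511),
  (2162, 16339406477473144933187655),
  (2659, 178087161133966075236248579481410771287791601362101395926528565702944301066825929006370337175180468925030428520253884197659009299453169838616124886811633012449075052902196570538651164298273457571573782834014448517959),
  (2131, 175011197003055910304612359),
  (8402, 11654818926466456881201271),
  (2675, 189216075383526359998398487),
  (11266, 5166845657127),
  (8722, 176051003073001533359521831),
  (11602, 40419937222695),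
  (10755, 6124623364135),
  (2579, 17247705712247030415399),
  (10835, 41858751266855),
  (10320, 35747012804631),
  (2067, 174236728899863776661079335),
  (2651, 181943630999909580270469127),
  (10577, 35742717837351),
  (10962, 40282498269207),
  (10706, 731751308983940584559117024100375),
  (0, 175059601259533709606935)]

theorem ck4 : checkCert 12826 kn4 [1, 34, 24, 10] [35, 25, 16, 4, 12, 33] cert4 = true := by decide +kernel

theorem ex4 : Excl [1, 34, 24, 10] [35, 25, 16, 4, 12, 33] := check_sound ck4 hk4

def kn5 : List (List ℕ × List ℕ) := ([1, 34, 24, 10], [35, 25, 16, 4, 12, 33]) :: kn4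
theorem hk5 : ∀ p ∈ kn5, Excl p.1 p.2 := all_cons ex4 hk4

def cert5 : List (ℕ × ℕ) := [
  (2080, 2533279085363224),
  (10816, 2280627634200),
  (8194, 2392541597007944),
  (11520, 287762808904),
  (8261, 39291269729096268668469271),
  (4, 422216760033288),
  (10304, 562640715784),
  (2145, 29014514818656313905512551),
  (161, 310693935640960007137132583),
  (36, 944491743318307694968855),
  (8198, 2115638631069842269011991),
  (164, 348208414980876258261336151),
  (8262, 58048509399054495162302615),
  (4098, 703691736743976),
  (10880, 150323855400),
  (137, 78580178274951068154593431),
  (293, 88251584831868372135182376),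
  (10369, 258),
  (6148, 1407379178520632),
  (11264, 768799146040),
  (2593, 164414206615496082847694904),
  (10753, 402),
  (6176, 451),
  (6304, 38988743126287633885429767),
  (8208, 563),
  (8337, 43522510097747470779940871),
  (6180, 11031466550727938590900231),
  (6308, 348209300424592277356150791),
  (2056, 163),
  (11329, 2035768069707530359),
  (2336, 77673779058145202611945943),
  (2321, 157160651697807139568353336),
  (2121, 21760959900968538857275447),
  (4112, 1318554959927),
  (11137, 238831612228272199),
  (4102, 1888965039892099298754871),
  (8200, 2349347110935),
  (4304, 58180145364764486522634295),
  (4166, 58047919103245717004615719),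
  (8264, 19419551569180866033746503),
  (6215, 355595073467161857663136082922452035830311),
  (2130, 1552514713387015),
  (2067, 24783274450005111794040839),
  (2657, 183757019729328843972936359),
  (2323, 176503464811642099716849687),
  (4261, 3093998966411572544162007526155199039637026699739783),
  (8332, 3105025131806727),
  (8205, 42313584278132841605234695),
  (8593, 120893762553085245494657031),
  (8461, 118475910913854475316756679),
  (8269, 116662522184432600274174711),
  (10824, 19872813678615),
  (2088, 120067095731505238892990171317163459451407664146144750335929424290656474218858531105645460587099443392367342785473784834292697468715033577868992033602871288227954688087),
  (2601, 166832058254724245980446727),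
  (2153, 31432366457885636679434248),
  (11593, 19868518711351),
  (27613192804227078, 247588014543965441468377033867495),
  (4100, 352845481880057995630533419472210730891492640237423957793580925365320503347973187956073334886153976500018697982749803705318506903),
  (4133, 348209005276687372881231879),
  (4230, 58066808569177126865993751),
  (4645, 353006929623283894491021335),
  (4197, 348775689254634135488561191),
  (4325, 349984615074245741006291367),
  (6188, 57764381779366732829621040653008935),
  (44, 4381079702555241125886695915388967),
  (6316, 425580552879928063501009639),
  (301, 90669436471097286887211048),
  (1122701041739, 673614482016406386481962431238673650216869050787163383946470936165558366881714438170725368727478245041791464746646445076121614072872935595643658237177499675273792282629206646441552231706919656651218750153556624821136577970263492687235381278703587750190286626887828039),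
  (142071943, 78044812252827059975486973452463280290596902723863866757158306259616518744433178294988750810437986098177733320420912484456528258478438713528479853519902585456723618510735984824120316393556457617233586478376118665880184896513353206134154175341526643328947214888884901396982620777575098402771626137755011674640879196722505835530952922797135038579551200178947951579294594634779669588037418276020188770290101796710724633831607502318809135104663126618993726423209144086096155947091873881085707795923105208947593452555124783839138209534154405433866847425559947825958538022407658286797989301833630013470311430364936409495467297818673817563296485470490453746460634052376988836157189276300835427905882979402853033774052407431595595650528676803461972648961491989676764235582595348139947735594702973100902642567236618615377549688299097615357769941149650777925574350676220516132516477060029529788682561650450691851326325783),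
  (8671, 1296391414664194568511266073058847184269504054883367851384773909277079068807828763302181016798028622216794948462871997984370948535643290144629674392740387876253647345285109767310631951034720142942225264983897630877719430213144049096105803137984168541284021058236583181108629419288994143360400756191650897483963504366812676011901092167578052824410338854302422173121668244739023769340217300424133891929924324799711141029855092314120830941220894010957637336272704853583393395669081714035749398761622083392648631295324536819377335609238813907306134183835618290966652077451215038706823166918573714074385625205935832681586691068896699795510700116531187740204831674764639620315055531305435245195558534157638578306090607030218117310522025060295131400717335733982567104960411166047051257603645216714966243181118877403545055191103662345455012262457905647250098312502897058718925570567819325408615856061607801724232240460751233296107366204454801049903156618680914555561665525620265220744315775008293346955867616951214689344851397654016845357307819864740399492560488507828835416501668276193984903),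
  (11470, 33204392165383),
  (11727, 33200097198087),
  (6278, 2597991025649488252943557368707786473626851183758457378840913002802565075799850473853518233140079908204069788038095563031844563908432764013097547330388313245813403086965244171133392826958984559141322224558713398992539644844715150171130519444338788408923873141551366960616090202771262555811042692258222229921686293936090366985361901286387724622816499892769505985718684715565270316714912975477559554594237821181544201397127074650271453319288290523524060139277983427759422722444418865946596596587018619810205771321918987254112218413693553056306779427852558553925078303867900609305967362663791683530021741001975240968713402870306716322693633263770560587042148865229778324360389529082678216257172448186136125786826219244157973637480311996587797676200139185616741328464465913404264768909143795233355080428412480617148888629320265439137707783889747198707731406768740043760915184088571243184126139438331182850818516091747749591546513773919507620045086582450907998681190900482247672050299268015142820500600668180808705324609484259179847596892929063995754916103632586429690660840649262119),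
  (6150, 59238250604836108535595015),
  (6213, 59257140070766144007438359),
  (6147, 19381477489412592080257927),
  (6241, 29015105114466668316197719),
  (16, 1266641690165271),
  (545, 314320713099803615488376904),
  (273, 82206955733794882664267816),
  (8210, 5742416089913661073653815),
  (8274, 174105388082064187333804039),
  (4179, 366484109174405322288964021396844931187335),
  (6218, 1833989690097671),
  (11330, 5716601470999),
  (4115, 174104797786253347591815207),
  (4627, 178921611598775506626937671),
  (4307, 175899297049742438383484951),
  (4243, 175294834139933680687120423),
  (6155, 22366013106586551452696791),
  (6497, 106386357569802935497393207),
  (6347, 98528339742307914581278999),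
  (6216, 5515742498736674017640551),
  (536, 1864776015675495),
  (2138, 2058970233275406526447719),
  (24, 7858036274239537007296663),
  (6153, 21761550196780267657494583),
  (6433, 87043544455973953943371783),
  (6281, 78581063718671893317812247),
  (6437, 88252470275588445679124519),
  (801, 316738564739033153010663495),
  (281, 84624807373024415891587112),
  (2075, 27201126089234370143453303),
  (2913, 261128272184665111154132583),
  (2331, 253874717266977404825371831),
  (2650, 252231333730939386766296055),
  (4116, 6120205408543645007611047),
  (11208, 17811229376599),
  (8795, 1071424201723859454550286981460692485563724106885800227453639113303716283633631591),
  (4693, 180130537418390273240596855),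
  (10441, 19250043420711),
  (11154, 41931765710887),
  (8219, 251627756264847129201082871),
  (4704, 35048083023276271658990653860216839),
  (4129, 183757314877235947471110151),
  (4641, 314321303395619540471644167),
  (4321, 311298988846582898815402007),
  (8216, 7555804819335604835713335),
  (8345, 45940361736976729129353223),
  (8987, 258711305989151459582672999),
  (2848, 47704306615951667376579308402245959),
  (10520, 54988466290711),
  (2072, 241785459070831113078310807),
  (2649, 181339168090099585623524615),
  (540, 5704637158050635192467687),
  (28, 275635086872138711713185799),
  (929, 317947490558647782185369607),
  (285, 85833733192638843202830359),
  (6414, 9142519957581317456003079),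
  (6159, 81603378267703037415916039),
  (6625, 145071983797478422072000519),
  (6351, 137213965969979896462573591),
  (4310, 2124260759830535),
  (11078, 14993730830359),
  (4118, 214584923277413801789489175),
  (4833, 316134692125035917956088135),
  (8222, 172831115570991213737906538769345500395077639),
  (9055, 260524694718574983892697095),
  (8207, 290275603560652168191018055),
  (8463, 137818724027695482779205639),
  (8399, 137214261117890023617724439),
  (10842, 59455232278583),
  (2346, 13978223236043407567618087),
  (11142, 15543486644263),
  (10762, 619339294883312021893841502761483728954640868014016168455),
  (11275, 23716809408519),
  (2090, 408617222177650076626716503),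
  (11655, 15539191676983),
  (2394, 22759031701543),
  (2059, 254479180176784650693247719),
  (2401, 1963864818989243345467395949875650643185631239),
  (2315, 99132212356313185519665175),
  (2411, 109408081823029493325889575),
  (416, 19471192447678872323122094950842599),
  (10312, 18154826760231),
  (11594, 22827751178279),
  (13, 313111787280189265486544935),
  (141, 117265804502629436652257287),
  (413, 124519359420306903778984455),
  (10884, 8946416877591),
  (11212, 26607322398743),
  (0, 8352032216584181372609774146567212912729558541511493304170799812344659442915082241431)]

theorem ck5 : checkCert 5226 kn5 [12, 32, 1, 16, 25] [35, 28, 17] cert5 = true := by decide +kernel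

theorem ex5 : Excl [12, 32, 1, 16, 25] [35, 28, 17] := check_sound ck5 hk5

def kn6 : List (List ℕ × List ℕ) := ([12, 32, 1, 16, 25], [35, 28, 17]) :: kn5
theorem hk6 : ∀ p ∈ kn6, Excl p.1 p.2 := all_cons ex5 hk5

def cert6 : List (ℕ × ℕ) := [
  (6146, 1266641690165304),
  (11200, 219043332152),
  (10433, 386),
  (8194, 2392541597007944),
  (11520, 287762808904),
  (10497, 514),
  (4128, 2814754062073896),
  (11136, 2349347110952),
  (8265, 77976895956764470978543687),
  (11649, 546),
  (2050, 422216760033304),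
  (10560, 81604378648),
  (10305, 130),
  (10368, 88133133032919202853256247083631391015063),
  (10881, 1108101562375),
  (8, 55752203278693874933119591575797635102015671),
  (289, 311902861460574636311838727),
  (273, 157160356549901891496050744),
  (137, 41103477866897495019225127),
  (4130, 10351445777194503521697959),
  (10753, 402),
  (6148, 9968849010137153420170267804082270813859129983350324903581593513855494832260415420454885586984996369049444276446917502055379737779466202597908264418265129170808112722816492884023818055036852874308998501374478204914133039483884116795728067632212757527045441895942311579921928735306226269084849054635369247682643275611180174121502407576580576587159492295401640416991637787170068811592303355831750153707270821161386746243131661121312817938488),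
  (4112, 307),
  (10688, 68015924564307726147293940685677198858025036447755340441855336994488128893825654963090384700359949304567329822335957712889117987721504923881367546181027320473137422795490197591),
  (2056, 48627382967384813316381995902557088607215503330885080718129511391937371922959653263979990670658451944292236552009147805539943885137546356798075260474734717307896957575068490137703),
  (2120, 5896873890257804325056706920095838784244211072072931234375847769115451926330451396952801377845247340820017852607481904736816927887395642941462280688260003176448968884343),
  (6176, 451),
  (10816, 32119555180518427149499617081187893303),
  (11585, 2276332666887),
  (2080, 837518622727),
  (4099, 396140821259738148020653392295),
  (4193, 29014809966561488963371399),
  (4195, 29619272876368872270201031),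
  (4177, 24179106688103659459313703),
  (8202, 417984967727167166032942191588933655),
  (40, 982270675181196137202087),
  (8266, 2959889596940343),
  (11650, 5785320947783),
  (6154, 3173448723232780235833671),
  (8459, 80394747595993862471942184),
  (1065, 321574268017491665414520904),
  (296, 2973083736473623),
  (169, 50774884423814528416874599),
  (11139, 6743098654807),
  (6496, 97017182467790727624523863),
  (6218, 96733840478817792997458631),
  (10504, 19804094201959),
  (10912, 70519068033127),
  (11529, 19799799234583),
  (2123, 361039591307473258676595899124686205747735),
  (4166, 989564759965703),
  (10946, 5098126180375),
  (2059, 96733250183009839473492007),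
  (2315, 99132212356306725888851975),
  (2401, 106385767273994226059182103),
  (4103, 21156792139068048595222599),
  (4321, 67700436194229622553969431),
  (4305, 62864732915773442317352983),
  (4323, 68304899104039548481437735),
  (10691, 5574867550327),
  (12, 4231258815395786922131527),
  (4164, 3060111927646520090820743),
  (268, 1002758899499143),
  (10312, 18154826760343),
  (417, 313111787280189192472100936),
  (401, 158369282369516726829187128),
  (141, 42312403686512124193931351),
  (4101, 20552329229259428337812039),
  (4257, 48357623080395555758670807),
  (4241, 43521919801940200155774999),
  (4259, 48962085990203007784977191),
  (10569, 18150531793015),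
  (8206, 19471192447673264512924580600348791),
  (10884, 8946416877671),
  (8463, 81603673415608358502662167),
  (8270, 135419761854395572706869287),
  (8526, 135495319718119425445986359),
  (6479, 32270580022170988920957487245796286239656552977690507224285607),
  (2394, 2133056852852743),
  (10762, 23721104375831),
  (6159, 135495024570214246093160487),
  (6625, 145071983797474779939733511),
  (6287, 136609503060168733584524231),
  (6223, 136005040150366985274785831),
  (2075, 104572378544570976627065335),
  (2913, 261128272184668890725351431),
  (2139, 252061328537560546304589847),
  (11275, 23716809408631),
  (2384, 18822155340360247982126081182269559),
  (4182, 9085851559785644762857511),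
  (2065, 101550063995534128812393047),
  (2321, 157160651697811537614864391),
  (2129, 155347262968385127086818583),
  (4119, 25992495417529176634163255),
  (4833, 222442941104902156916360567),
  (4631, 217607237826448588019859479),
  (4835, 223047404014714694183944231),
  (4310, 213432665855590034944557175),
  (6156, 3777911633040232262140359),
  (28, 38942305667175326345051995759444199),
  (6543, 139027354699397991933935927),
  (929, 317947490558647782185369623),
  (412, 2137454899363863),
  (10444, 28050431410215),
  (8222, 172831115571007693195713342674330227539181719),
  (8670, 290275603560652099471540743),
  (105093326, 3591171090156638703041694525091992494885032199667239667132461050690313689239657825561477495),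
  (28328447196668040, 1417276058308660586478127871183468072273479),
  (1704938080619, 78024517300223222318493699211685677343929276547915009018956861102910851254955501141101771294058200272994817693142443417525626176287544270849331319752231372754112434552807849712492891135425826861621850330559314181959033808137524196068857227056775959),
  (1705025645770, 42812338291195162081908381109289628495398610891154014742631841374160926334272454606741176654663752000777490059307938293671868276657033884049155218168145394758612187143177598227274032598957595402545041682949642041559279078126677983719289380957849325406164709964691658378986913940987620110692746649578990735329271149089753165715981652872916682281658986645256034324332529687607751565844341676633425027007775040921040864483735807137361730448573622402305548860755755808623204058428597956335402419067066233747331112964919950183162744918118491195713618102287049116875474616656672542671472917203489052402781978612719098519528884443219391058277287757525928228495117432374964098167986854453703738761992047748358847347753139066863379971281697411449413644120302633914624262040135661807684551047),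
  (104066506, 1474477430133303325240125479337451112299781458122875745444588691701984459534704028300829087806879355706501915657183723258104157451234779015836841343434712223513827946279152420273091715379918914892428004209275438886566180450905138600494179832017807385386288767980815062797236362187043730875069680245971290169313385707409104196231749435448),
  (27935110387248194, 381907391708890593649828400136659812774359744769677506135107172377062233323860648769882535670734401634404123675990214089107255536852469146552062001672821566265954735432496870970382887781691211424606633121410555994077884488953665771148611198763678953628129385525916444489423340538724291598986194234252568479578357562528504802251587555387565951450320390357146049421893628330407),
  (289968059553156652104544062193923205372159146692097731764510574186507331, 247175233998712512556640378185340750709756121998070396444960238399391355414486247152692778653577516848408102671959212368551569131007047481095436640157924580006745924627585902524266594164041960537930793813938184256098880504459738323672564830272904361002175361995773041176175616706657967837281177565995928970614990889673017288529500290704307094202891004616005515264133272888815068974603256726087),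
  (7498397355150836495472874, 86235802461910842833499804418841509299030657752458500767810514338462200577248758259233421751324264429682239019736421270732076222342393345482325052894723932994116089826012954923769541840728260569275155676834896770246635920582152961634264741736774340294553223839997951581878759787155990331835440937760751689663002506039313799908379819717176618344067102805039333962545172497743865828603397988817260528047818759638332738294465936099603180006014810890020712008583484090098326738272859678640984411659423693071656600225025819339263098832773201413465599123461828151519683598348603194933141221903922220899637090600921985334435568454165795720394592787033827895727586035963909378869127975499931095303979463),
  (29200905613777103, 3701109462589457863675590222484909407464582123926426810704789420240848423237610324519531616071043513464237590024214444704186240747622218538159883581757690448261899397278880491920073078766208268899754830435908432537013002052713677045497645881036174656174826549638936395832),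
  (6350, 5034693090210286349070764035952971881829995809164669586627763340958214821088792973268773096650791878062110719659004878730519744373665811290315057686358663315536145643011889895433061257899179235191869654735427420075627708570948465453380280172356446217792282680644076583),
  (6151, 137213965969978384634085383),
  (6369, 67700731342140986659700743),
  (6279, 59238250604838994753617943),
  (6215, 58633787695025220535453543),
  (6347, 61051639334259907723526199),
  (11722, 717259538519),
  (144, 1964522903619869048045655),
  (148, 1556912759898183),
  (2130, 1552514713387079),
  (4306, 2058970233277880427610183),
  (532, 194788172685407361997733927),
  (21, 160787134008745710300692536),
  (669, 201890611875643102240702919),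
  (2066, 6649110454624632954683591),
  (2651, 256897031816013909042660055),
  (8407, 19615942923257296081891491067944888284975734231301601743601895),
  (4115, 63469195825578832759358663),
  (4705, 183757314877242681979830279),
  (4627, 178921611598783134488854551),
  (10900, 44130788966503),
  (10962, 40282498269271),
  (6374, 3813110620094551),
  (6216, 5515742498736192981305223),
  (536, 1864776015675463),
  (10384, 36296768618583),
  (10389, 45088566673495),
  (6152, 77976600808868839338016823),
  (6345, 60447176424447026858557863),
  (10707, 40759239639159),
  (25, 161996059828360683072782392),
  (281, 234531609005247023489744903),
  (809, 244203015562162751217336343),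
  (797, 240576238103314534366183463),
  (11208, 17811229376551),
  (10584, 52858162511895),
  (10329, 53334903881735),
  (50431100574821443, 3689511006474954326321122582864502938825149603331059079067530690743),
  (108784842, 216819175610663692332718376420957188803347249472316505509560686141633797961635643235941309655202547421640401083348873152724257786988894688722871544917206859929825217077144186615109842136820132290880656367097161085901022260914045754314567666872691399468804597985307146563980602156908654231094065024188876818467760073920709866965558262038728700864352641531965840254944562612501477316884661991721584221101720251920417832057154394320214406153896958870663195579246458690425562414698812220083269578586450242803442189876539962501740727048277658551406461623026462997018101087769346946808371845327306775656855008815554129247844756074744800397327747694931361468995075968384638711903360421416805820887694773350317379243806295303),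
  (11467, 24404004176391),
  (6639, 98784247815),
  (11726, 32723355828231),
  (11654, 490935946768108539322013651719055164195080867413529461591),
  (11143, 15539191676935),
  (11159, 429264973869669505751724524110295129294503756286220305271),
  (8398, 15543486644247),
  (8926, 50727858733079),
  (8663, 217060033610241188797874663),
  (8214, 221839068490909186764308503),
  (0, 582434744780862705086788980126516663)]

theorem ck6 : checkCert 4936 kn6 [24, 32, 20, 8, 25] [26, 35] cert6 = true := by decide +kernel

theorem ex6 : Excl [24, 32, 20, 8, 25] [26, 35] := check_sound ck6 hk6

def kn7 : List (List ℕ × List ℕ) := ([24, 32, 20, 8, 25], [26, 35]) :: kn6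
theorem hk7 : ∀ p ∈ kn7, Excl p.1 p.2 := all_cons ex6 hk6

def cert7 : List (ℕ × ℕ) := [
  (8196, 2533279085363272),
  (11584, 837518622792),
  (10817, 530),
  (4100, 844429225099304),
  (10944, 700079669288),
  (10689, 274),
  (6148, 1407379178520632),
  (11264, 768799146040),
  (10753, 402),
  (10560, 6465364973161622221093979080992470597671),
  (10305, 558345748487),
  (2050, 33451458080164519442182920940930259046367303),
  (2145, 310089767879057592729731144),
  (2129, 155347262968385268820738071),
  (2121, 77976010513048932920066087),
  (16, 1266641690165256),
  (10432, 1662152343560),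
  (6213, 20552624377164951288021000),
  (11201, 386),
  (20, 793376015866547767607319),
  (11073, 418),
  (6152, 1799591297031),
  (6280, 38762069535110646829416455),
  (6217, 21761550196778897562927127),
  (4098, 3818244439376545467790508640940704888212997928458985036182947574442931445983444838139163560427526324634509644762099205514873297178966965233366359410530788882222785919407079950325731854597077602253766306496200990586225101003801560172348127005739319495),
  (36624218873511940, 8817567858903),
  (5, 1663791420307375929006103724343),
  (145, 43521329506127436268437511),
  (149, 44730255325741378248376455),
  (6150, 254426349026694127872687843466805255),
  (2066, 5477963566873029661163719),
  (6278, 1556912759898151),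
  (11204, 9015136354359),
  (6344, 58104882648944438746808375),
  (6215, 21157087286971582975574087),
  (2657, 314925471157516384306462792),
  (2579, 160182966246843785519562839),
  (2130, 1552514713387047),
  (10437, 10453950398551),
  (10754, 6128918331463),
  (10320, 35747012804663),
  (11267, 6124623364119),
  (10577, 35742717837335),
  (135581779, 85328731029467558324545056145416),
  (11521, 3594399657918813222018689470402404594055861996574461423054158299687),
  (32, 287762808839),
  (161, 48357032784585197053018423),
  (8198, 2115638631072041292267527),
  (8326, 58067398864989134839087111),
  (4231, 29710560947995768195685839536135),
  (140, 993962806476807),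
  (10372, 9908489551895),
  (4103, 58066808569175683756983047),
  (4167, 58633492547119903743672775),
  (13, 42312403686513906605359159),
  (417, 125728285239922082709504007),
  (401, 120892581961465696314458135),
  (405, 122101507781077714149048919),
  (10885, 9904194584679),
  (136, 1888965039892374176662215),
  (2122, 989564759965799),
  (10690, 5579162517623),
  (2058, 4231258815395786922131607),
  (9, 41103477866897628163211847),
  (289, 87042659012254567594196999),
  (273, 82206955733798181199151127),
  (268, 18497636867086699843255677986275383),
  (2401, 312507619518287130252017735),
  (2385, 157765114607614527170150487),
  (2315, 80393862152278191269478503),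
  (10947, 5574867550343),
  (4114, 5515742498739079199326295),
  (10312, 18154826760231),
  (4178, 174104797786248537228444423),
  (8275, 2091649073159),
  (6242, 3522839550361607),
  (11458, 6816113098775),
  (187930830, 158144027485961799986331015885329037145870446482146343524297242476600595274678793121230391568180020983486531453075534305772400352599049847345031699494762338059574843621534306030340573694712641726936202613856036087023088948010785305688960763815533328990967),
  (2991368301639, 866927876448679573231340142131056878405973083456008615464591513107924967272083025053934862062321798218823),
  (137604551, 748887410950391620479051180336929575078076565802658370075503732349889749080710820489547934425554314294866484742092114970807469447292555598334169966431729865242727238171305345780662820550550344791036923940247835409396240090558403227853498513287979265662566672826930496457708033049702031749919713338839846294293799584907841691773470552065845796049684410642138755701938758575625090939761457810652328709591888081299713321545321887129744556531044951080819515866699665839766710903299471295583632890897556553595015857853115113566907122100692138003416764427408075357666679031775966029113360395224137618546369095572055012943278899575),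
  (8398, 52970664135781378816451769950374214430383766741887570215420981918173055611356102110841230490478495495930810415448515794213859669147465458076065115153403795112903772735863191162369230707119923349982123364751653696360658290255621455564869021678614099900251213862680840654208205336379044989368291108185484843132264068980661069437256425059104655355662275834523935270906996190538777415359028514961231893597289008138107026754194748281986252908800796869903232386966323866837989951427276346684470547795957245200893069073157899870834382744378578013805085431),
  (8206, 137214261117883426547957767),
  (6351, 19515509296075709844656924783194080974562979684754322169528343),
  (4310, 2124260759830535),
  (11078, 14993730830359),
  (6159, 135457245638348608871859063),
  (6287, 136609503060174093703708679),
  (11470, 648540061767),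
  (4119, 64678121645193324495110711),
  (4247, 213980460367605593848938503),
  (4695, 218211700736252191755468823),
  (11335, 14989435863143),
  (4304, 18822155340358181946790719065686119),
  (4308, 4420153474710504011203127),
  (156, 9104741025717260782665799),
  (6348, 6762447250215978340974679),
  (10706, 40763534606423),
  (4113, 62864732915771380733051591),
  (4177, 155347558116295254241968135),
  (4627, 160183261394750609844862999),
  (4117, 64073658735388964845256807),
  (4245, 194637647253772351687360519),
  (4181, 194033184343958440030242007),
  (29, 47148106964971117634127047),
  (669, 276844012691750111072486727),
  (6156, 117871152856142531132392631),
  (6412, 988639465870445562853658171909927609462156435105191465940998685826296375001208354870476544397570736183),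
  (6221, 22970476016393526737633303),
  (6543, 139027354699398060653412711),
  (10963, 40759239639239),
  (6154, 3173448723235529014902967),
  (24, 831154947735139926409415),
  (10384, 36296768618695),
  (11332, 10114647982263),
  (2136, 3732042595236321636984265843409063),
  (797, 278052938511365496161435703),
  (10900, 44130788966583),
  (8461, 6017002241449050113641219701082771158376218852590375),
  (10444, 28050431410327),
  (6219, 22366013106586212150280327),
  (6479, 138422891789591227102396967),
  (281, 84624807373024690769494935),
  (10897, 36292473651351),
  (2072, 232718515423721875304351479),
  (2329, 84625102520929251647029288),
  (10584, 52858162512023),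
  (2344, 3113821224829063),
  (10824, 19872813678743),
  (11213, 28046136443031),
  (11074, 6197637808279),
  (10762, 23721104375959),
  (11208, 17811229376663),
  (11272, 18360985190519),
  (2409, 7191995771428227933342882819144044961498923111),
  (10329, 53334903881863),
  (2089, 89460805799387910079774855),
  (2665, 392296723612852376609752727),
  (11593, 19868518711447),
  (10441, 19250043420775),
  (10761, 19318762897511),
  (172436887, 19534719020022915302611594416922630346513469719296233278849626316077318840171047682535),
  (11671, 3818573361681456063361723432270261460507334083346709418293583981084149809655),
  (191999314, 71132421082354771878433679973886680446394501946009726549492231),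
  (11718, 22562774828795750044429189780435390588138228124512763585019820513734139180176598845152760781757794187337690080842650484736487),
  (11463, 15607911153671),
  (8406, 15612206120967),
  (8214, 214585513573217425986422311),
  (8342, 212809903775668472429674503),
  (8662, 137422045243127560633582647),
  (8598, 83289302881588041781646184035598254640589272759813481732052279390669949251990777718252866404844972607724488736105096623497276640975608047431515385623033676119),
  (8204, 122707151282505608708751415),
  (8471, 1549923569868151335973798177626082811712635415),
  (8201, 116133617138351131290763815),
  (8463, 81603673415613095851589639),
  (8393, 79185821776386242683863063),
  (8329, 78581358866582226631393319),
  (4128, 2814754062073911),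
  (11136, 2349347110983),
  (424, 4609048134025152380797319),
  (4833, 222442941104906967279730727),
  (10505, 144198041514557498505433306675224195691081368071),
  (41, 1650255146368702516334079661392129624687771687),
  (296, 390558597599257696168575031),
  (681, 392900891374764338729451543),
  (6376, 129623421748826722545778735403569275906032055),
  (8458, 19804094201927),
  (6184, 388670536449818916510763143),
  (6440, 386932705584132782676770823),
  (8203, 80394747595993725032988919),
  (4130, 12693739552697710108737655),
  (4194, 328847302696921002871359767),
  (8264, 112288177873145434078985654738831496354338237887503948859405495114400007),
  (11602, 543574369605812227746607773455884536204061562356869075237431518225553824936914175865652743),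
  (10512, 284782255598746202627039463401610790084205163516332482296959862228762748880981069233220520772551),
  (11155, 1499420947247516814057987789571165949050071989066183569609942003257733808151),
  (0, 19560561946229071819378866970067537919493750989888295653656925663923454966067883934423)]

theorem ck7 : checkCert 9348 kn7 [33, 17, 25, 3, 26, 16] [] cert7 = true := by decide +kernel

theorem ex7 : Excl [33, 17, 25, 3, 26, 16] [] := check_sound ck7 hk7

def kn8 : List (List ℕ × List ℕ) := ([33, 17, 25, 3, 26, 16], []) :: kn7
theorem hk8 : ∀ p ∈ kn8, Excl p.1 p.2 := all_cons ex7 hk7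

def cert8 : List (ℕ × ℕ) := [
  (4100, 844429225099304),
  (10944, 700079669288),
  (10689, 274),
  (8, 703691736743944),
  (10368, 1112396529672),
  (4165, 20552329229259089035395143),
  (2050, 422216760033304),
  (10560, 81604378648),
  (137, 41103477866897495019225159),
  (2121, 77976010513048928625098792),
  (10305, 130),
  (2058, 3060111927643977470181415),
  (4102, 1888965039892168018231335),
  (12, 717818152140770883141687),
  (2315, 80393862152278186974511144),
  (2122, 18254247892605809784956656468099080),
  (4167, 21156792139066605486211080),
  (268, 1002758899499047),
  (141, 42312403686512124193931335),
  (10312, 18154826760263),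
  (10690, 5579162517559),
  (10884, 8946416877607),
  (10569, 18150531792935),
  (10947, 5574867550247),
  (6146, 1266641690165304),
  (11200, 219043332152),
  (273, 157160356549903334605062200),
  (6241, 310090358174868088874336328),
  (11649, 546),
  (4128, 1387274436615),
  (4193, 29014809966561488963371016),
  (4112, 307),
  (11521, 1406249421733102039),
  (4177, 24179106688102976559513623),
  (32, 287762808855),
  (6154, 3173448723232574077403271),
  (545, 164413911467589666544287800),
  (6497, 312508209814097488957669399),
  (6218, 96733840478817518119551191),
  (8210, 5742416089914348268421159),
  (138631437, 1400942504652087769234799886716698250706984),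
  (8267, 361039591306205608080204592489288433664599),
  (11138, 6747393622023),
  (11651, 6743098654727),
  (3110549367875, 10871890668632446189619380599),
  (2223372299458, 5821361851064480057330187278684139354978345077090787005060541763652809919062145632863050820613086691736264185030908147107431138038109463873560175007368199798999),
  (3110549383425, 252591816757920362489922712029097711214273527348021543305903865911),
  (135704002, 1147347239170997603923227754725854397289915621640552248523874936425506748352194519162508115236504304819553055896184204764889596871569381548025465377508524534224360342275948786686047278794777618194419064990153606241976567),
  (134647891, 944894453468850349562945595775028570334311296410431812647169276806572047018045401931028790665428336903),
  (135702784, 8983624123486773915486807755102083516556109101374930183829795999192940416185133653776765532676772891525959949186344654817139829506199),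
  (8282, 3389818352469893098720466148599260178119218318795185399558900711237636990377801667431497291054186663),
  (8539, 104592153454218268144304135),
  (11466, 24408299143175),
  (185658819, 1431173894730774650986118629586726331297447463368662194428561856475577712807),
  (11331, 11799024666505585535719964874486096661932185422403673433213394650022642804413836949688051302567),
  (4178, 5716601470983),
  (4115, 24783569597910291146866695),
  (4627, 178921611598777224613855239),
  (8218, 648540061735),
  (6216, 5515742498738048407175207),
  (536, 1864776015675431),
  (10384, 36296768618551),
  (8194, 27202011532950659821207607),
  (8794, 251627756264848503590617159),
  (8203, 96734135626724071861911575),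
  (6152, 77976600808861898670866519),
  (25, 161996059828360683072782392),
  (281, 234531609005242419284803591),
  (409, 235740534824852787851952999),
  (11208, 17811229376535),
  (10441, 19250043420679),
  (177368329, 46876386110889798967233231711285281591),
  (3146789301058, 3853912490697204440089720869071459720006576783802387945863708024554910638460181734159099274528128404947703068361159),
  (192064322, 158816610363155583361285178842261474616715915782123355430905530823751333559608957959357445433838558082128795957864332403064058006593309964782155132437164452868350787732109985601293945354025033958535409146363650965207754186229284935),
  (11723, 24404004176215),
  (11074, 98784247815),
  (10827, 59589335457886669925247898369509916994005107223),
  (8526, 24270860189703),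
  (8207, 100946486529442283564040407),
  (11586, 1596074715227995523715156945444577079866811639398967),
  (10819, 6674379177991),
  (8262, 6678674145287),
  (8410, 58879645900039484000436727),
  (8402, 66057642954001344725254455),
  (8198, 63469786121388779148149447),
  (8399, 137214261117881158805225575),
  (11142, 15543486644231),
  (177367305, 148568993039512337092133819026784908548272817207),
  (11275, 204417830047235391865649440788563479847675511516380357355884123849727795488887491360091840117574269478900603396554753095),
  (2394, 22759031701511),
  (2074, 254479180176790010812432391),
  (2331, 85229565430736566234382376),
  (6476, 7971373069828064895041911),
  (6156, 119080078675760458841980935),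
  (6412, 116133321990447807363809287),
  (8461, 3740916514823),
  (10824, 19872813678599),
  (8525, 2198038976702022804506631946541778824180269063),
  (11593, 19868518711319),
  (11529, 1885490642983),
  (10505, 854698491959),
  (8591, 101059823325031361207599479),
  (11720, 329906068710116124758627904914583),
  (8458, 19804094201895),
  (10508, 28600187224103),
  (11465, 20005957664807),
  (8201, 99133097800020477240935063),
  (8475, 85230450874452104292860679),
  (11471, 639109015839474400914820951469437412013699832968900511079),
  (8472, 20010252632119),
  (8670, 33204392165399),
  (8987, 258786863852877373906092087),
  (8542, 294469064997442680883511319),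
  (8223, 105782189807904098797748231),
  (9055, 298001395126626839041147767),
  (10520, 54988466290743),
  (10842, 59455232278551),
  (0, 1165512201163657168450412773576217039467967953722342309232916824071)]

theorem ck8 : checkCert 17035 kn8 [17, 2, 8, 24, 35, 20] [26] cert8 = true := by decide +kernel

theorem ex8 : Excl [17, 2, 8, 24, 35, 20] [26] := check_sound ck8 hk8

def kn9 : List (List ℕ × List ℕ) := ([17, 2, 8, 24, 35, 20], [26]) :: kn8
theorem hk9 : ∀ p ∈ kn9, Excl p.1 p.2 := all_cons ex8 hk8

def cert9 : List (ℕ × ℕ) := [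
  (11456, 2418066587704),
  (8194, 2392541597007944),
  (11520, 287762808904),
  (10497, 514),
  (2080, 2533279085363224),
  (10816, 2280627634200),
  (8261, 39291269729096268668469319),
  (11585, 530),
  (4, 422216760033288),
  (10304, 562640715784),
  (2145, 29014514818656653207928840),
  (161, 310693935640959865403211848),
  (10561, 130),
  (36, 944491743318170256015463),
  (2082, 10313666845331889957371943),
  (1061, 320365342197876830081384520),
  (2147, 29618977728463692917374984),
  (10592, 70450348556311),
  (11586, 5235565133847),
  (10337, 70927089926167),
  (10819, 6674379178007),
  (11201, 386),
  (16, 219043332103),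
  (11137, 227995237941772311),
  (184053121, 95993294289899424662261825561765047751794646394225990784253847906001361040841083742009054724199),
  (184052576, 5137634379945504258934432760431664689657724282278866882940970287090799101320865820859436115151638839324632063934583),
  (749520441723035069281, 145763264225839224714292020591581109734286033031),
  (11233, 39614143681596851217293762251415646686818722635770747826067891183522898148378074415479),
  (1072, 70587787509767),
  (49, 323992119656720648886026312),
  (561, 469063218010476149850767479),
  (8722, 3553625875939335),
  (8211, 160183851690559323578040327),
  (8275, 174690961525936793524895751),
  (11458, 6816113098759),
  (10947, 6196368583729082965212266759),
  (10691, 257604427669112316827353135304072289419738980120805769495),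
  (10754, 82714201665021095657305427411335),
  (11139, 148567942226038297968154338482159221470880858119),
  (11074, 19553548718368347914247),
  (0, 836887905804601333461755600202124921321703818451734233127)]

theorem ck9 : checkCert 6698 kn9 [28, 32, 12, 1, 3] [16] cert9 = true := by decide +kernel

theorem ex9 : Excl [28, 32, 12, 1, 3] [16] := check_sound ck9 hk9

def kn10 : List (List ℕ × List ℕ) := ([28, 32, 12, 1, 3], [16]) :: kn9
theorem hk10 : ∀ p ∈ kn10, Excl p.1 p.2 := all_cons ex9 hk9

def cert10 : List (ℕ × ℕ) := [
  (2056, 844429225099288),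
  (10688, 1181116006424),
  (10945, 274),
  (16, 1266641690165256),
  (10432, 1662152343560),
  (4098, 703691736743976),
  (10880, 150323855400),
  (273, 82206955733794955678711863),
  (4165, 39290679433285974387327000),
  (10369, 258),
  (8194, 2392541597007944),
  (11520, 287762808904),
  (545, 314320713099803894661251207),
  (10497, 514),
  (11137, 546),
  (8200, 2349347110919),
  (8264, 19419551569180728594792535),
  (2080, 195),
  (8196, 531),
  (8328, 38762364683015001548521479),
  (8260, 19381772637317840152559767),
  (4112, 307),
  (4241, 43521919801937039059845144),
  (4176, 19494519137096352932036887),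
  (8208, 563),
  (11264, 60910543683047077574214635548271538339847),
  (8336, 38837922546741190749847575),
  (8272, 19495109432907742429839399),
  (10305, 254594554521452583),
  (6148, 111504066275024235738757505910288216615813191),
  (2050, 562640715799),
  (11073, 45258667451643203768603445827546906663),
  (6213, 20552624377164268388220967),
  (2120, 19418666125467389559570471),
  (6152, 1799591297063),
  (10561, 10292192732300757183833833527),
  (6280, 38762069535109684756742247),
  (6217, 21761550196779030706913288),
  (4, 81604378663),
  (4114, 5515742498737979687698455),
  (144, 38836741955120061021684295),
  (137, 78580178274951068154593319),
  (4243, 44126382711744426661642279),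
  (4178, 174104797786248674667397719),
  (2058, 3060111927646039054483495),
  (2314, 96789918580804481374486535),
  (2122, 96733250183007090694422775),
  (138598667, 1395497986744590886413357536163374177452119),
  (2236975628429, 165190718856242222637194810490904),
  (2065, 4199092621354130543938763751815),
  (2321, 157160651697810369383759879),
  (2593, 164414206615494845897114135),
  (2129, 155347262968386501476352039),
  (2385, 157765114607614866472566839),
  (6156, 3777911633041950249058359),
  (20, 793376015867715998711847),
  (6284, 116095543058582994776228263),
  (6221, 22970476016393659881619464),
  (532, 193579246865792664103551847),
  (277, 83415881553409584853418039),
  (9370932972972165, 7877521868631269023896006112561378470172796380946084750995125059311169225460371466822836311338751653130441659491386005241398217517426461976415330234674991125758231),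
  (45905402261499333, 1932104797861366242944911202929211358208202850895312630419851660826247168519),
  (142928965, 15522319018864503197357423416974353898807559297989278210787132913334700613663935612215000214239407987810620050477071423138996208620934186876275314357793741307676503371494756666978956552887399523361533853078794922781151766337234097622464653741990873106241447084835706658090259913735105881503433458030455509440690952307287679608144480167568591566126640845710734466894091006466187126746293329705737784391177624333109949780124140633434330600598648801257929725821229626340317998445406772095878451722061581993281613296596026738914031016907351782761155399655900924614886379362259736996472000999472742014850632940822950045615533215474173790162564336847229354248691058072300439155367958513511087602411766439),
  (142928841, 29272659166704646638364503177303198918262734667328606225564288251356559722936080085559753498839129403949208092222615082390731320137076148337342459372057778153460989089308472519221893238688792998359964349888216141427289491564220192252678630788040766401113217484031759826301556814977129610794716294101068597891638686566480441013529419625182580335160458889837803074047597817874380350034019201941008619143863),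
  (560, 12493115148139184808550372755221922205438446537355224304227705002314233521640936002923561921966341798915557828638586343998316090903383319164061572189610579323477070410466998790909632949408838605447049879457405838730121808089257773815291522695240318978994992405933632715158635786073659678961458676077344015633881782649707635329149267555993640455280561543753816392397366079960706824405315831004232341262682051398134357431709051226104995053034698619722582457505918318773347034728978129250065148880941089532937428475736076538322762503880328426722401604383580931279164750832765793226631680870960400615578483468339257214256893656313153284747127200559694262574818417515247923727438222683073301897801107306971578385325400972840709626660464232182839680548677527655359493492285612774509264352251696615092949313440500535874091062519364948975581538619954528504711047309286378300780124803757360522693626970155358846201243086910128551),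
  (48, 469063218010476149850768343),
  (1073, 323992119656720648886026312),
  (7202, 3588810248028167),
  (11232, 70587787509783),
  (10465, 72026601553927),
  (188834323, 176571280304085221355294974418734694330224341485668335198385679456935082070240341639132555594882029725596011615379673413291984198620153477411895562896898266099532835131993452963205420067878731923415957648873725637869296904879091701561644259792585556985475344183368378984120480007241443177474633797655619214460723908945576268938827582276968373115933140955991566512131232191893221035369354102209522750159743968541254391103280473251650406478940874730219707930402387713438679559158122000364711359616651547203979449411199870334605491796726315280842961638149345394356933504844675444901554386634873712573623814317045042386878945144693197788915711143681833770260430573223600549741303052021346605750298963240743083617127198040199425992601655203829183290216918531740757644613617516450537736029906127342797607),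
  (11525, 18118582951512223451265824206098418866089913275547766363631272443869110809533776324491568297854034837059365460607704441773288209723160014614262297421437444004256264569008635092067185159484505843649102216815826955738927611745649245993683718055944246321378611772957432158415120728070713442184230198522909595988415069010604017253531264463619798262504457339449768738399704080509815332691756893123598368843273816656072009508384439694179785066610185142610955845154859811485035119334439872850093732586839506077876967),
  (164, 9083855831047),
  (36, 349379561868630198017064967),
  (1061, 320365342197877040534781959),
  (10592, 70450348556295),
  (10337, 70927089926151),
  (10913, 5662979151596649036243439343907286334571511),
  (10400, 1298391127286254274933047831823367),
  (8723, 2476288184188584220318784992358573699362006765450566121725658513855912087652018099777781799494266824210769772104032445277215962734290587457418590052535070178064275589517880958012344819685306610924126536173163070802094637254557947756352644135361195871939396657939811720149293654463047841192158817538970243633127605348350251724988679333100899648183874528308276630893496650142744091594698108903049033132017598076144868596682030943774869386076018120128227744697630925550117364130981804503049875727822504444149743684518569454269236272197067759015135768028516423885813511657198690237606717074737153341856168661096404300549662553185874024514832027265608432267586550786188292680319587850499104295720396590075905285468817622135718006208339198385880226388796559308024335774939966315315161708817040290050136097325954433621681020518462122297957966912753796215010904846084383391580893173746041298175244929751744745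256370395412165649278444039741672620471202624581388094027665818772634322700600279),
  (10512, 37396280246279),
  (8211, 174237614343579246000079751),
  (11537, 37391985278999),
  (6240, 5742416089913661073654887),
  (6177, 29015105114466672611164167),
  (11712, 1937030250503),
  (11361, 23845090178776774350204447946752542006417817719),
  (8724, 49533314534896689075749628865837502578783120813167023249518265411587131628716838359849879928802289824696611250160241388872327453851502041482020017695116452050322031903831),
  (10977, 3515312896177519324547839849062242776193648918864300362410215080087),
  (4629, 221422041980867321317598057440611447605425141765677305400245711750038135),
  (11104, 1300926428487891325361843890814999),
  (10704, 36365488095255),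
  (10720, 626048522759708725399156774906370098904394534370471313431),
  (10784, 38049139923727983168752750850701407094949238517117485095),
  (11297, 72095321030663),
  (3120, 71137543323655),
  (2096, 473899216436839845902419175),
  (2609, 169249909893956523691868167),
  (11600, 36021890711559),
  (10609, 494648909215766992262883427222136429994662846681571131527),
  (10928, 61862730682266652622479969015339495921063329637565726871),
  (11665, 301554471066664952553588744794628355571576353843723632759),
  (11152, 15438490683346691919209409340450565633309972484248911421190547001880717819911),
  (10896, 107765784563791536017798914186855346685005465291897962679),
  (10320, 2003453659953106154694683577272443587418526063012822231455427985495),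
  (0, 491608003681018335269455011063556529882280291153748164615)]

theorem ck10 : checkCert 4188 kn10 [10, 3, 16, 32, 34] [33, 12, 26, 28] cert10 = true := by decide +kernel

theorem ex10 : Excl [10, 3, 16, 32, 34] [33, 12, 26, 28] := check_sound ck10 hk10

def kn11 : List (List ℕ × List ℕ) := ([10, 3, 16, 32, 34], [33, 12, 26, 28]) :: kn10
theorem hk11 : ∀ p ∈ kn11, Excl p.1 p.2 := all_cons ex10 hk10

def cert11 : List (ℕ × ℕ) := [
  (2050, 422216760033304),
  (10560, 81604378648),
  (32, 2392541597007880),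
  (10496, 2211908157448),
  (161, 48357032784585265772494872),
  (8196, 2533279085363272),
  (11584, 837518622792),
  (2145, 310089767879057871902605415),
  (8261, 20552919525069447741046823),
  (10817, 530),
  (8198, 2115638631070048427442215),
  (36, 944491743318170256015415),
  (8326, 49489158710638548702968712909553688),
  (8263, 21157382434876762328399911),
  (165, 49565958604199963666677784),
  (10818, 6678674145303),
  (11524, 9083855831063),
  (10501, 11003706212359),
  (4100, 844429225099304),
  (10944, 700079669288),
  (2121, 77976010513050096856203304),
  (11457, 562),
  (8208, 2418066587655),
  (8400, 58180735660575601142530055),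
  (11137, 546),
  (11201, 1264385758593024247),
  (10881, 172825730189623367),
  (8200, 2349347110951),
  (16, 219043332135),
  (8, 150323855399),
  (11265, 1093476170853043449897156663),
  (8464, 77523548774409393059921975),
  (8328, 38762364683015070267998631),
  (145, 43521329506126955232100376),
  (137, 41103477866897495019225159),
  (2064, 768799146055),
  (11328, 104466686648927200898707176918812171698391),
  (4102, 1888965039892099298754823),
  (2321, 82207250881700130736570408),
  (10433, 8066558232354888136693645511),
  (4230, 58066808569176989427040295),
  (6152, 133804811473554858880294699922461100496388391),
  (6146, 1662152343591),
  (6279, 698599699327270780635474224484453793661607),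
  (148, 1556912759898119),
  (10436, 10458245365783),
  (21, 44730255325741382543343639),
  (277, 195845982777571124598276103),
  (677, 204308463514874834491277335),
  (11205, 10453950398519),
  (2066, 73729354275867037326155136503710283553315863319020893213096241521156414502054157001351657989778352283420266484681387991831859688926330324270733836611504945411518624073709304166839902447096488343530981063559334240831794671348246017918732444395406436454617406263967333946922893831),
  (2323, 82811713791507307884970024),
  (2130, 3996876304092422873483113370912921046425870950784616843410551509957712781171538390747182051579040726428804441380619341087590987108220550074863867021738119843334082885193200364769158015350162690569415345266944862545596337140951502192637354431118497714851021351),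
  (4113, 4199092620468686826476559925735),
  (4241, 155952021026099957489205255),
  (4305, 156556483935904935614349591),
  (6156, 3777911633039888664756503),
  (6412, 116133321990446914010611719),
  (137746573, 1138017833660801559781692938449666188369834085847578408116297813489465113488549268545696595821827172947298731365505422943966111408352683485341688004615),
  (136665228, 23617967010316683971829895375284654845823163270603924228389651530226829398306555665420313480754782661318675118016595802355474657968791),
  (6285, 1538014147920639083139965720615408258060690911287329140645915335279330263792846975270030673362303850704980234273740789972131997934928231294739229272554783698791699729314450763296664943647630885398002086439628719730644788590294322386101942717687437564084286111638959463589168317991294280911098444605435856113179705132719583867953213731633104036894142108747801128753500231272778042445752617309558834412122369646293401774585110014505428810785338505675574343920339869474101069062052077780875398486401185287202765720990515879),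
  (11076, 10595684319239),
  (6149, 116095543058583269654134807),
  (8341, 236223201319),
  (11333, 10591389351975),
  (10752, 1730871820327),
  (11460, 11214159609895),
  (11140, 194853509112803818814761175972882781704516797207),
  (10372, 203968744004665861804346546450629129374213324146670043143),
  (0, 25089042732846477931444190266292270908030582855)]

theorem ck11 : checkCert 8333 kn11 [8, 4, 33, 17, 35, 34] [] cert11 = true := by decide +kernel

theorem ex11 : Excl [8, 4, 33, 17, 35, 34] [] := check_sound ck11 hk11

def kn12 : List (List ℕ × List ℕ) := ([8, 4, 33, 17, 35, 34], []) :: kn11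
theorem hk12 : ∀ p ∈ kn12, Excl p.1 p.2 := all_cons ex11 hk11

def cert12 : List (ℕ × ℕ) := [
  (4, 422216760033288),
  (10304, 562640715784),
  (10561, 130),
  (2056, 844429225099288),
  (10688, 1181116006424),
  (2121, 21760959900968538857275415),
  (10945, 274),
  (8196, 2533279085363272),
  (11584, 837518622792),
  (2337, 311903156608479815664664663),
  (4098, 703691736743976),
  (10880, 150323855400),
  (137, 78580178274951682334916648),
  (4165, 39290679433285974387327000),
  (10369, 258),
  (4102, 1888965039892580335091751),
  (2058, 3060111927643840031227943),
  (12, 717818152141045761048631),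
  (4231, 40499605252900603562033176),
  (2314, 18497636867690867605157740206358568),
  (2123, 22365422810775853444628535),
  (269, 80998029914180390928515112),
  (140, 993962806476855),
  (10946, 5098126180391),
  (10568, 17673790423079),
  (10313, 18150531792903),
  (11201, 386),
  (10497, 2207940608038),
  (16, 219043332119),
  (8194, 2211908157463),
  (273, 82206955733794882664267816),
  (11073, 418),
  (11456, 10880335733839084292436656599),
  (11265, 31851009441897445623938135621639),
  (11520, 327417894),
  (6152, 1799591297079),
  (11649, 185827745733331645533152434337850247348279),
  (10752, 1288111161775662354116116551),
  (2064, 768799146055),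
  (4128, 1387274436647),
  (11136, 33573394497956371707546037067741921399),
  (2593, 314321008247709074014076967),
  (4257, 48357623080395693197623320),
  (8204, 3929027360491648592118295),
  (8332, 116095838206490579310739463),
  (8268, 19457330501043754475978999),
  (138598667, 1395497986776282151407570949644996715741751),
  (6285, 3047230913848203596795577687832041783531600833675959),
  (171076873, 494619118014428739787976374278087874167688305049029574775),
  (171076936, 2381976898353926142130850812395771658439),
  (171073552, 28926997299755514442087421236192787262810559085249623972915951471549977012542046015364706154938588878921864224052647987433283517191977496236044820526973661714177951135625938725003009352286410020691476037262752115062181207427203708273509210589853981266876098640168911509539601138689365105910820853124824021028158465628507586510716999),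
  (10441, 8411263665143112524814652475108189284957564079923171760854541005511280270039085936441682568769498869339542885255025948936498144432758328738902281845718672351109026267943013082499496696734312194200746207355852794738834173643128119793299317575039056181611987143),
  (10504, 324835466319533383835498988961799),
  (11529, 19799799234567),
  (10760, 301534500345895454835977655795830694572665097594129050953273745565037083948519814817396335695336665252119),
  (11273, 19318762897415),
  (11593, 196259114846973639968458795480376624358256279559),
  (11721, 1060348852565077307065737459162748657222907791682435082829902643223),
  (0, 1416935775859342358999515990823037902520663)]

theorem ck12 : checkCert 8282 kn12 [1, 10, 33, 16, 3, 26] [] cert12 = true := by decide +kernel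

theorem ex12 : Excl [1, 10, 33, 16, 3, 26] [] := check_sound ck12 hk12

def kn13 : List (List ℕ × List ℕ) := ([1, 10, 33, 16, 3, 26], []) :: kn12
theorem hk13 : ∀ p ∈ kn13, Excl p.1 p.2 := all_cons ex12 hk12

def cert13 : List (ℕ × ℕ) := [
  (4, 422216760033288),
  (10304, 562640715784),
  (10561, 130),
  (2080, 2533279085363224),
  (10816, 2280627634200),
  (2145, 29014514818656313905512471),
  (6148, 1407379178520632),
  (11264, 768799146040),
  (2593, 164414206615494987631034439),
  (8194, 2392541597007944),
  (11520, 287762808904),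
  (161, 310693935640960415159025736),
  (8261, 39291269729096333092978712),
  (10497, 514),
  (8198, 2115638631069842269012103),
  (36, 944491743318651292352551),
  (8327, 40500195548710893548208152),
  (1061, 320365342197877040534781975),
  (164, 2682812666740759),
  (10500, 11008001179687),
  (10592, 70450348556327),
  (10337, 70927089926151),
  (11072, 1799591297064),
  (6281, 78581063718666606213071111),
  (11137, 444858374),
  (103370917, 720377770779787227894604172777329705091096),
  (11457, 1837750217752313926),
  (8208, 2418066587655),
  (11649, 1405264121875660823),
  (10945, 10842254570521223335994458183),
  (8337, 43522510097747535204450328),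
  (4128, 1387274436647),
  (2056, 700079669287),
  (6180, 11031466550729244260958247),
  (2321, 157160651697807070848876600),
  (6308, 348209300424593651745685527),
  (4116, 6120205408543232690749639),
  (4261, 785979015191),
  (11652, 10183367458823),
  (11141, 11141145165831),
  (191982625, 13243301918302434402038954607659494471163866010738891612114290061889139018362923516790803090722366111705985046285731144909755908950002573056000885695852550499235421154589080421400903),
  (11717, 275814195323686534840534779687548731474845838547416803375643092096261379684058813682049213633448034077503109180948504),
  (11076, 1443569861561207529030058062360583193159620328794162643895511669904357982567),
  (11333, 10591389351943),
  (4244, 10114647982087),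
  (4100, 44730845621551668234551431),
  (4133, 348209005276686548247511175),
  (5157, 357842632901741655275601927),
  (10720, 71549860184071),
  (10977, 71545565216775),
  (11297, 150637420494110072795172475783391742907196216962837283148024244812860809016765540262004635422920342724379935303),
  (3120, 71137543323655),
  (2096, 473899216436843144437301255),
  (2609, 169249909893953504329859079),
  (8724, 3694363364294663),
  (8212, 198265015008421787553759239),
  (8341, 44731435917362099954647047),
  (11460, 11214159609863),
  (10689, 695314874670322333711144728566466735275494461450185482740981527362458878199),
  (10885, 108605387946522387961408612465590687597343015543),
  (11205, 143104586323470586302475226397281560016889839895),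
  (0, 336108404203354537274235845785543314458498325076866477057112014871)]

theorem ck13 : checkCert 5418 kn13 [1, 12, 25, 32, 19, 2] [] cert13 = true := by decide +kernel

theorem ex13 : Excl [1, 12, 25, 32, 19, 2] [] := check_sound ck13 hk13

def kn14 : List (List ℕ × List ℕ) := ([1, 12, 25, 32, 19, 2], []) :: kn13
theorem hk14 : ∀ p ∈ kn14, Excl p.1 p.2 := all_cons ex13 hk13

def cert14 : List (ℕ × ℕ) := [
  (2080, 2533279085363224),
  (10816, 2280627634200),
  (4098, 703691736743976),
  (10880, 150323855400),
  (16, 1266641690165256),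
  (10432, 1662152343560),
  (273, 82206955733794955678711831),
  (8200, 2814754062073928),
  (11648, 1387274436680),
  (4193, 310090063026963051255431271),
  (2050, 131),
  (8208, 563),
  (8337, 43522510097747470779940871),
  (6152, 419),
  (6217, 21761550196778897562927111),
  (4114, 5515742498735849383919751),
  (4178, 174104797786248468508967127),
  (32, 67),
  (289, 87042659012253472377536519),
  (8202, 3324564450684334004764823),
  (8528, 96866361888242910099406983),
  (8458, 96790804024517889129185303),
  (8331, 41709121368325591442391064),
  (1720977637512, 324914694471422323584990858707271),
  (135579731, 85328731030057854134354005983240),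
  (11264, 282745740051106987647026171024987145476205139021573128407),
  (10753, 1726576852999),
  (10561, 1909667005263249431),
  (10497, 1256504321806172199),
  (10945, 2523423191980834871),
  (11713, 598415826256658503),
  (11329, 299911613455007831),
  (6148, 478906318022245634105372782453759903296921134780383559),
  (4, 81604378711),
  (8194, 2211908157527),
  (2056, 700079669335),
  (6176, 1937030250583),
  (4112, 1318554959959),
  (6280, 38762069535109959634649479),
  (6213, 20552624377164676410114056),
  (160, 38987857682573332777533543),
  (137, 78580178274951068154593399),
  (8272, 19495109432907123954549223),
  (8261, 39291269729096268668469383),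
  (2336, 77673779058148088829968519),
  (6241, 29015105114467218072010760),
  (4176, 19494519137096833968374455),
  (2065, 4199092616041468250504254456375),
  (2593, 164414206615498006993043463),
  (2129, 155347262968385127086817895),
  (2321, 157160651697807139568353511),
  (6180, 11031466550730206333632551),
  (20, 793376015866341609177287),
  (6436, 348247079356457364821639191),
  (6308, 348209300424593170709348391),
  (532, 193579246865792664103551783),
  (277, 83415881553409649277927464),
  (3024654232131, 6204834606839667716179199062),
  (192015811, 324351320372336107192693454640026066267552042605878152863283581065185152136545193231204579760159893088638559979241692197698645781945494505404658381141484376704952858244833162778563108594046789292630275041502716088030131303725646093539965374494948435152870279958434996853460005612986878136454957871570759468308965556682923966951),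
  (3145972361730, 51672146485029923148254866124549486123211929900715195193895417142575242900314045400968878089764211442513283785272971966450833973697526624635411750590029591797507436846720118087386503698997666424100188459631088628857160650380123893170757340570248926631856374811629453815),
  (2904394099714, 2241426155377190721062060784706451255293742988937623128045218381898057637571590527981097761187152715030146115469033983267625370048686118306853252782882214884888174115772989953886927879722645400197720444639087626437140482212384126692814994512766285197333535240650012831845654612953333739695169255000992907655),
  (811920497636503808645, 6204872385771539469433932886),
  (192014915, 101272432447889452589135718314309162500736593316590706717647949316273593130749167978445194871405588376390960364560678703432386060623898755465767),
  (11719, 575264108896007140490858167035808246692529641335382931454195325763027222734069783373339385023152626712196061105805260673015546911110622346337437934278323707174245529610694323466753304980475433253088085433544765771825686943486336341162798536956712226925429619132332641125306198098590323465955437388374525754301883679610044310412636096241603017525436598419851785391213507286193466873915887166516692154980185829122049740869335095476366857994679),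
  (6374, 15131169783815),
  (136423621, 446249366648249357044712627205471165653556269931545264650530131381787807680421038730515064196785800945328675804786022248609912431269888080818219173327659448811419314562314758559719302839140951),
  (34925201, 718003426365107854771108331143063368931979494918686431529606878389325824872520600125292070223025542778263160164964417505823274997008020147529662943521136577610375),
  (2705674, 132483077993545980865315037393231698259072827260913365469149375541837367238061236950118382284460176520893130385331100271069870914308881252855),
  (8326, 121748195232176185125270426472400223707039204998001132704045298235383703967882775576453091985488311175218261095440880190286807855836781641105146279),
  (8199, 40500195548710824828731416),
  (8401, 62865323211585450290446343),
  (8263, 58634082842932736350486551),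
  (2146, 2678414620229639),
  (10818, 6678674145303),
  (2082, 329432580992891728244507639),
  (2595, 165018669525302091764990391),
  (105025637, 722901890220867128980600745659371112322193856955133119948815118611771403362211974420385749296570980776630892727514917805757257553461835335025868141058308719371901165295769441412226036645744880959646037018577348476007972562195797721444936997571374093282757215607204515661965455774295281514297023609409935725959887126899980416853411574346910618815515922800982075620534291221489502745911198767583588320132445068204708444734146793389263310243806481098557722020410932635568688823534215),
  (2809362148065, 172896924155068422),
  (6410, 3746365568089216661369287195069811721192481140994939165358873586023695417278012650620400286076634259342838596978767108118512205633582606977223515983301701299623586307244232340946210467245143781801515500664910847696492945464566318633977111248125186660408020751887731178443160624838586663850362998909688785721486772104330546259857227432143292535935444154027157092812441970344139754820757786494153477050450399037267189804184472597454597405227339123450532233923614086904330346310750532107630770992277012091677827485004978250994813072435150616497694013101548725004703572000051256041623867785349085914568591380302261396701514561920637349101407016144006301052336922536325452495648195159),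
  (2315, 16362261993410437055063),
  (268, 1002758899499015),
  (2059, 96789918580804550093963287),
  (2123, 97318823626882857981445239),
  (165, 1060856922167),
  (13, 80998029914180326504005687),
  (141, 117265804502619060011270967),
  (10946, 5098126180407),
  (11524, 9083855831095),
  (1061, 357879821537793497817416439),
  (37, 348472867503916889673827447),
  (549, 353006339327477590234497031),
  (10884, 8946416877655),
  (10501, 11003706212423),
  (6182, 49975936491565376830541727570853927),
  (10373, 9904194584615),
  (10436, 37852718839419503640583),
  (6150, 69514120071556883107807735),
  (11205, 10453950398487),
  (11335, 212798488860363152608338775570038299282286733188872482818413902184154623558720567304692015562760),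
  (11463, 8678841372576173333058768045176880339009942289028270197601451411058391515143),
  (6215, 21157087286971784839036936),
  (11266, 247508779694986065756162843738151),
  (10754, 6128918331415),
  (0, 26305057049208604852231)]

theorem ck14 : checkCert 12396 kn14 [12, 16, 3, 34] [1, 28, 19, 32] cert14 = true := by decide +kernel

theorem ex14 : Excl [12, 16, 3, 34] [1, 28, 19, 32] := check_sound ck14 hk14

def kn15 : List (List ℕ × List ℕ) := ([12, 16, 3, 34], [1, 28, 19, 32]) :: kn14
theorem hk15 : ∀ p ∈ kn15, Excl p.1 p.2 := all_cons ex14 hk14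

def cert15 : List (ℕ × ℕ) := [
  (8200, 2814754062073928),
  (11648, 1387274436680),
  (4, 422216760033288),
  (10304, 562640715784),
  (10561, 130),
  (6152, 1688854155231288),
  (11328, 1318554959928),
  (2056, 844429225099288),
  (10688, 1181116006424),
  (2121, 21760959900968538857275415),
  (10880, 11909882845164288235555610580954931789863),
  (10369, 1108101562375),
  (4098, 55752203278696410234317686851359674722156615),
  (4193, 310090063026962772082557000),
  (4165, 39290679433285905667850264),
  (12, 717818152140289846804567),
  (10433, 386),
  (10753, 2524408491838275687),
  (6146, 1662152343575),
  (6148, 1730871820311),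
  (6216, 19419256421276511314640919),
  (6280, 38762069535110646829416471),
  (6212, 19381477489412729519210551),
  (9, 2931442017584126278365681287527),
  (137, 78580178274950926420672855),
  (269, 80998029914180803245375511),
  (4102, 1888965039892030579278087),
  (2058, 3060111927644458506518567),
  (2314, 1002758899499047),
  (10568, 17673790423095),
  (4321, 311298988846577680430137399),
  (4305, 156556483935905077348270151),
  (4231, 40499605252900809720463384),
  (4166, 18254247893814440456665973145993303),
  (2123, 22365422810775853444628583),
  (10372, 9908489551911),
  (10946, 5098126180375),
  (139909386, 8031178023667521861070087065136868673454677218297074221724605605130240427298262683192608567055274418298037880194529861185004409886712936307361076005682643406467330974971218793710065397953335907167112441348918665513976918343368329658663),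
  (172125641, 3699532475257080073895686630324818558922905039780330604226469167543),
  (137746699, 707776552936403614718500155969926011025935554848208995554742886201056406058370891233366121754826768400181803070517937692090869051581573452675139572083405178606090058967719905852133059697376904078819140155311065628178016563300791578110246002468939351750214427412957326651452721007595882655763870462097444019570650179952687351302198743486726024596553728327),
  (10497, 861358494234006463034696903344357383013501803837238804951),
  (8194, 2211908157447),
  (8264, 19419551569180728594793111),
  (3148047625481, 4069812093161520303012080363126737514727099741508930252921672119777446055772212984971000569705260027686329741761342050896185042972836803027405372104698812357337311165698720672944090494933064593170313366057517159),
  (2802923481609, 159964684716837536283384791499350737229396836887),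
  (2802919288072, 33900842592151925282180242297914917415),
  (192141578, 13271012310482077622782571261432512381191),
  (6411, 34056369421282319946110720150674238075648760826821182655837481531456208326057292890267712884461971286229843682340638247516161872324591956187846912241022291994761411925322694146184353611344945469809307310859576668802371985386993347263767839984705122830333198951715337234144237737017301223730466470609471928061850165172019697305040847704239043733827141151358720245047130612866698494022838636603691237655),
  (10440, 19254338387975),
  (6155, 96790508876614771360661527),
  (6219, 97319413922693216687096311),
  (8539, 923417968695),
  (11727, 373662154823),
  (11273, 10880410111111189489348772215),
  (11074, 6197637808183),
  (11466, 24408299143223),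
  (11528, 3080606260476998844535),
  (11331, 6193342840871),
  (11651, 300520452812246751303722904042200548602204840411990589479),
  (10762, 9105590584050073042803765296573777142095998642295922146135150873040228712807),
  (11275, 23716809408519),
  (10826, 7318424778026738398200166214605151203807893831498323045111841816150194257943),
  (11595, 24266565222407),
  (11655, 499652038540809038492425831029042793239872574406340379047),
  (11533, 282085515455452659268042726182622974134897445548689719367),
  (0, 2462283207041732969358935866349609759539399)]

theorem ck15 : checkCert 13850 kn15 [34, 1, 26, 10, 24] [] cert15 = true := by decide +kernel

theorem ex15 : Excl [34, 1, 26, 10, 24] [] := check_sound ck15 hk15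

def kn16 : List (List ℕ × List ℕ) := ([34, 1, 26, 10, 24], []) :: kn15
theorem hk16 : ∀ p ∈ kn16, Excl p.1 p.2 := all_cons ex15 hk15

def cert16 : List (ℕ × ℕ) := [
  (8194, 2392541597007944),
  (11520, 287762808904),
  (4128, 2814754062073896),
  (11136, 2349347110952),
  (8265, 77976895956764535403053096),
  (6148, 1407379178520632),
  (11264, 768799146040),
  (2056, 844429225099288),
  (10688, 1181116006424),
  (2321, 157160651697807212582797335),
  (11457, 562),
  (11585, 8820990171857134278103900212641416020825431407634311040693256627032606900391),
  (8208, 2418066587671),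
  (2080, 837518622743),
  (6146, 387),
  (8196, 531),
  (10369, 427884662),
  (8329, 78581358866571785565896727),
  (4098, 1112396529687),
  (10304, 44576990067039079531715184763578615857159),
  (2088, 1119205636156587126444337444323900675312585463281098863645832811660901320477221895290605557041009810766403078569780268861224200306575778010880151622082668283909854787586506391356362845237503915621217581682525626191470747532453019090157639),
  (4165, 39290679433285909962817575),
  (11073, 405105860941292220031068975183236057246501325735014170791),
  (11329, 111746072560271415),
  (10881, 10909953235828021989805654023),
  (2601, 166832058254724310404956216),
  (2344, 386932115288312803244376359),
  (4, 33451458080163251791587415078011975585759367),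
  (6152, 1799591297111),
  (4112, 1318554959959),
  (8, 150323855447),
  (6280, 38762069535111334024183847),
  (4241, 43521919801937176498798616),
  (289, 311902861460574636311838759),
  (136, 38761184091394284137218151),
  (6156, 3777911633041537932197927),
  (4130, 10351445777194503521698295),
  (6284, 116095543058585056360529943),
  (4259, 48962085990202939065499672),
  (2051, 396140823916069294978426208583),
  (2121, 21760959900968534562308615),
  (2145, 29014514818656378330022327),
  (2153, 31432366457887011068968999),
  (12, 717818152140427285758295),
  (8198, 14501991250211658197894035680080281825555258555623434459240988159282061681428365852128289802845734854276234662199774129264564992400226385586287402802430366526853419100253187786237207801939545317966279),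
  (417, 313111787280189055033147464),
  (140, 116094657614867525437227303),
  (8393, 79185821776379095858282536),
  (8262, 8361336962859441904814582793264142124285499922944112279863040499900609914887638914305853107839711539792271441446854243265498239463052300441743122656398116127239),
  (101830727, 82793429827535359994417935024471),
  (8333, 3047230913902648775476307179381388903289871455486407),
  (4260, 3105025131806727),
  (11140, 11145440133143),
  (8205, 116095838206488242848531031),
  (8593, 120893762553086482445238279),
  (8269, 116662522184436173686964247),
  (4133, 49566548900010459811282968),
  (5157, 357842632901744335335194631),
  (4645, 353006929623284031929974807),
  (4197, 348775689254631043112108679),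
  (11653, 11141145165943),
  (2338, 44621380356200745542808126294589799),
  (10720, 71549860184135),
  (6188, 57764381779363781350569178405274199),
  (2082, 331245969722313740726043527),
  (2147, 29618977728463624197898647),
  (6444, 425618331811791089382195799),
  (11586, 5235565133847),
  (105529641, 26144128728854500967271838184917663334740856356252400079601704),
  (191965317, 819121915423186257461884177931568328061379315739123516311),
  (191982853, 2588134000201654250552884546336956696718012267851616290228580583127735371152410610280088883854891711130168274059132995670687311512155842015937122277690776001878542215640199311492340506777313678129389632360987780393171749623957212121885080524268418105751177051578041191),
  (173566625, 5592896984073866856241558123825149050356679),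
  (11716, 8258798364722822522799449574432693802828702273505328713634632582638647037665080424120599418070992744117171479663004150503693089784036013558425537632518697153304335609368384554875283888336512421530569587586494069789431678292448901465890111406522264472393390226143970553807376014423999785392697140281301836936105647472665556432075430817132950515033657392347033018494994237782198087396408827441424185356272996067314743283925144297104657386307656),
  (11461, 11209864642567),
  (11525, 236223201303),
  (8340, 11214159609879),
  (164, 9083855831063),
  (8212, 194638237549576113323246551),
  (8469, 83417062145030160530800680),
  (36, 349379561868627998993810231),
  (1061, 320365342197876761361907784),
  (10592, 70450348556295),
  (10913, 717259538439),
  (1064, 70519068033031),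
  (41, 321574268017491390536613960),
  (169, 388065188096299912155627527),
  (4320, 9411117284269709828180376343806567),
  (4102, 67700436194235394990014471),
  (4231, 40499605252900539137523719),
  (4166, 58047919103248878100545559),
  (10372, 9908489551895),
  (6215, 2847563317271),
  (10885, 9904194584599),
  (11077, 490928650951934972565610207030724991381323076175143108903),
  (2130, 1552514713387047),
  (10754, 6128918331447),
  (6151, 58048214251154813367615559),
  (6279, 59238250604832397683852727),
  (2067, 24783274450009093228724279),
  (2657, 183757019729328843972937047),
  (2665, 186174871368563531161010199),
  (148, 1556912759898167),
  (10436, 10458245365831),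
  (20, 6649110454624839113113703),
  (673, 315529638919418523835957255),
  (681, 392900891374754580563755335),
  (10500, 256917794346878629764959085556322405565205229823494094714973454551),
  (11333, 11038985855890858001361236979223625991),
  (11079, 93619575732556940419005225008565998427746336967),
  (4244, 10114647982103),
  (4117, 44730845621551741248995335),
  (4769, 203100127991075511824547847),
  (4629, 198264424712615208419328023),
  (6312, 27584156289154593035867341482622999),
  (6350, 14993730830423),
  (2584, 2005513504030759),
  (6184, 388066073540019092346372135),
  (6377, 70118582981364060256207175),
  (6159, 62260565153869176779047255),
  (6543, 139027354699397923214460215),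
  (2073, 161996354976265729281622087),
  (2849, 241785459070838397342842887),
  (2329, 234531904153143338030073639),
  (10444, 28050431410231),
  (11272, 18360985190423),
  (11533, 190718076563426238002712139033437063506131156999),
  (11593, 462838267426678751389149019176042399611510046765439702033930125319),
  (11724, 492165345558218954081478337626135),
  (11469, 28802050686983),
  (8604, 28806345654279),
  (8221, 124520540011932775151042567),
  (6560, 37644231452545751508590645666119831),
  (6176, 313112672723904524372149767),
  (6369, 67700731342134801906795079),
  (8214, 29855786164746461544846694700548647),
  (8471, 84021525054837616852074503),
  (8406, 212828793241596171439308823),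
  (4832, 129623421748866019714390237733592608083542599),
  (4311, 19615942924028968946565543344872146086114161809293142147465959),
  (0, 955628546186852689280713804442763287)]

theorem ck16 : checkCert 5464 kn16 [32, 20, 25, 10, 35] [3, 12] cert16 = true := by decide +kernel

theorem ex16 : Excl [32, 20, 25, 10, 35] [3, 12] := check_sound ck16 hk16

def kn17 : List (List ℕ × List ℕ) := ([32, 20, 25, 10, 35], [3, 12]) :: kn16
theorem hk17 : ∀ p ∈ kn17, Excl p.1 p.2 := all_cons ex16 hk16

def cert17 : List (ℕ × ℕ) := [
  (11456, 2418066587704),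
  (4, 422216760033288),
  (10304, 562640715784),
  (4112, 1688854155231272),
  (11072, 1799591297064),
  (11329, 418),
  (8200, 2814754062073928),
  (11648, 1387274436680),
  (4641, 314321303395614253366902855),
  (8465, 157161537141522750641274919),
  (11137, 546),
  (6184, 12240392370342361607176215),
  (8472, 73016753890769923885745966959034375),
  (6441, 89461396095198195770982440),
  (11720, 19529216294919),
  (11465, 20005957664775),
  (2056, 844429225099288),
  (10688, 1181116006424),
  (4241, 43521919801937112074289383),
  (2121, 21760959900968538857275431),
  (11521, 420085814),
  (11265, 5532413068059702729221465207757340679),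
  (32, 287762808855),
  (10752, 1288115295595420228601774119),
  (10881, 317644743146209287),
  (10816, 2897322404841013863695295723662737431),
  (10369, 94997899129126951),
  (11585, 2276332666903),
  (8, 150323855415),
  (11201, 1229905142665445431),
  (10497, 32264945830810396380695753470259494983),
  (10433, 21960832715048030951876983711080644727),
  (4098, 1112396529751),
  (288, 77673483910240229417549991),
  (6146, 1662152343591),
  (4165, 39290679433285974387327000),
  (6217, 77976600808859218611273768),
  (12, 717818152141458077909015),
  (140, 116094657614867387998274119),
  (168979784, 1156487166192997524656891196375501120155526662095306138593520040255769163682070578739891831856225029456263),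
  (190917701, 5727963670120945314952883864835444897048774929976934413143225775278398621300238791503967740243477145051526357003983023802569140001829656644463962417232408313625934957106566216122499236382870354261100184321647461827281877043512029387890983011505615913157786658914061264508271520150666852466098700551),
  (185675205, 258611741365613523587769248251325132337160306476011487511),
  (11652, 10929518071013299255670962522848674448811794681865750591424197405584634117309724105085662267155658465782511446912431091625881151915822873858618940998732917501298892525797671),
  (11141, 11141145165831),
  (11333, 285543292125731926355474434526941733127358463197000232372888585708693587163611575),
  (8332, 11145440133143),
  (11076, 15485609984246172358274652246784347245276139549824527110242775),
  (6285, 3047230913897204257603036862767566039357338314342887),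
  (11205, 16345519583566449437091549627688157575),
  (10437, 8073574146367615009753639156459897976273240471),
  (11460, 166379141281559975682809236815895),
  (6278, 10458245365783),
  (11525, 13873986278903872666502655947816566807),
  (10373, 184940833316574821225110957865727098650655457335),
  (2072, 2228822740294799413567177726222765081314126246933737809165200700458622540413430557040829499500159119724827603289054006629543250948925041497910713200020066674789053558687881687234221165436487996387081750234858194474596838997567817437803835247969115287061111),
  (2328, 50923848839149411577221814439640040526382879467551736095121120457801866511818193046461678376467199953704189413655066812886442708196943823110759),
  (2137, 26596663179427119980609544),
  (4230, 9908489551927),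
  (4103, 40499605252900539137523719),
  (4305, 62864732915771105855144823),
  (4167, 58633492547121759169544215),
  (2122, 989564759965703),
  (2059, 22365422810775853444628487),
  (2315, 99132212356304801743504103),
  (10312, 18154826760199),
  (11592, 1748051689479),
  (11273, 57483539837772668613906198956825988899343713130860840388363713802455937579746832892548773801632456308414268500914146766727394267451552858638369831038789927349243901025838877342107326220621992083587175),
  (10825, 19868518711319),
  (11208, 328638418109592747456006298010439),
  (10505, 57481610143624825724738313975705843707668332615),
  (10761, 816443368620437785191821352644311206258991006593128071255),
  (6412, 19323057864711),
  (6281, 118513394697812184406163847),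
  (6345, 40575458264533002908336135),
  (281, 111856818723859749520070976486877068156011984063611650341401034129145863),
  (152, 8762080176940460162597768434548983),
  (801, 241860721786651848048902823),
  (25, 232415988820912488902034279),
  (0, 1002113293697222451729409918956994567)]

theorem ck17 : checkCert 15130 kn17 [28, 1, 19, 34, 10] [] cert17 = true := by decide +kernel

theorem ex17 : Excl [28, 1, 19, 34, 10] [] := check_sound ck17 hk17

def kn18 : List (List ℕ × List ℕ) := ([28, 1, 19, 34, 10], []) :: kn17
theorem hk18 : ∀ p ∈ kn18, Excl p.1 p.2 := all_cons ex17 hk17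

def cert18 : List (ℕ × ℕ) := [
  (11328, 1318554959928),
  (11073, 418),
  (4100, 844429225099304),
  (10944, 700079669288),
  (32, 2392541597007880),
  (10496, 2211908157448),
  (11713, 562),
  (10817, 59047974),
  (6176, 1937030250519),
  (8196, 2280627634199),
  (8261, 20552919525069447741046791),
  (67651617, 1272825341253462786151),
  (11585, 230988242064714130407209340379184215936247427951305603310552088615),
  (2080, 837518622727),
  (11648, 5958298335975688896519),
  (2337, 87042954160158578715918376),
  (4129, 304942678055),
  (10753, 1823957874854854695),
  (8200, 2814754062073879),
  (4257, 310694525936771186181537831),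
  (6148, 1730871820327),
  (10560, 6465364973161622224045458133198315716615),
  (8265, 21761845344684076915753015),
  (8204, 3929027360492129628454967),
  (5, 1663791417060748970727552581975),
  (10305, 558345748535),
  (10369, 47659922729224499339412719742515457133654931182932941156417037158500953716615662272807),
  (10881, 99550604831185100412512185357161437024449724727),
  (8269, 22970771164298706090459207),
  (8460, 116133617138351749766053975),
  (2050, 422216760033367),
  (161, 48357032784585609369878951),
  (4098, 1112396529751),
  (8, 150323855447),
  (10433, 4205762198432793791045778297826836583),
  (2121, 77976010513048932920066119),
  (2082, 10313666845331683798942103),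
  (4164, 19381182341509749189640263),
  (288, 77673483910240229417550359),
  (6146, 1662152343623),
  (11200, 145601605554525742054675541595182375862827745639),
  (2339, 87647417069966099461701672),
  (2146, 328847007549016167115915447),
  (11264, 2740588580916474033668597783899651595453182828555875788530699468839),
  (4194, 1112739476464584952310290455921561503311308090544264116428749267816613665553850136929431443609834414359774423064757828141718207705121448233618146374427607167924186215477057421352),
  (6243, 371928627045219565866301983645324523077639),
  (4130, 329432876140796907597332695),
  (5155, 319761469583879805480206823),
  (11714, 6335076761639),
  (6179, 328847597844826800699473975),
  (7203, 338500114935814554539524103),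
  (10400, 71481140707383),
  (10947, 37244426971277709286287896359768949223),
  (10464, 72030896521255),
  (2122, 5098126180375),
  (10721, 11058297245134736618951068900690755639),
  (2058, 97318823626882926700921239),
  (2315, 80393862152278049535557672),
  (5156, 71549860184103),
  (268, 1002758899499031),
  (4133, 320365932493687188787036855),
  (4261, 349380152164438220260508583),
  (12, 118474730322233826624930247),
  (141, 42312403686514662519603207),
  (11652, 10183367458855),
  (10884, 8946416877591),
  (10437, 63022604871029252936807447874273085969349476375),
  (10373, 9904194584599),
  (10501, 114303168455050423386070033088982606741902458935),
  (0, 698259416922320324177265031944470100181031)]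

theorem ck18 : checkCert 1669 kn18 [26, 17, 4, 28] [] cert18 = true := by decide +kernel

theorem ex18 : Excl [26, 17, 4, 28] [] := check_sound ck18 hk18

def kn19 : List (List ℕ × List ℕ) := ([26, 17, 4, 28], []) :: kn18
theorem hk19 : ∀ p ∈ kn19, Excl p.1 p.2 := all_cons ex18 hk18

def cert19 : List (ℕ × ℕ) := [
  (10496, 2211908157448),
  (10560, 81604378648),
  (10944, 700079669288),
  (11648, 1387274436680),
  (13525669311531556736624832, 1752041293607862502),
  (169880641, 3489348259692557171627097526576049289432614956749430409988151998602684865133122981298198),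
  (185608833, 50554930618150343177835034247683829663001451142004765588311619631397293796535832674562),
  (3041021406400, 50554930618150343179426030763812576993470708581865270072762174754999308555450281099271),
  (185609216, 11535746375925320849617930380171118212398961847336557100516098195403881578519),
  (13374553653885625399519808, 1741205194246979654),
  (11328, 1219191133167356479248409946275145246427579006551108678587516555763058437182509752121883471341980450029623),
  (11585, 2317524315236466695),
  (11265, 1378664461698596887),
  (10368, 511101108263),
  (0, 68797893535964976967127672008534443543215734807)]

theorem ck19 : checkCert 12429 kn19 [4, 8, 17, 34] [] cert19 = true := by decide +kernel

theorem ex19 : Excl [4, 8, 17, 34] [] := check_sound ck19 hk19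

def kn20 : List (List ℕ × List ℕ) := ([4, 8, 17, 34], []) :: kn19
theorem hk20 : ∀ p ∈ kn20, Excl p.1 p.2 := all_cons ex19 hk19

def cert20 : List (ℕ × ℕ) := [
  (6176, 3377704015495224),
  (11456, 2418066587704),
  (6305, 48357918228300808125939735),
  (8196, 2533279085363272),
  (11584, 837518622792),
  (8337, 155952611321908121466568727),
  (10817, 530),
  (2096, 1662291448714287609020487),
  (3121, 323992414804625828238852168),
  (11296, 71137543323655),
  (10785, 72095321030663),
  (48838726408743265, 63183593824646714152241737377140415734136963095),
  (10497, 188883046080794689034758291301123133087597071235485009642068765573159),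
  (10593, 950247365036519266089066369438517308856783712870954209346286900583224054703919899452742186225520384933895),
  (10720, 1299658777885006764809060087758855),
  (10977, 71545565216775),
  (11105, 1184657834000777239),
  (182479072, 2053900065187550171529860833340583547678991347239259519153415913543),
  (11137, 5430797714140092741101551671),
  (10912, 1300926428485234994210075754627111),
  (11648, 788971931563987282913753140818224060390045735589003657223),
  (0, 16292131210887231129512106396275965959)]

theorem ck20 : checkCert 10784 kn20 [11, 28, 33] [] cert20 = true := by decide +kernel

theorem ex20 : Excl [11, 28, 33] [] := check_sound ck20 hk20

def kn21 : List (List ℕ × List ℕ) := ([11, 28, 33], []) :: kn20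
theorem hk21 : ∀ p ∈ kn21, Excl p.1 p.2 := all_cons ex20 hk20

def cert21 : List (ℕ × ℕ) := [
  (10688, 1181116006424),
  (11136, 2349347110952),
  (11585, 576978950),
  (2080, 7),
  (0, 309237645319)]

theorem ck21 : checkCert 10072 kn21 [10, 20, 26, 33] [] cert21 = true := by decide +kernel

theorem ex21 : Excl [10, 20, 26, 33] [] := check_sound ck21 hk21

def kn22 : List (List ℕ × List ℕ) := ([10, 20, 26, 33], []) :: kn21
theorem hk22 : ∀ p ∈ kn22, Excl p.1 p.2 := all_cons ex21 hk21

def cert22 : List (ℕ × ℕ) := [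
  (10688, 1181116006424),
  (11136, 2349347110952),
  (11712, 1937030250568),
  (11457, 562),
  (11265, 277643302),
  (11329, 472383510),
  (11200, 4119864451461168573769022701591),
  (10433, 1657857376263),
  (10369, 1264385758593024023),
  (10497, 2035767863549100071),
  (10304, 316912650186184559057646387223),
  (11073, 3805699181123127747880681479),
  (10817, 3264100413935773946331791383),
  (0, 2744908030379441708464704385819823238037146563707073192110772453511)]

theorem ck22 : checkCert 16728 kn22 [10, 20, 35] [] cert22 = true := by decide +kernel

theorem ex22 : Excl [10, 20, 35] [] := check_sound ck22 hk22

def kn23 : List (List ℕ × List ℕ) := ([10, 20, 35], []) :: kn22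
theorem hk23 : ∀ p ∈ kn23, Excl p.1 p.2 := all_cons ex22 hk22

def cert23 : List (ℕ × ℕ) := [
  (11072, 1799591297064),
  (11456, 2418066587704),
  (11713, 562),
  (11665, 589832230),
  (11537, 543727622),
  (11601, 560472070),
  (0, 2810732350770041606545954841666279025147959)]

theorem ck23 : checkCert 2816 kn23 [19, 28] [] cert23 = true := by decide +kernel

theorem ex23 : Excl [19, 28] [] := check_sound ck23 hk23

def kn24 : List (List ℕ × List ℕ) := ([19, 28], []) :: kn23
theorem hk24 : ∀ p ∈ kn24, Excl p.1 p.2 := all_cons ex23 hk23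

def cert24 : List (ℕ × ℕ) := [
  (11712, 1937030250568),
  (11457, 562),
  (11233, 59293702),
  (11297, 193478662),
  (11361, 327434246),
  (0, 5592880982713099182622344321130670587904055)]

theorem ck24 : checkCert 16384 kn24 [35] [] cert24 = true := by decide +kernel

theorem ex24 : Excl [35] [] := check_sound ck24 hk24

end CubeCol

/-- Every cube tiling of ℝ^5 contains a column. -/
theorem cube_tiling_dim5_contains_column (T : Set (Fin 5 → ℝ)) (hT : IsCubeTiling T) :
    ∃ s : Fin 5 → ℝ, ∃ i : Fin 5, ∀ k : ℤ, (s + (k : ℝ) • (Pi.single i 1 : Fin 5 → ℝ)) ∈ T := by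
  exact CubeCol.reduction (CubeCol.finish (by decide) CubeCol.ex24) T hT
end
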